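/- arXiv:1804.09611 — 3 statements merged into one kernel-verified Lean document; each statement's English description precedes it below -/
import Mathlib

section
/- Let n ≥ 2, 1 < p < ∞, and let Ω ⊂ ℝⁿ be a bounded open set. Let σ be a nonnegative locally finite Borel measure on Ω whose support is a compact subset of Ω. Suppose there exists u ∈ W^{1,p}_loc(Ω) (i.e., u ∈ L^p_loc(Ω) with weak gradient ∇u ∈ L^p_loc(Ω; ℝⁿ)) such that ∫_Ω |∇u|^{p−2} ∇u · ∇φ dx = ∫_Ω |∇u|^p φ dx + ∫_Ω φ dσ for all φ ∈ C_c^∞(Ω). Then there exists a vector field F : Ω → ℝⁿ with |F|^{1/(p−1)} ∈ M^{1,p}(Ω) such that ∫_Ω φ dσ = −∫_Ω F · ∇φ dx for all φ ∈ C_c^∞(Ω), i.e., σ = div F in the sense of distributions in Ω. -/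
open MeasureTheory Filter Real Metric Bornology
open scoped ENNReal RealInnerProductSpace Topology

noncomputable section

abbrev Euc (n : ℕ) := EuclideanSpace ℝ (Fin n)

/-- `φ` is a test function: smooth, compactly supported, with support contained in `U`. -/
def IsTest (n : ℕ) (U : Set (Euc n)) (φ : Euc n → ℝ) : Prop :=
  ContDiff ℝ (⊤ : ℕ∞) φ ∧ HasCompactSupport φ ∧ tsupport φ ⊆ U

/-- `V` is the weak gradient of `u` on the open set `U`
    (stated against all directions `y`, equivalently componentwise). -/
def IsWeakGrad (n : ℕ) (U : Set (Euc n)) (u : Euc n → ℝ) (V : Euc n → Euc n) : Prop :=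
  ∀ φ : Euc n → ℝ, IsTest n U φ → ∀ y : Euc n,
    ∫ x in U, u x * ⟪gradient φ x, y⟫ = - ∫ x in U, ⟪V x, y⟫ * φ x

/-- The capacity `Cap_{1,p}(K)`. -/
def cap1p (n : ℕ) (p : ℝ) (K : Set (Euc n)) : ℝ :=
  sInf {c : ℝ | ∃ φ : Euc n → ℝ, ContDiff ℝ (⊤ : ℕ∞) φ ∧ HasCompactSupport φ ∧
    (∀ x, 0 ≤ φ x ∧ φ x ≤ 1) ∧ (∀ x ∈ K, 1 ≤ φ x) ∧
    c = ∫ x, (‖gradient φ x‖ ^ p + φ x ^ p)}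

/-- Membership in the space `M^{1,p}(Ω)` of Sobolev multipliers. -/
def MemM1p (n : ℕ) (p : ℝ) (Ω : Set (Euc n)) (f : Euc n → ℝ) : Prop :=
  MemLp f (ENNReal.ofReal p) (volume.restrict Ω) ∧
  ∃ C : ℝ, 0 ≤ C ∧ ∀ K : Set (Euc n), K ⊆ Ω → IsCompact K →
    ∫ x in K, |f x| ^ p ≤ C * cap1p n p K

/-- The norm in `M^{1,p}(Ω)`: the `p`-th root of the least admissible constant. -/
def M1pNorm (n : ℕ) (p : ℝ) (Ω : Set (Euc n)) (f : Euc n → ℝ) : ℝ :=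
  sInf {C : ℝ | 0 ≤ C ∧ ∀ K : Set (Euc n), K ⊆ Ω → IsCompact K →
    ∫ x in K, |f x| ^ p ≤ C * cap1p n p K} ^ (1/p)

/-- `u ∈ W^{1,p}_0(Ω)` with weak gradient `V`. -/
def MemW1p0 (n : ℕ) (p : ℝ) (Ω : Set (Euc n)) (u : Euc n → ℝ) (V : Euc n → Euc n) : Prop :=
  (∀ᵐ x : Euc n, x ∉ Ω → u x = 0) ∧
  MemLp u (ENNReal.ofReal p) volume ∧
  MemLp (fun x => ‖V x‖) (ENNReal.ofReal p) volume ∧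
  IsWeakGrad n Set.univ u V ∧
  ∃ φ : ℕ → Euc n → ℝ, (∀ j, IsTest n Ω (φ j)) ∧
    Tendsto (fun j => (∫ x, |φ j x - u x| ^ p) ^ (1/p)
      + (∫ x, ‖gradient (φ j) x - V x‖ ^ p) ^ (1/p)) atTop (nhds 0)



lemma norm_gradient_eq {n : ℕ} (φ : Euc n → ℝ) (x : Euc n) :
    ‖gradient φ x‖ = ‖fderiv ℝ φ x‖ := by
  simp [gradient]

lemma rpow_conj1 {p q : ℝ} (hpq : p.HolderConjugate q) {s : ℝ} (hs : 0 ≤ s) :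
    (s ^ (p - 1)) ^ q = s ^ p := by
  rw [← Real.rpow_mul hs]
  congr 1
  have := hpq.sub_one_mul_conj
  linarith

lemma lemA_young {p q : ℝ} (hpq : p.HolderConjugate q) {C g s d : ℝ} (hC : 0 ≤ C) (hg : 0 ≤ g)
    (hs : 0 ≤ s) (hd : 0 ≤ d) :
    C * (g * (p * s ^ (p - 1) * d)) ≤ g ^ q * s ^ p + (p * C * d) ^ p := by
  have h0 := hpq.pos
  have h1 : 0 ≤ g * s ^ (p - 1) := by positivity
  have h2 : 0 ≤ p * C * d := by positivity
  have h := Real.young_inequality_of_nonneg h1 h2 hpq.symm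
  have h3 : (g * s ^ (p - 1)) ^ q = g ^ q * s ^ p := by
    rw [Real.mul_rpow hg (by positivity), rpow_conj1 hpq hs]
  have h4 : (g * s ^ (p - 1)) ^ q / q ≤ (g * s ^ (p - 1)) ^ q :=
    div_le_self (by positivity) hpq.symm.lt.le
  have h5 : (p * C * d) ^ p / p ≤ (p * C * d) ^ p :=
    div_le_self (by positivity) hpq.lt.le
  rw [h3] at h4
  calc C * (g * (p * s ^ (p - 1) * d)) = (g * s ^ (p - 1)) * (p * C * d) := by ring
    _ ≤ _ := h
    _ ≤ _ := by rw [h3] at h ⊢; linarith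

lemma test_pow {n : ℕ} {p : ℝ} (hp : 1 < p) {U : Set (Euc n)} {φ : Euc n → ℝ} (hφ : IsTest n U φ)
    {ε : ℝ} (hε : 0 < ε) :
    IsTest n U (fun x => (√(φ x ^ 2 + ε ^ 2)) ^ p - ε ^ p) ∧
    (∀ x, ‖fderiv ℝ (fun x => (√(φ x ^ 2 + ε ^ 2)) ^ p - ε ^ p) x‖ ≤
      p * (√(φ x ^ 2 + ε ^ 2)) ^ (p - 1) * ‖fderiv ℝ φ x‖) ∧
    (∀ x ∉ tsupport φ, (√(φ x ^ 2 + ε ^ 2)) ^ p - ε ^ p = 0) := by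
  obtain ⟨h1, h2, h3⟩ := hφ
  have hpos : ∀ x, 0 < φ x ^ 2 + ε ^ 2 := fun x => by positivity
  have hsm : ContDiff ℝ (⊤ : ℕ∞) (fun x => √(φ x ^ 2 + ε ^ 2)) :=
    ((h1.pow 2).add contDiff_const).sqrt (fun x => (hpos x).ne')
  have hsm2 : ContDiff ℝ (⊤ : ℕ∞) (fun x => (√(φ x ^ 2 + ε ^ 2)) ^ p - ε ^ p) := by
    refine ContDiff.sub ?_ contDiff_const
    exact hsm.rpow_const_of_ne (fun x => (Real.sqrt_pos.2 (hpos x)).ne')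
  have hz : ∀ x, φ x = 0 → (√(φ x ^ 2 + ε ^ 2)) ^ p - ε ^ p = 0 := by
    intro x hx
    simp [hx, Real.sqrt_sq hε.le]
  have hsupp : Function.support (fun x => (√(φ x ^ 2 + ε ^ 2)) ^ p - ε ^ p) ⊆
      Function.support φ := by
    intro x hx hx'
    exact hx (hz x hx')
  have hts : tsupport (fun x => (√(φ x ^ 2 + ε ^ 2)) ^ p - ε ^ p) ⊆ tsupport φ :=
    closure_mono hsupp
  refine ⟨⟨hsm2, h2.mono hsupp, hts.trans h3⟩, ?_, ?_⟩
  · intro x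
    have hd : HasFDerivAt φ (fderiv ℝ φ x) x :=
      (h1.differentiable (by simp) x).hasFDerivAt
    have hq : HasFDerivAt (fun x => φ x ^ 2 + ε ^ 2) ((2 * φ x) • fderiv ℝ φ x) x := by
      simpa using (hd.pow 2).add_const (ε ^ 2)
    have hs := (hq.sqrt (hpos x).ne')
    have hs2 := (hs.rpow_const (p := p) (Or.inr hp.le)).sub_const (ε ^ p)
    have hsp := Real.sqrt_pos.2 (hpos x)
    rw [hs2.fderiv, smul_smul, smul_smul, norm_smul]
    refine mul_le_mul_of_nonneg_right ?_ (norm_nonneg _)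
    rw [mul_assoc, Real.norm_eq_abs, abs_mul, abs_of_nonneg (by positivity :
      0 ≤ p * √(φ x ^ 2 + ε ^ 2) ^ (p - 1))]
    apply mul_le_of_le_one_right (by positivity)
    rw [show 1 / (2 * √(φ x ^ 2 + ε ^ 2)) * (2 * φ x) = φ x / √(φ x ^ 2 + ε ^ 2) by
      field_simp, abs_div, abs_of_pos hsp, div_le_one hsp]
    apply Real.abs_le_sqrt
    nlinarith [sq_nonneg ε]
  · intro x hx
    exact hz x (image_eq_zero_of_notMem_tsupport hx)

lemma lemA {n : ℕ} {p q : ℝ} (hpq : p.HolderConjugate q) {U : Set (Euc n)} (hU : IsOpen U)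
    {μ : Measure (Euc n)} [IsFiniteMeasure μ] {g : Euc n → ℝ} (hg0 : ∀ x, 0 ≤ g x)
    (hg : ∀ K, K ⊆ U → IsCompact K → IntegrableOn (fun x => g x ^ q) K) {C : ℝ} (hC : 0 ≤ C)
    (H : ∀ ψ : Euc n → ℝ, IsTest n U ψ → (∀ x, 0 ≤ ψ x) →
      (∫ x in U, g x ^ q * ψ x) + ∫ x, ψ x ∂μ ≤ C * ∫ x in U, g x * ‖fderiv ℝ ψ x‖)
    {φ : Euc n → ℝ} (hφ : IsTest n U φ) (hφ0 : ∀ x, 0 ≤ φ x) :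
    ∫ x, φ x ^ p ∂μ ≤ (p * C) ^ p * ∫ x, ‖fderiv ℝ φ x‖ ^ p := by
  have hp0 := hpq.pos
  have hp := hpq.lt
  obtain ⟨h1, h2, h3⟩ := id hφ
  set S := tsupport φ with hS
  have hSc : IsCompact S := h2
  have hSm : MeasurableSet S := hSc.isClosed.measurableSet
  have hdc : Continuous (fun x => ‖fderiv ℝ φ x‖ ^ p) :=
    ((h1.continuous_fderiv (by simp)).norm).rpow_const (fun x => Or.inr hp0.le)
  have hdi : Integrable (fun x => ‖fderiv ℝ φ x‖ ^ p) := by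
    refine hdc.integrable_of_hasCompactSupport ?_
    refine (h2.fderiv (𝕜 := ℝ)).mono ?_
    intro x hx hx'
    apply hx
    simp [hx', Real.zero_rpow hp0.ne']
  set D := ∫ x, ‖fderiv ℝ φ x‖ ^ p with hD
  have key : ∀ δ > 0, ∫ x, φ x ^ p ∂μ ≤ (p * C) ^ p * D +
      δ * ((∫ x in S, g x ^ q) + μ.real Set.univ) := by
    intro δ hδ
    set ε := δ ^ (1 / p) with hε'
    have hε : 0 < ε := by positivity
    have hεp : ε ^ p = δ := by
      rw [hε', ← Real.rpow_mul hδ.le]; simp [hp0.ne']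
    obtain ⟨hT, hTd, hTz⟩ := test_pow hp hφ hε
    set s : Euc n → ℝ := fun x => √(φ x ^ 2 + ε ^ 2) with hs
    have hs0 : ∀ x, 0 ≤ s x := fun x => Real.sqrt_nonneg _
    have hsc : Continuous s := by
      have := h1.continuous
      fun_prop
    have hsε : ∀ x, ε ≤ s x := fun x => by
      apply Real.le_sqrt_of_sq_le; nlinarith [sq_nonneg (φ x)]
    have hsφ : ∀ x, φ x ≤ s x := fun x => by
      apply Real.le_sqrt_of_sq_le; nlinarith [sq_nonneg ε]
    have hspc : Continuous (fun x => s x ^ p) := hsc.rpow_const (fun x => Or.inr hp0.le)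
    have hT0 : ∀ x, 0 ≤ s x ^ p - ε ^ p := fun x =>
      sub_nonneg.2 (Real.rpow_le_rpow hε.le (hsε x) hp0.le)
    have hH := H _ hT hT0
    have hgS := hg S h3 hSc
    have hgs : IntegrableOn (fun x => g x ^ q * s x ^ p) S :=
      hgS.mul_continuousOn hspc.continuousOn hSc
    have e1 : ∫ x in U, g x ^ q * (s x ^ p - ε ^ p) = ∫ x in S, g x ^ q * (s x ^ p - ε ^ p) := by
      apply setIntegral_eq_of_subset_of_forall_sdiff_eq_zero hU.measurableSet h3
      intro x hx
      rw [hTz x hx.2, mul_zero]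
    have e2 : C * ∫ x in U, g x * ‖fderiv ℝ (fun x => s x ^ p - ε ^ p) x‖ ≤
        (∫ x in S, g x ^ q * s x ^ p) + (p * C) ^ p * D := by
      have e3 : ∫ x in U, g x * ‖fderiv ℝ (fun x => s x ^ p - ε ^ p) x‖ =
          ∫ x in S, g x * ‖fderiv ℝ (fun x => s x ^ p - ε ^ p) x‖ := by
        apply setIntegral_eq_of_subset_of_forall_sdiff_eq_zero hU.measurableSet h3
        intro x hx
        have h5 := hTd x
        rw [fderiv_of_notMem_tsupport (𝕜 := ℝ) hx.2] at h5
        simp only [norm_zero, mul_zero] at h5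
        rw [le_antisymm h5 (norm_nonneg _), mul_zero]
      rw [e3, ← integral_const_mul]
      have e4 : ∫ x in S, C * (g x * ‖fderiv ℝ (fun x => s x ^ p - ε ^ p) x‖) ≤
          ∫ x in S, (g x ^ q * s x ^ p + (p * C) ^ p * ‖fderiv ℝ φ x‖ ^ p) := by
        apply integral_mono_of_nonneg
        · exact Eventually.of_forall fun x => by have := hg0 x; positivity
        · exact hgs.add (hdi.integrableOn.const_mul _)
        · refine Eventually.of_forall fun x => ?_
          have h6 := lemA_young hpq hC (hg0 x) (hs0 x) (norm_nonneg (fderiv ℝ φ x))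
          rw [Real.mul_rpow (by positivity) (norm_nonneg _)] at h6
          refine le_trans ?_ h6
          have := hg0 x
          have := hTd x
          dsimp only
          gcongr
      refine e4.trans ?_
      rw [integral_add hgs (hdi.integrableOn.const_mul _), integral_const_mul]
      gcongr
      exact setIntegral_le_integral hdi (Eventually.of_forall fun x => by positivity)
    have e5 : ∫ x in S, g x ^ q * (s x ^ p - ε ^ p) =
        (∫ x in S, g x ^ q * s x ^ p) - δ * ∫ x in S, g x ^ q := by
      rw [← integral_const_mul, ← integral_sub hgs (hgS.const_mul _)]
      congr 1
      ext x
      rw [hεp]; ring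
    have hTi : Integrable (fun x => s x ^ p - ε ^ p) μ :=
      hT.1.continuous.integrable_of_hasCompactSupport hT.2.1
    have e6 : ∫ x, φ x ^ p ∂μ ≤ ∫ x, ((s x ^ p - ε ^ p) + δ) ∂μ := by
      apply integral_mono_of_nonneg
      · exact Eventually.of_forall fun x => by have := hφ0 x; positivity
      · exact hTi.add (integrable_const _)
      · refine Eventually.of_forall fun x => ?_
        have := Real.rpow_le_rpow (hφ0 x) (hsφ x) hp0.le
        dsimp only
        rw [hεp]; linarith
    rw [integral_add hTi (integrable_const _), integral_const, smul_eq_mul] at e6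
    rw [e1, e5] at hH
    linarith
  have hM : 0 ≤ (∫ x in S, g x ^ q) + μ.real Set.univ :=
    add_nonneg (integral_nonneg fun x => by have := hg0 x; positivity) measureReal_nonneg
  refine le_of_forall_pos_le_add fun δ hδ => ?_
  refine (key (δ / ((∫ x in S, g x ^ q) + μ.real Set.univ + 1)) (by positivity)).trans ?_
  gcongr
  rw [div_mul_eq_mul_div, div_le_iff₀ (by positivity)]
  exact mul_le_mul_of_nonneg_left (by linarith) hδ.le


/-- the kernel `z / |z|^n` -/
def kerF (n : ℕ) (z : Euc n) : Euc n := (‖z‖ ^ n)⁻¹ • z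

/-- `n * |B_1|` -/
def cS (n : ℕ) : ℝ := (n : ℝ) * (volume : Measure (Euc n)).real (ball 0 1)

lemma cS_pos {n : ℕ} (hn : 2 ≤ n) : 0 < cS n := by
  have : 0 < (volume : Measure (Euc n)).real (ball 0 1) :=
    by
    rw [Measure.real, ENNReal.toReal_pos_iff]; exact ⟨Metric.measure_ball_pos _ _ one_pos, measure_ball_lt_top⟩
  have : (0 : ℝ) < n := by exact_mod_cast (by omega : 0 < n)
  unfold cS; positivity

lemma ker_norm {n : ℕ} (hn : 2 ≤ n) (z : Euc n) : ‖kerF n z‖ = (‖z‖ ^ (n - 1))⁻¹ := by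
  unfold kerF
  obtain ⟨m, rfl⟩ : ∃ m, n = m + 1 := ⟨n - 1, by omega⟩
  rw [norm_smul, norm_inv, norm_pow, norm_norm]
  simp only [Nat.add_sub_cancel]
  rcases eq_or_ne ‖z‖ 0 with h | h
  · have hm : m ≠ 0 := by omega
    simp [h, hm]
  · field_simp
    ring

lemma ker_meas (n : ℕ) : Measurable (kerF n) := by
  unfold kerF; fun_prop

lemma nontriv {n : ℕ} (hn : 2 ≤ n) : Nontrivial (Euc n) := by
  have : Nonempty (Fin n) := ⟨⟨0, by omega⟩⟩
  infer_instance

lemma ker_integrableOn {n : ℕ} (hn : 2 ≤ n) (r : ℝ) :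
    IntegrableOn (fun z : Euc n => (‖z‖ ^ (n - 1))⁻¹) (ball 0 r) := by
  have := nontriv hn
  rw [integrableOn_fun_norm_addHaar volume (f := fun t : ℝ => (t ^ (n - 1))⁻¹)]
  have h : IntegrableOn (fun _ : ℝ => (1 : ℝ)) (Set.Ioo 0 r) := by simp
  refine h.congr_fun (fun y hy => ?_) measurableSet_Ioo
  have : y ≠ 0 := hy.1.ne'
  simp [this]

lemma ker_integral {n : ℕ} (hn : 2 ≤ n) {r : ℝ} (hr : 0 ≤ r) :
    ∫ z in ball (0 : Euc n) r, (‖z‖ ^ (n - 1))⁻¹ = cS n * r := by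
  have := nontriv hn
  rw [← integral_indicator measurableSet_ball]
  have e : ∀ z : Euc n, (ball (0 : Euc n) r).indicator (fun z => (‖z‖ ^ (n - 1))⁻¹) z =
      (Set.Iio r).indicator (fun t : ℝ => (t ^ (n - 1))⁻¹) ‖z‖ := by
    intro z
    simp [Set.indicator]
  simp_rw [e]
  rw [integral_fun_norm_addHaar volume ((Set.Iio r).indicator (fun t : ℝ => (t ^ (n - 1))⁻¹))]
  have e2 : ∫ y in Set.Ioi (0 : ℝ), y ^ (Module.finrank ℝ (Euc n) - 1) •
      (Set.Iio r).indicator (fun t : ℝ => (t ^ (n - 1))⁻¹) y =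
      ∫ y in Set.Ioi (0 : ℝ), (Set.Iio r).indicator (fun _ => (1 : ℝ)) y := by
    apply setIntegral_congr_fun measurableSet_Ioi
    intro y hy
    have : y ≠ 0 := (Set.mem_Ioi.1 hy).ne'
    by_cases h : y < r <;> simp [h, this]
  rw [e2, setIntegral_indicator measurableSet_Iio]
  rw [Set.Ioi_inter_Iio]
  simp [cS, hr]
  ring

lemma rep0 {n : ℕ} (hn : 2 ≤ n) {φ : Euc n → ℝ} (hφ : ContDiff ℝ 1 φ)
    (hc : HasCompactSupport φ) :
    Integrable (fun x => fderiv ℝ φ x (kerF n x)) ∧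
    ∫ x, fderiv ℝ φ x (kerF n x) = - (cS n * φ 0) := by
  have := nontriv hn
  have hdc : Continuous (fderiv ℝ φ) := hφ.continuous_fderiv (by simp)
  have hcd : HasCompactSupport (fderiv ℝ φ) := hc.fderiv (𝕜 := ℝ)
  have hmeas : Measurable (fun x => fderiv ℝ φ x (kerF n x)) := by
    have e : (fun x => fderiv ℝ φ x (kerF n x)) = fun x => (‖x‖ ^ n)⁻¹ * fderiv ℝ φ x x := by
      ext x; simp [kerF]
    rw [e]
    have : Continuous (fun x => fderiv ℝ φ x x) := hdc.clm_apply continuous_id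
    have := this.measurable
    fun_prop
  obtain ⟨M, hM⟩ := hcd.exists_bound_of_continuous hdc
  obtain ⟨r, hr⟩ := hcd.isCompact.isBounded.subset_ball (0 : Euc n)
  have hint : Integrable (fun x => fderiv ℝ φ x (kerF n x)) := by
    have h1 : IntegrableOn (fun x => fderiv ℝ φ x (kerF n x)) (ball 0 r) := by
      refine Integrable.mono' ((ker_integrableOn hn r).const_mul M) hmeas.aestronglyMeasurable ?_
      refine Eventually.of_forall fun x => ?_
      refine (ContinuousLinearMap.le_opNorm _ _).trans ?_
      rw [ker_norm hn]
      exact mul_le_mul_of_nonneg_right (hM x) (by positivity)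
    refine (integrableOn_iff_integrable_of_support_subset ?_).1 h1
    intro x hx
    apply hr
    by_contra hx'
    apply hx
    show fderiv ℝ φ x (kerF n x) = 0
    rw [image_eq_zero_of_notMem_tsupport hx']; simp
  refine ⟨hint, ?_⟩
  set f : Euc n → ℝ := fun x => fderiv ℝ φ x (kerF n x) with hf
  set G : sphere (0 : Euc n) 1 × Set.Ioi (0 : ℝ) → ℝ := fun z => f (z.2.1 • z.1.1) with hG
  have hGe : ∀ x : ({0}ᶜ : Set (Euc n)), G (homeomorphUnitSphereProd (Euc n) x) = f x.1 := by
    intro x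
    have h0 : ‖x.1‖ ≠ 0 := norm_ne_zero_iff.2 x.2
    simp only [hG]
    congr 1
    simp [smul_smul, h0]
  have mp := (volume : Measure (Euc n)).measurePreserving_homeomorphUnitSphereProd
  have hGi : Integrable G ((volume : Measure (Euc n)).toSphere.prod
      (Measure.volumeIoiPow (Module.finrank ℝ (Euc n) - 1))) := by
    rw [← mp.integrable_comp_emb (Homeomorph.measurableEmbedding _)]
    have : G ∘ (homeomorphUnitSphereProd (Euc n)) = f ∘ Subtype.val := by
      ext x; exact hGe x
    rw [this]
    rw [← integrableOn_iff_comap_subtypeVal (measurableSet_singleton _).compl]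
    exact hint.integrableOn
  have e1 : ∫ x, f x = ∫ z, G z ∂((volume : Measure (Euc n)).toSphere.prod
      (Measure.volumeIoiPow (Module.finrank ℝ (Euc n) - 1))) := by
    rw [← mp.integral_comp (Homeomorph.measurableEmbedding _)]
    simp_rw [hGe]
    rw [integral_subtype_comap (measurableSet_singleton _).compl fun x ↦ f x,
        restrict_compl_singleton]
  have e2 : ∀ θ : sphere (0 : Euc n) 1,
      ∫ t, G (θ, t) ∂(Measure.volumeIoiPow (Module.finrank ℝ (Euc n) - 1)) = - φ 0 := by
    intro θ
    have hθ : ‖θ.1‖ = 1 := by simpa using θ.2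
    simp only [Measure.volumeIoiPow, ENNReal.ofReal]
    rw [integral_withDensity_eq_integral_smul
      ((measurable_subtype_coe.pow_const _).real_toNNReal),
      integral_subtype_comap measurableSet_Ioi
        fun a ↦ Real.toNNReal (a ^ (Module.finrank ℝ (Euc n) - 1)) • f (a • θ.1)]
    have hd : ∀ t : ℝ, HasDerivAt (fun t : ℝ => φ (t • θ.1)) (fderiv ℝ φ (t • θ.1) θ.1) t := by
      intro t
      have h1 : HasFDerivAt φ (fderiv ℝ φ (t • θ.1)) (t • θ.1) :=
        (hφ.differentiable (by simp) _).hasFDerivAt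
      have h2 : HasDerivAt (fun t : ℝ => t • θ.1) θ.1 t := by
        simpa using (hasDerivAt_id t).smul_const θ.1
      exact h1.comp_hasDerivAt t h2
    have e3 : ∫ a in Set.Ioi (0 : ℝ),
        Real.toNNReal (a ^ (Module.finrank ℝ (Euc n) - 1)) • f (a • θ.1) =
        ∫ a in Set.Ioi (0 : ℝ), deriv (fun t : ℝ => φ (t • θ.1)) a := by
      apply setIntegral_congr_fun measurableSet_Ioi
      intro a ha
      have ha : 0 < a := ha
      simp only [(hd a).deriv, hf, kerF]
      rw [NNReal.smul_def, Real.coe_toNNReal _ (pow_nonneg ha.le _)]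
      simp only [norm_smul, hθ, map_smul, smul_eq_mul, finrank_euclideanSpace, Fintype.card_fin,
        Real.norm_eq_abs, abs_of_pos ha, mul_one]
      obtain ⟨m, rfl⟩ : ∃ m, n = m + 1 := ⟨n - 1, by omega⟩
      simp only [Nat.add_sub_cancel]
      field_simp
      ring
    rw [e3]
    have hcc : HasCompactSupport (fun t : ℝ => φ (t • θ.1)) := by
      obtain ⟨s, hs⟩ := hc.isCompact.isBounded.subset_closedBall (0 : Euc n)
      refine HasCompactSupport.of_support_subset_isCompact (isCompact_closedBall (0 : ℝ) s) ?_
      intro t ht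
      have := hs (subset_tsupport _ (show t • θ.1 ∈ Function.support φ from ht))
      simpa [norm_smul, hθ] using this
    have hcd : ContDiff ℝ 1 (fun t : ℝ => φ (t • θ.1)) :=
      hφ.comp (contDiff_id.smul contDiff_const)
    rw [HasCompactSupport.integral_Ioi_deriv_eq hcd hcc 0]
    simp
  rw [e1, integral_prod _ hGi]
  simp_rw [e2]
  rw [integral_const, Measure.toSphere_real_apply_univ]
  simp [cS]

lemma rep {n : ℕ} (hn : 2 ≤ n) {φ : Euc n → ℝ} (hφ : ContDiff ℝ 1 φ)
    (hc : HasCompactSupport φ) (y : Euc n) :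
    Integrable (fun x => fderiv ℝ φ x (kerF n (x - y))) ∧
    ∫ x, fderiv ℝ φ x (kerF n (x - y)) = - (cS n * φ y) := by
  have h := rep0 hn (φ := fun x => φ (x + y)) (hφ.comp (contDiff_id.add contDiff_const))
    (hc.comp_homeomorph (Homeomorph.addRight y))
  simp only [fderiv_comp_add_right, zero_add] at h
  constructor
  · have := h.1.comp_sub_right y
    simpa using this
  · rw [← h.2]
    have := integral_sub_right_eq_self (μ := (volume : Measure (Euc n)))
      (fun x => fderiv ℝ φ (x + y) (kerF n x)) y
    simpa using this

lemma rep_le {n : ℕ} (hn : 2 ≤ n) {φ : Euc n → ℝ} (hφ : ContDiff ℝ 1 φ)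
    (hc : HasCompactSupport φ) (y : Euc n) :
    cS n * |φ y| ≤ ∫ x, ‖fderiv ℝ φ x‖ * (‖x - y‖ ^ (n - 1))⁻¹ ∧
    Integrable (fun x => ‖fderiv ℝ φ x‖ * (‖x - y‖ ^ (n - 1))⁻¹) := by
  have hdc : Continuous (fderiv ℝ φ) := hφ.continuous_fderiv (by simp)
  have hcd : HasCompactSupport (fderiv ℝ φ) := hc.fderiv (𝕜 := ℝ)
  obtain ⟨M, hM⟩ := hcd.exists_bound_of_continuous hdc
  obtain ⟨r, hr⟩ := hcd.isCompact.isBounded.subset_ball y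
  have hint : Integrable (fun x => ‖fderiv ℝ φ x‖ * (‖x - y‖ ^ (n - 1))⁻¹) := by
    have h0 : IntegrableOn (fun x : Euc n => (‖x - y‖ ^ (n - 1))⁻¹) (ball y r) := by
      have := ker_integrableOn hn r
      rw [← integrable_indicator_iff measurableSet_ball] at this ⊢
      have := this.comp_sub_right y
      refine this.congr (Eventually.of_forall fun x => ?_)
      simp [Set.indicator, dist_eq_norm]
    have h1 : IntegrableOn (fun x => ‖fderiv ℝ φ x‖ * (‖x - y‖ ^ (n - 1))⁻¹) (ball y r) := by
      refine Integrable.mono' (h0.const_mul M) ?_ ?_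
      · have := hdc.norm.measurable
        exact Measurable.aestronglyMeasurable (by fun_prop)
      refine Eventually.of_forall fun x => ?_
      rw [Real.norm_of_nonneg (by positivity)]
      exact mul_le_mul_of_nonneg_right (hM x) (by positivity)
    refine (integrableOn_iff_integrable_of_support_subset ?_).1 h1
    intro x hx
    apply hr
    by_contra hx'
    apply hx
    show ‖fderiv ℝ φ x‖ * (‖x - y‖ ^ (n - 1))⁻¹ = 0
    rw [image_eq_zero_of_notMem_tsupport hx']; simp
  refine ⟨?_, hint⟩
  have h := (rep hn hφ hc y).2
  have h2 : cS n * |φ y| = ‖∫ x, fderiv ℝ φ x (kerF n (x - y))‖ := by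
    rw [h, norm_neg, norm_mul, Real.norm_of_nonneg (cS_pos hn).le, Real.norm_eq_abs]
  rw [h2]
  refine norm_integral_le_of_norm_le hint (Eventually.of_forall fun x => ?_)
  rw [← ker_norm hn]
  exact ContinuousLinearMap.le_opNorm _ _


set_option linter.unusedSectionVars false

/-- the standard bump -/
def etaB (n : ℕ) : ContDiffBump (0 : Euc n) := ⟨1/2, 3/4, by norm_num, by norm_num⟩

/-- the standard bump as a function -/
def eta (n : ℕ) (x : Euc n) : ℝ := etaB n x

lemma eta_contDiff (n : ℕ) : ContDiff ℝ (⊤ : ℕ∞) (eta n) := (etaB n).contDiff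

lemma eta_cont (n : ℕ) : Continuous (eta n) := (eta_contDiff n).continuous

lemma eta_nonneg {n : ℕ} (x : Euc n) : 0 ≤ eta n x := (etaB n).nonneg

lemma eta_le_one {n : ℕ} (x : Euc n) : eta n x ≤ 1 := (etaB n).le_one

lemma eta_one {n : ℕ} {x : Euc n} (hx : ‖x‖ ≤ 1 / 2) : eta n x = 1 :=
  (etaB n).one_of_mem_closedBall (by simpa [etaB] using hx)

lemma eta_zero {n : ℕ} {x : Euc n} (hx : 3 / 4 ≤ ‖x‖) : eta n x = 0 :=
  (etaB n).zero_of_le_dist (by simpa [etaB] using hx)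

lemma eta_compact (n : ℕ) : HasCompactSupport (eta n) := (etaB n).hasCompactSupport

lemma eta_lip_ex (n : ℕ) : ∃ L : ℝ, 0 < L ∧ ∀ x y : Euc n, |eta n x - eta n y| ≤ L * ‖x - y‖ := by
  obtain ⟨C, hC⟩ := ContDiff.lipschitzWith_of_hasCompactSupport (eta_compact n)
    (eta_contDiff n) (by simp)
  refine ⟨C + 1, by positivity, fun x y => ?_⟩
  have := hC.dist_le_mul x y
  rw [Real.dist_eq, dist_eq_norm] at this
  nlinarith [norm_nonneg (x - y)]

/-- Lipschitz constant of the bump -/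
def etaL (n : ℕ) : ℝ := Classical.choose (eta_lip_ex n)

lemma etaL_pos (n : ℕ) : 0 < etaL n := (Classical.choose_spec (eta_lip_ex n)).1

lemma eta_lip {n : ℕ} (x y : Euc n) : |eta n x - eta n y| ≤ etaL n * ‖x - y‖ :=
  (Classical.choose_spec (eta_lip_ex n)).2 x y

/-- smooth averages -/
def bb {n : ℕ} (τ : Measure (Euc n)) (r : ℝ) (x : Euc n) : ℝ :=
  (r ^ (n - 1))⁻¹ * ∫ y, eta n (r⁻¹ • (x - y)) ∂τ

/-- sharp averages -/
def tt {n : ℕ} (τ : Measure (Euc n)) (r : ℝ) (x : Euc n) : ℝ :=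
  (r ^ (n - 1))⁻¹ * τ.real (ball x r)

/-- dyadic averages -/
def aa {n : ℕ} (τ : Measure (Euc n)) (R : ℝ) (k : ℕ) (x : Euc n) : ℝ :=
  if k = 0 then (R ^ (n - 1))⁻¹ * τ.real Set.univ else bb τ (R / 4 ^ k) x

/-- sums of dyadic averages -/
def AA {n : ℕ} (τ : Measure (Euc n)) (R : ℝ) (k : ℕ) (x : Euc n) : ℝ :=
  ∑ j ∈ Finset.range (k + 1), aa τ R j x

section
variable {n : ℕ} (τ : Measure (Euc n)) [IsFiniteMeasure τ]

lemma eta_integrable (r : ℝ) (x : Euc n) : Integrable (fun y => eta n (r⁻¹ • (x - y))) τ := by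
  refine Integrable.mono' (integrable_const (1 : ℝ)) ?_ (Eventually.of_forall fun y => ?_)
  · exact ((eta_cont n).comp (by fun_prop)).aestronglyMeasurable
  · rw [Real.norm_of_nonneg (eta_nonneg _)]; exact eta_le_one _

lemma bb_nonneg {r : ℝ} (hr : 0 < r) (x : Euc n) : 0 ≤ bb τ r x := by
  unfold bb
  have : 0 ≤ ∫ y, eta n (r⁻¹ • (x - y)) ∂τ := integral_nonneg fun y => eta_nonneg _
  positivity

lemma tt_nonneg {r : ℝ} (hr : 0 < r) (x : Euc n) : 0 ≤ tt τ r x := by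
  unfold tt; positivity

lemma bb_contDiff {r : ℝ} (hr : 0 < r) : ContDiff ℝ (⊤ : ℕ∞) (bb τ r) := by
  unfold bb
  refine contDiff_const.mul ?_
  have h := HasCompactSupport.contDiff_convolution_right (μ := τ) (𝕜 := ℝ)
    (ContinuousLinearMap.mul ℝ ℝ) (f := fun _ : Euc n => (1 : ℝ))
    (g := fun z => eta n (r⁻¹ • z)) (n := (⊤ : ℕ∞))
    ((eta_compact n).comp_homeomorph (Homeomorph.smulOfNeZero r⁻¹ (by positivity)))
    (integrable_const (1 : ℝ)).locallyIntegrable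
    ((eta_contDiff n).comp (by fun_prop))
  have e : (fun x => ∫ y, eta n (r⁻¹ • (x - y)) ∂τ) = MeasureTheory.convolution
      (fun _ : Euc n => (1 : ℝ)) (fun z => eta n (r⁻¹ • z)) (ContinuousLinearMap.mul ℝ ℝ) τ := by
    ext x
    simp [MeasureTheory.convolution_def]
  rw [e]
  exact h

lemma bb_le_tt {r : ℝ} (hr : 0 < r) (x : Euc n) : bb τ r x ≤ tt τ r x := by
  unfold bb tt
  refine mul_le_mul_of_nonneg_left ?_ (by positivity)
  have : τ.real (ball x r) = ∫ y, (ball x r).indicator (fun _ => (1 : ℝ)) y ∂τ := by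
    rw [integral_indicator_const _ measurableSet_ball]; simp
  rw [this]
  refine integral_mono (eta_integrable τ r x) ((integrable_const (1 : ℝ)).indicator measurableSet_ball)
    fun y => ?_
  by_cases hy : y ∈ ball x r
  · simp only [hy, Set.indicator_of_mem]; exact eta_le_one _
  · simp only [hy, not_false_eq_true, Set.indicator_of_notMem]
    rw [eta_zero]
    rw [norm_smul, norm_inv, Real.norm_of_nonneg hr.le]
    rw [mem_ball, not_lt, dist_comm, dist_eq_norm] at hy
    rw [← div_eq_inv_mul, le_div_iff₀ hr]; linarith

lemma le_bb {r : ℝ} (hr : 0 < r) (x : Euc n) :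
    τ.real (ball x (r / 2)) ≤ r ^ (n - 1) * bb τ r x := by
  unfold bb
  rw [mul_inv_cancel_left₀ (by positivity)]
  have : τ.real (ball x (r / 2)) = ∫ y, (ball x (r / 2)).indicator (fun _ => (1 : ℝ)) y ∂τ := by
    rw [integral_indicator_const _ measurableSet_ball]; simp
  rw [this]
  refine integral_mono ((integrable_const (1 : ℝ)).indicator measurableSet_ball)
    (eta_integrable τ r x) fun y => ?_
  by_cases hy : y ∈ ball x (r / 2)
  · simp only [hy, Set.indicator_of_mem]
    rw [eta_one]
    rw [norm_smul, norm_inv, Real.norm_of_nonneg hr.le]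
    rw [mem_ball, dist_comm, dist_eq_norm] at hy
    rw [← div_eq_inv_mul, div_le_iff₀ hr]; linarith
  · simp only [hy, not_false_eq_true, Set.indicator_of_notMem]; exact eta_nonneg _

lemma bb_fderiv {r : ℝ} (hr : 0 < r) (x : Euc n) :
    ‖fderiv ℝ (bb τ r) x‖ ≤ etaL n * r⁻¹ * tt τ r x := by
  have hL := etaL_pos n
  refine norm_fderiv_le_of_lip' ℝ (mul_nonneg (by positivity) (tt_nonneg τ hr x)) ?_
  filter_upwards [ball_mem_nhds x (show 0 < r / 4 by positivity)] with y hy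
  unfold bb tt
  rw [← mul_sub, ← integral_sub (eta_integrable τ r y) (eta_integrable τ r x), norm_mul,
    Real.norm_of_nonneg (show 0 ≤ (r ^ (n - 1))⁻¹ by positivity)]
  have : ‖∫ z, eta n (r⁻¹ • (y - z)) - eta n (r⁻¹ • (x - z)) ∂τ‖ ≤
      ∫ z, (ball x r).indicator (fun _ => etaL n * r⁻¹ * ‖y - x‖) z ∂τ := by
    refine norm_integral_le_of_norm_le ((integrable_const _).indicator measurableSet_ball)
      (Eventually.of_forall fun z => ?_)
    by_cases hz : z ∈ ball x r
    · simp only [hz, Set.indicator_of_mem]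
      refine (eta_lip _ _).trans (le_of_eq ?_)
      rw [← smul_sub, norm_smul, norm_inv, Real.norm_of_nonneg hr.le]
      simp; ring
    · simp only [hz, not_false_eq_true, Set.indicator_of_notMem]
      rw [mem_ball, not_lt, dist_comm, dist_eq_norm] at hz
      rw [mem_ball, dist_comm, dist_eq_norm] at hy
      have h2 : ‖x - z‖ ≤ ‖x - y‖ + ‖y - z‖ := norm_sub_le_norm_sub_add_norm_sub _ _ _
      rw [eta_zero, eta_zero]
      · simp
      · rw [norm_smul, norm_inv, Real.norm_of_nonneg hr.le, ← div_eq_inv_mul, le_div_iff₀ hr]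
        linarith
      · rw [norm_smul, norm_inv, Real.norm_of_nonneg hr.le, ← div_eq_inv_mul, le_div_iff₀ hr]
        linarith
  rw [integral_indicator_const _ measurableSet_ball, smul_eq_mul] at this
  calc _ ≤ (r ^ (n - 1))⁻¹ * (τ.real (ball x r) * (etaL n * r⁻¹ * ‖y - x‖)) :=
        mul_le_mul_of_nonneg_left this (by positivity)
    _ = _ := by ring

lemma aa_nonneg {R : ℝ} (hR : 0 < R) (k : ℕ) (x : Euc n) : 0 ≤ aa τ R k x := by
  unfold aa
  split_ifs
  · positivity
  · exact bb_nonneg τ (by positivity) x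

lemma aa_contDiff {R : ℝ} (hR : 0 < R) (k : ℕ) : ContDiff ℝ (⊤ : ℕ∞) (aa τ R k) := by
  unfold aa
  by_cases hk : k = 0
  · simp only [hk, if_true]; exact contDiff_const
  · simp only [hk, if_false]; exact bb_contDiff τ (by positivity)

lemma tt_le_aa {R : ℝ} (hR : 0 < R) (k : ℕ) {x y : Euc n} (h : dist x y ≤ R / 4 ^ (k + 1)) :
    tt τ (R / 4 ^ (k + 1)) x ≤ 4 ^ (n - 1) * aa τ R k y := by
  set r := R / 4 ^ (k + 1) with hr
  have hr0 : 0 < r := by positivity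
  have h4 : R / 4 ^ k = 4 * r := by rw [hr, pow_succ]; field_simp
  have e1 : (4 : ℝ) ^ (n - 1) * ((4 * r) ^ (n - 1))⁻¹ = (r ^ (n - 1))⁻¹ := by
    rw [mul_pow]; field_simp
  unfold aa tt
  by_cases hk : k = 0
  · simp only [hk, if_true]
    have : R = 4 * r := by rw [hk] at h4; simpa using h4
    rw [this, ← mul_assoc, e1]
    exact mul_le_mul_of_nonneg_left (measureReal_mono (Set.subset_univ _)) (by positivity)
  · simp only [hk, if_false, h4]
    have h1 : τ.real (ball x r) ≤ τ.real (ball y (4 * r / 2)) :=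
      measureReal_mono (ball_subset_ball' (by linarith))
    have h2 := le_bb τ (show 0 < 4 * r by positivity) y
    rw [← e1, mul_assoc]
    refine mul_le_mul_of_nonneg_left ?_ (by positivity)
    rw [inv_mul_le_iff₀ (by positivity)]
    linarith

lemma aa_le_aa {R : ℝ} (hR : 0 < R) (k : ℕ) {x y : Euc n} (h : dist x y ≤ R / 4 ^ (k + 1)) :
    aa τ R (k + 1) x ≤ 4 ^ (n - 1) * aa τ R k y := by
  refine le_trans ?_ (tt_le_aa τ hR k h)
  simp only [aa, Nat.add_eq_zero_iff, one_ne_zero, and_false, if_false]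
  exact bb_le_tt τ (by positivity) x

lemma aa_fderiv {R : ℝ} (hR : 0 < R) (k : ℕ) (x : Euc n) :
    R / 4 ^ (k + 1) * ‖fderiv ℝ (aa τ R (k + 1)) x‖ ≤ etaL n * 4 ^ (n - 1) * aa τ R k x := by
  have hL := etaL_pos n
  set r := R / 4 ^ (k + 1) with hr
  have hr0 : 0 < r := by positivity
  have h1 := tt_le_aa τ hR k (x := x) (y := x) (by simp; positivity)
  have h2 := bb_fderiv τ hr0 x
  have e : aa τ R (k + 1) = bb τ r := by
    ext y; simp [aa, hr]
  rw [e]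
  calc r * ‖fderiv ℝ (bb τ r) x‖ ≤ r * (etaL n * r⁻¹ * tt τ r x) :=
        mul_le_mul_of_nonneg_left h2 hr0.le
    _ = etaL n * tt τ r x := by field_simp
    _ ≤ etaL n * (4 ^ (n - 1) * aa τ R k x) := mul_le_mul_of_nonneg_left h1 hL.le
    _ = _ := by ring

lemma AA_succ (R : ℝ) (k : ℕ) (x : Euc n) :
    AA τ R (k + 1) x = AA τ R k x + aa τ R (k + 1) x := by
  unfold AA; rw [Finset.sum_range_succ]

lemma AA_zero (R : ℝ) (x : Euc n) : AA τ R 0 x = aa τ R 0 x := by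
  simp [AA]

lemma AA_nonneg {R : ℝ} (hR : 0 < R) (k : ℕ) (x : Euc n) : 0 ≤ AA τ R k x :=
  Finset.sum_nonneg fun j _ => aa_nonneg τ hR j x

lemma AA_contDiff {R : ℝ} (hR : 0 < R) (k : ℕ) : ContDiff ℝ (⊤ : ℕ∞) (AA τ R k) := by
  unfold AA
  exact ContDiff.sum fun j _ => aa_contDiff τ hR j

lemma AA_cont {R : ℝ} (hR : 0 < R) (k : ℕ) : Continuous (AA τ R k) :=
  (AA_contDiff τ hR k).continuous

lemma AA_mono {R : ℝ} (hR : 0 < R) (x : Euc n) : Monotone (fun k => AA τ R k x) :=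
  monotone_nat_of_le_succ fun k => by
    rw [AA_succ]; linarith [aa_nonneg τ hR (k + 1) x]

lemma AA_pos {R : ℝ} (hR : 0 < R) (hτ : τ ≠ 0) (k : ℕ) (x : Euc n) : 0 < AA τ R k x := by
  refine lt_of_lt_of_le ?_ (AA_mono τ hR x (Nat.zero_le k))
  have : 0 < τ.real Set.univ := by
    rw [measureReal_def, ENNReal.toReal_pos_iff]
    exact ⟨by simpa [pos_iff_ne_zero] using hτ, measure_lt_top _ _⟩
  simp only [AA_zero, aa, if_true]
  positivity

lemma AA_comp {R : ℝ} (hR : 0 < R) (k : ℕ) {x y : Euc n} (h : dist x y ≤ R / 4 ^ k) :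
    AA τ R k x ≤ (1 + 4 ^ (n - 1)) * AA τ R k y := by
  cases k with
  | zero => 
    have := aa_nonneg τ hR 0 y
    simp only [AA_zero, aa, if_true] at this ⊢
    nlinarith [pow_pos (show (0:ℝ) < 4 by norm_num) (n-1)]
  | succ k =>
    have h0 : AA τ R (k + 1) x = ∑ j ∈ Finset.range (k + 1), aa τ R (j + 1) x + aa τ R 0 x := by
      unfold AA; rw [Finset.sum_range_succ']
    have h1 : ∑ j ∈ Finset.range (k + 1), aa τ R (j + 1) x ≤ 4 ^ (n - 1) * AA τ R k y := by
      unfold AA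
      rw [Finset.mul_sum]
      refine Finset.sum_le_sum fun j hj => aa_le_aa τ hR j (h.trans ?_)
      have : j + 1 ≤ k + 1 := by simp at hj; omega
      gcongr
      norm_num
    have h2 := AA_mono τ hR y (Nat.le_succ k)
    have h3 := AA_mono τ hR y (Nat.zero_le (k + 1))
    have h4 : aa τ R 0 x = AA τ R 0 y := by simp [AA_zero, aa]
    simp only at h2 h3
    rw [h0, h4]
    nlinarith [pow_pos (show (0:ℝ) < 4 by norm_num) (n-1)]

lemma aa_le_bound {R : ℝ} (hR : 0 < R) (k : ℕ) (x : Euc n) :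
    aa τ R k x ≤ ((R / 4 ^ k) ^ (n - 1))⁻¹ * τ.real Set.univ := by
  unfold aa
  split_ifs with hk
  · simp [hk]
  · refine (bb_le_tt τ (by positivity) x).trans ?_
    exact mul_le_mul_of_nonneg_left (measureReal_mono (Set.subset_univ _)) (by positivity)

lemma AA_bdd {R : ℝ} (hR : 0 < R) (k : ℕ) : ∃ M, 0 ≤ M ∧ ∀ x, AA τ R k x ≤ M :=
  ⟨∑ j ∈ Finset.range (k + 1), ((R / 4 ^ j) ^ (n - 1))⁻¹ * τ.real Set.univ,
    Finset.sum_nonneg fun j _ => by positivity,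
    fun x => Finset.sum_le_sum fun j _ => aa_le_bound τ hR j x⟩

end


lemma conv_ineq {q x y : ℝ} (hq : 1 ≤ q) (hy : 0 ≤ y) (hx : 0 ≤ x) :
    x ^ q ≤ y ^ q + q * (x ^ (q - 1) * (x - y)) := by
  rcases hx.eq_or_lt with h | h
  · subst h
    rw [Real.zero_rpow (by linarith)]
    rcases eq_or_lt_of_le hq with h1 | h1
    · subst h1; simp
    · rw [Real.zero_rpow (by linarith)]; simp; positivity
  · have h1 := one_add_mul_self_le_rpow_one_add (s := y / x - 1) (p := q)
      (by have : 0 ≤ y / x := by positivity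
          linarith) hq
    have h2 : (1 + (y / x - 1)) = y / x := by ring
    rw [h2, Real.div_rpow hy hx, le_div_iff₀ (by positivity)] at h1
    have h3 : x ^ q = x ^ (q - 1) * x := by
      rw [← Real.rpow_add_one h.ne']; congr 1; ring
    have h4 : (1 + q * (y / x - 1)) * x ^ q = x ^ q + q * (x ^ (q - 1) * (y - x)) := by
      rw [add_mul, one_mul, mul_assoc]; congr 2
      rw [h3]; field_simp
    rw [h4] at h1
    nlinarith

lemma conc_ineq {θ x y : ℝ} (h0 : 0 ≤ θ) (h1 : θ ≤ 1) (hy : 0 ≤ y) (h : 0 < x) :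
    y ^ θ + θ * (x ^ (θ - 1) * (x - y)) ≤ x ^ θ := by
  have h1 := rpow_one_add_le_one_add_mul_self (s := y / x - 1) (p := θ)
      (by have : 0 ≤ y / x := by positivity
          linarith) h0 h1
  have h2 : (1 + (y / x - 1)) = y / x := by ring
  rw [h2, Real.div_rpow hy h.le, div_le_iff₀ (by positivity)] at h1
  have h3 : x ^ θ = x ^ (θ - 1) * x := by
    rw [← Real.rpow_add_one h.ne']; congr 1; ring
  have h4 : (1 + θ * (y / x - 1)) * x ^ θ = x ^ θ + θ * (x ^ (θ - 1) * (y - x)) := by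
    rw [add_mul, one_mul, mul_assoc]; congr 2
    rw [h3]; field_simp
  rw [h4] at h1
  nlinarith

lemma seq_S1 {q : ℝ} (hq : 1 ≤ q) {a A : ℕ → ℝ} (ha : ∀ k, 0 ≤ a k) (h0 : A 0 = a 0)
    (hA : ∀ k, A (k + 1) = A k + a (k + 1)) (N : ℕ) :
    A N ^ q ≤ q * ∑ k ∈ Finset.range (N + 1), a k * A k ^ (q - 1) := by
  have hA0 : ∀ k, 0 ≤ A k := by
    intro k; induction k with
    | zero => rw [h0]; exact ha 0
    | succ k ih => rw [hA]; linarith [ha (k + 1)]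
  induction N with
  | zero =>
    have := conv_ineq hq le_rfl (hA0 0)
    rw [Real.zero_rpow (by linarith)] at this
    simp only [zero_add, Finset.sum_range_one, ← h0]
    linarith
  | succ N ih =>
    rw [Finset.sum_range_succ, mul_add]
    have := conv_ineq hq (hA0 N) (hA0 (N + 1))
    have e : A (N + 1) - A N = a (N + 1) := by rw [hA]; ring
    rw [e, mul_comm (A (N + 1) ^ (q - 1))] at this
    linarith

lemma seq_S0 {s a w : ℕ → ℝ} (hw : Antitone w) (hw0 : ∀ k, 0 ≤ w k)
    (ha : ∀ k, 0 ≤ a k) (hs0 : s 0 = 0) (hs : ∀ k, s (k + 1) = s k / 4 + a k) (N : ℕ) :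
    ∑ k ∈ Finset.range (N + 1), s k * w k ≤ 4 / 3 * ∑ k ∈ Finset.range (N + 1), a k * w k := by
  have hsn : ∀ k, 0 ≤ s k := by
    intro k; induction k with
    | zero => rw [hs0]
    | succ k ih => rw [hs]; linarith [ha k]
  have key : ∀ N, ∑ k ∈ Finset.range (N + 1), s k * w k ≤
      1 / 4 * ∑ k ∈ Finset.range N, s k * w k + ∑ k ∈ Finset.range N, a k * w k := by
    intro N
    rw [Finset.sum_range_succ', hs0, zero_mul, add_zero, Finset.mul_sum, ← Finset.sum_add_distrib]
    refine Finset.sum_le_sum fun k _ => ?_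
    have h1 : s (k + 1) * w (k + 1) ≤ s (k + 1) * w k :=
      mul_le_mul_of_nonneg_left (hw (Nat.le_succ k)) (hsn _)
    rw [hs] at h1 ⊢
    linarith
  have h1 := key N
  have h2 : ∑ k ∈ Finset.range N, s k * w k ≤ ∑ k ∈ Finset.range (N + 1), s k * w k := by
    rw [Finset.sum_range_succ]; nlinarith [mul_nonneg (hsn N) (hw0 N)]
  have h3 : ∑ k ∈ Finset.range N, a k * w k ≤ ∑ k ∈ Finset.range (N + 1), a k * w k := by
    rw [Finset.sum_range_succ]; nlinarith [mul_nonneg (ha N) (hw0 N)]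
  linarith

lemma seq_S3 {q : ℝ} (hq : 1 < q) {a A s : ℕ → ℝ} (ha : ∀ k, 0 ≤ a k) (h0 : A 0 = a 0)
    (hpos : 0 < a 0)
    (hA : ∀ k, A (k + 1) = A k + a (k + 1)) (hs0 : s 0 = 0)
    (hs : ∀ k, s (k + 1) = s k / 4 + a k) (N : ℕ) :
    (q - 1) * ∑ k ∈ Finset.range (N + 1), s k * A k ^ (q - 2) ≤ 4 / 3 * q * A N ^ (q - 1) := by
  have hmono : Monotone A := monotone_nat_of_le_succ fun k => by rw [hA]; linarith [ha (k + 1)]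
  have hA0 : ∀ k, 0 < A k := fun k => lt_of_lt_of_le (by rw [h0]; exact hpos) (hmono (Nat.zero_le k))
  have hsn : ∀ k, 0 ≤ s k := by
    intro k; induction k with
    | zero => rw [hs0]
    | succ k ih => rw [hs]; linarith [ha k]
  have hsum : ∀ N, ∑ k ∈ Finset.range (N + 1), a k = A N := by
    intro N; induction N with
    | zero => simp [h0]
    | succ N ih => rw [Finset.sum_range_succ, ih, hA]
  have hAN := hA0 N
  have hpw : A N ^ (q - 1) = A N * A N ^ (q - 2) := by
    rw [mul_comm, ← Real.rpow_add_one hAN.ne']; congr 1; ring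
  rcases le_total 2 q with h2 | h2
  · have h3 : ∑ k ∈ Finset.range (N + 1), s k * A k ^ (q - 2) ≤
        (∑ k ∈ Finset.range (N + 1), s k * 1) * A N ^ (q - 2) := by
      rw [Finset.sum_mul]
      refine Finset.sum_le_sum fun k hk => ?_
      rw [mul_one]
      refine mul_le_mul_of_nonneg_left ?_ (hsn k)
      exact Real.rpow_le_rpow (hA0 k).le (hmono (by simp at hk; omega)) (by linarith)
    have h4 := seq_S0 (w := fun _ => 1) antitone_const (fun _ => zero_le_one) ha hs0 hs N
    simp only [mul_one, hsum] at h3 h4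
    have h5 : (∑ k ∈ Finset.range (N + 1), s k) * A N ^ (q - 2) ≤ 4 / 3 * A N * A N ^ (q - 2) :=
      mul_le_mul_of_nonneg_right h4 (by positivity)
    rw [hpw]
    have h6 : 0 ≤ A N * A N ^ (q - 2) := by positivity
    nlinarith
  · have hw : Antitone (fun k => A k ^ (q - 2)) := by
      intro i j hij
      exact Real.rpow_le_rpow_of_nonpos (hA0 i) (hmono hij) (by linarith)
    have h4 := seq_S0 hw (fun k => (Real.rpow_pos_of_pos (hA0 k) _).le) ha hs0 hs N
    have h5 : ∀ N, (q - 1) * ∑ k ∈ Finset.range (N + 1), a k * A k ^ (q - 2) ≤ A N ^ (q - 1) := by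
      intro N; induction N with
      | zero =>
        simp only [zero_add, Finset.sum_range_one, ← h0]
        have : A 0 * A 0 ^ (q - 2) = A 0 ^ (q - 1) := by
          rw [mul_comm, ← Real.rpow_add_one (hA0 0).ne']; congr 1; ring
        rw [this]
        have := Real.rpow_pos_of_pos (hA0 0) (q - 1)
        nlinarith
      | succ N ih =>
        rw [Finset.sum_range_succ, mul_add]
        have := conc_ineq (θ := q - 1) (by linarith) (by linarith) (hA0 N).le (hA0 (N + 1))
        have e : A (N + 1) - A N = a (N + 1) := by rw [hA]; ring
        have e2 : q - 1 - 1 = q - 2 := by ring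
        rw [e, mul_comm (A (N + 1) ^ (q - 1 - 1)), e2] at this
        linarith
    have h6 := h5 N
    have h7 : (q - 1) * ∑ k ∈ Finset.range (N + 1), s k * A k ^ (q - 2) ≤
      (q - 1) * (4 / 3 * ∑ k ∈ Finset.range (N + 1), a k * A k ^ (q - 2)) :=
      mul_le_mul_of_nonneg_left h4 (by linarith)
    have h8 := Real.rpow_pos_of_pos hAN (q - 1)
    nlinarith

lemma seq_geo {R : ℝ} (hR : 0 ≤ R) (N : ℕ) :
    ∑ k ∈ Finset.range (N + 1), R / 4 ^ k ≤ 2 * R := by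
  have h : ∑ k ∈ Finset.range (N + 1), R / 4 ^ k ≤ 2 * R - R / 4 ^ N := by
    induction N with
    | zero => simp; linarith
    | succ N ih =>
      rw [Finset.sum_range_succ]
      have : R / 4 ^ (N + 1) = R / 4 ^ N / 4 := by rw [pow_succ]; field_simp
      have h2 : 0 ≤ R / 4 ^ N := by positivity
      linarith
  have h2 : 0 ≤ R / 4 ^ N := by positivity
  linarith

lemma seq_S2 {θ R : ℝ} (hθ : 0 ≤ θ) (hR : 0 ≤ R) {A : ℕ → ℝ} (hA0 : ∀ k, 0 ≤ A k)
    (hmono : Monotone A) (N : ℕ) :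
    ∑ k ∈ Finset.range (N + 1), R / 4 ^ k * A k ^ θ ≤ 2 * R * A N ^ θ := by
  calc _ ≤ ∑ k ∈ Finset.range (N + 1), R / 4 ^ k * A N ^ θ := by
        refine Finset.sum_le_sum fun k hk => ?_
        refine mul_le_mul_of_nonneg_left ?_ (by positivity)
        exact Real.rpow_le_rpow (hA0 k) (hmono (by simp at hk; omega)) hθ
    _ = (∑ k ∈ Finset.range (N + 1), R / 4 ^ k) * A N ^ θ := by rw [Finset.sum_mul]
    _ ≤ _ := mul_le_mul_of_nonneg_right (seq_geo hR N) (Real.rpow_nonneg (hA0 N) _)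

lemma seq_S4 {q R G : ℝ} (hq : 1 ≤ q) (hR : 0 ≤ R) {a A : ℕ → ℝ} (ha : ∀ k, 0 ≤ a k) (h0 : A 0 = a 0)
    (hA : ∀ k, A (k + 1) = A k + a (k + 1)) (hG : ∀ k, R / 4 ^ k * A k ^ (q - 1) ≤ G) (N : ℕ) :
    ∑ k ∈ Finset.range (N + 1), R / 4 ^ k * A k ^ q ≤ 4 / 3 * (q * G) * A N := by
  have hmono : Monotone A := monotone_nat_of_le_succ fun k => by rw [hA]; linarith [ha (k + 1)]
  have hA0 : ∀ k, 0 ≤ A k := fun k => le_trans (by rw [h0]; exact ha 0) (hmono (Nat.zero_le k))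
  have hstep : ∀ k, R / 4 ^ (k + 1) * A (k + 1) ^ q ≤ 1 / 4 * (R / 4 ^ k * A k ^ q) +
      q * G * a (k + 1) := by
    intro k
    have h1 := conv_ineq hq (hA0 k) (hA0 (k + 1))
    have e : A (k + 1) - A k = a (k + 1) := by rw [hA]; ring
    rw [e] at h1
    have h2 : R / 4 ^ (k + 1) = R / 4 ^ k / 4 := by rw [pow_succ]; field_simp
    have h3 : 0 ≤ R / 4 ^ (k + 1) := by positivity
    have h4 := mul_le_mul_of_nonneg_left h1 h3
    have h5 := mul_le_mul_of_nonneg_right (hG (k + 1)) (mul_nonneg (by linarith : 0 ≤ q) (ha (k + 1)))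
    calc _ ≤ _ := h4
      _ = 1 / 4 * (R / 4 ^ k * A k ^ q) + R / 4 ^ (k + 1) * A (k + 1) ^ (q - 1) * (q * a (k + 1)) := by
        rw [mul_add, h2]; ring
      _ ≤ _ := by linarith
  have hz : R / 4 ^ 0 * A 0 ^ q ≤ q * G * a 0 := by
    have h1 := conv_ineq hq le_rfl (hA0 0)
    rw [Real.zero_rpow (by linarith), zero_add, sub_zero] at h1
    have h3 : 0 ≤ R / 4 ^ 0 := by positivity
    have h4 := mul_le_mul_of_nonneg_left h1 h3
    have h5 := mul_le_mul_of_nonneg_right (hG 0) (mul_nonneg (by linarith : 0 ≤ q) (hA0 0))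
    rw [← h0]
    linarith
  have hsum : ∀ N, ∑ k ∈ Finset.range (N + 1), R / 4 ^ k * A k ^ q +
      1 / 3 * (R / 4 ^ N * A N ^ q) ≤ 4 / 3 * (q * G) * A N := by
    intro N; induction N with
    | zero => 
      rw [← h0] at hz
      simp only [zero_add, Finset.sum_range_one]
      linarith
    | succ N ih =>
      rw [Finset.sum_range_succ, hA]
      have := hstep N
      rw [hA] at this
      linarith
  have := hsum N
  have h6 : 0 ≤ R / 4 ^ N * A N ^ q := mul_nonneg (by positivity) (Real.rpow_nonneg (hA0 N) _)
  linarith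

lemma seq_S5 {p R H : ℝ} (hp : 1 < p) (hR : 0 < R) (hH : 0 ≤ H) {a A : ℕ → ℝ} (h0 : A 0 = a 0)
    (hA : ∀ k, A (k + 1) = A k + a (k + 1)) (hG : ∀ k, a k ≤ H * (R / 4 ^ k) ^ (1 - p)) (N : ℕ) :
    A N ≤ H / (1 - 4 ^ (1 - p)) * (R / 4 ^ N) ^ (1 - p) := by
  have h4 : (4 : ℝ) ^ (1 - p) < 1 := Real.rpow_lt_one_of_one_lt_of_neg (by norm_num) (by linarith)
  have h5 : 0 < (4 : ℝ) ^ (1 - p) := by positivity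
  have h6 : 0 < 1 - (4 : ℝ) ^ (1 - p) := by linarith
  induction N with
  | zero =>
    rw [h0]
    refine (hG 0).trans (mul_le_mul_of_nonneg_right ?_ (by positivity))
    rw [le_div_iff₀ h6]; nlinarith
  | succ N ih =>
    rw [hA]
    have e : R / 4 ^ N = 4 * (R / 4 ^ (N + 1)) := by rw [pow_succ]; field_simp
    rw [e, Real.mul_rpow (by norm_num) (by positivity)] at ih
    have := hG (N + 1)
    calc _ ≤ _ := add_le_add ih this
      _ = _ := by field_simp; ring


/-- auxiliary recursive sequence -/
def sseq (a : ℕ → ℝ) : ℕ → ℝ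
  | 0 => 0
  | k + 1 => sseq a k / 4 + a k

/-- the test function -/
def hh {n : ℕ} (τ : Measure (Euc n)) (R q : ℝ) (N : ℕ) (x : Euc n) : ℝ :=
  ∑ k ∈ Finset.range (N + 1), R / 4 ^ k * AA τ R k x ^ (q - 1)

/-- volume of unit ball -/
def vB (n : ℕ) : ℝ := (volume : Measure (Euc n)).real (ball 0 1)

lemma vB_pos (n : ℕ) : 0 < vB n := by
  rw [vB, Measure.real, ENNReal.toReal_pos_iff]
  exact ⟨Metric.measure_ball_pos _ _ one_pos, measure_ball_lt_top⟩

lemma vol_ball {n : ℕ} (x : Euc n) {r : ℝ} (hr : 0 < r) :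
    (volume : Measure (Euc n)).real (ball x r) = r ^ n * vB n := by
  rw [vB, Measure.real, Measure.addHaar_ball_of_pos _ _ hr, ENNReal.toReal_mul,
    ENNReal.toReal_ofReal (by positivity)]
  simp [Measure.real]

section
variable {n : ℕ} (τ : Measure (Euc n)) [IsFiniteMeasure τ]

lemma AA_fderiv {R : ℝ} (hR : 0 < R) (x : Euc n) (k : ℕ) :
    R / 4 ^ k * ‖fderiv ℝ (AA τ R k) x‖ ≤
      etaL n * 4 ^ (n - 1) * sseq (fun j => aa τ R j x) k := by
  induction k with
  | zero =>
    have : AA τ R 0 = fun _ => (R ^ (n - 1))⁻¹ * τ.real Set.univ := by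
      ext y; simp [AA_zero, aa]
    rw [this]; simp [sseq]
  | succ k ih =>
    have e : AA τ R (k + 1) = fun y => AA τ R k y + aa τ R (k + 1) y := by
      ext y; rw [AA_succ]
    have d1 : DifferentiableAt ℝ (AA τ R k) x := (AA_contDiff τ hR k).differentiable (by simp) x
    have d2 : DifferentiableAt ℝ (aa τ R (k + 1)) x :=
      (aa_contDiff τ hR (k + 1)).differentiable (by simp) x
    rw [e, fderiv_fun_add d1 d2]
    have h1 := norm_add_le (fderiv ℝ (AA τ R k) x) (fderiv ℝ (aa τ R (k + 1)) x)
    have h2 := aa_fderiv τ hR k x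
    have h3 : 0 ≤ R / 4 ^ (k + 1) := by positivity
    have h4 : R / 4 ^ (k + 1) = R / 4 ^ k / 4 := by rw [pow_succ]; field_simp
    calc _ ≤ R / 4 ^ (k + 1) * (‖fderiv ℝ (AA τ R k) x‖ + ‖fderiv ℝ (aa τ R (k + 1)) x‖) :=
          mul_le_mul_of_nonneg_left h1 h3
      _ = (R / 4 ^ k * ‖fderiv ℝ (AA τ R k) x‖) / 4 +
          R / 4 ^ (k + 1) * ‖fderiv ℝ (aa τ R (k + 1)) x‖ := by rw [mul_add, h4]; ring
      _ ≤ (etaL n * 4 ^ (n - 1) * sseq (fun j => aa τ R j x) k) / 4 +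
          etaL n * 4 ^ (n - 1) * aa τ R k x := by gcongr
      _ = _ := by simp only [sseq]; ring

lemma hh_contDiff {R : ℝ} (hR : 0 < R) (hτ : τ ≠ 0) (q : ℝ) (N : ℕ) :
    ContDiff ℝ (⊤ : ℕ∞) (hh τ R q N) := by
  unfold hh
  refine ContDiff.sum fun k _ => contDiff_const.mul ?_
  exact (AA_contDiff τ hR k).rpow_const_of_ne fun x => (AA_pos τ hR hτ k x).ne'

lemma hh_nonneg {R : ℝ} (hR : 0 < R) (q : ℝ) (N : ℕ) (x : Euc n) : 0 ≤ hh τ R q N x :=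
  Finset.sum_nonneg fun k _ => mul_nonneg (by positivity) (Real.rpow_nonneg (AA_nonneg τ hR k x) _)

lemma hh_le {R q : ℝ} (hR : 0 < R) (hq : 1 < q) (N : ℕ) (x : Euc n) :
    hh τ R q N x ≤ 2 * R * AA τ R N x ^ (q - 1) :=
  seq_S2 (by linarith) hR.le (fun k => AA_nonneg τ hR k x) (AA_mono τ hR x) N

lemma hh_fderiv {R q : ℝ} (hR : 0 < R) (hq : 1 < q) (hτ : τ ≠ 0) (N : ℕ) (x : Euc n) :
    ‖fderiv ℝ (hh τ R q N) x‖ ≤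
      etaL n * 4 ^ (n - 1) * (4 / 3 * q) * AA τ R N x ^ (q - 1) := by
  have hL := etaL_pos n
  have hd : HasFDerivAt (hh τ R q N) (∑ k ∈ Finset.range (N + 1),
      (R / 4 ^ k) • (((q - 1) * AA τ R k x ^ (q - 1 - 1)) • fderiv ℝ (AA τ R k) x)) x := by
    unfold hh
    refine HasFDerivAt.fun_sum fun k _ => ?_
    have d1 : HasFDerivAt (AA τ R k) (fderiv ℝ (AA τ R k) x) x :=
      ((AA_contDiff τ hR k).differentiable (by simp) x).hasFDerivAt
    exact (d1.rpow_const (Or.inl (AA_pos τ hR hτ k x).ne')).const_mul _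
  rw [hd.fderiv]
  have h3 := seq_S3 hq (a := fun j => aa τ R j x) (A := fun j => AA τ R j x)
    (s := sseq (fun j => aa τ R j x)) (fun k => aa_nonneg τ hR k x) (AA_zero τ R x)
    (by have := AA_pos τ hR hτ 0 x; rwa [AA_zero] at this) (fun k => AA_succ τ R k x) rfl
    (fun k => rfl) N
  calc _ ≤ ∑ k ∈ Finset.range (N + 1),
      ‖(R / 4 ^ k) • (((q - 1) * AA τ R k x ^ (q - 1 - 1)) • fderiv ℝ (AA τ R k) x)‖ :=
        norm_sum_le _ _
    _ ≤ ∑ k ∈ Finset.range (N + 1), (etaL n * 4 ^ (n - 1) * (q - 1)) *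
        (sseq (fun j => aa τ R j x) k * AA τ R k x ^ (q - 2)) := by
      refine Finset.sum_le_sum fun k _ => ?_
      have e : q - 1 - 1 = q - 2 := by ring
      have h1 : 0 ≤ AA τ R k x ^ (q - 2) := Real.rpow_nonneg (AA_nonneg τ hR k x) _
      rw [e, norm_smul, norm_smul, Real.norm_of_nonneg (by positivity : 0 ≤ R / 4 ^ k),
        Real.norm_of_nonneg (mul_nonneg (by linarith) h1)]
      have h2 := AA_fderiv τ hR x k
      have h4 : 0 ≤ (q - 1) * AA τ R k x ^ (q - 2) := mul_nonneg (by linarith) h1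
      have := mul_le_mul_of_nonneg_left h2 h4
      calc _ = _ := by ring
        _ ≤ _ := this
        _ = _ := by ring
    _ = etaL n * 4 ^ (n - 1) * ((q - 1) * ∑ k ∈ Finset.range (N + 1),
        (sseq (fun j => aa τ R j x) k * AA τ R k x ^ (q - 2))) := by
      rw [← Finset.mul_sum]; ring
    _ ≤ etaL n * 4 ^ (n - 1) * (4 / 3 * q * AA τ R N x ^ (q - 1)) :=
      mul_le_mul_of_nonneg_left h3 (by positivity)
    _ = _ := by ring

lemma aa_cont {R : ℝ} (hR : 0 < R) (k : ℕ) : Continuous (aa τ R k) :=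
  (aa_contDiff τ hR k).continuous

lemma AAq_cont {R θ : ℝ} (hR : 0 < R) (hθ : 0 ≤ θ) (k : ℕ) :
    Continuous (fun x => AA τ R k x ^ θ) :=
  (AA_cont τ hR k).rpow_const fun _ => Or.inr hθ

lemma cont_intOn {f : Euc n → ℝ} (hf : Continuous f) (x0 : Euc n) (r : ℝ) :
    IntegrableOn f (ball x0 r) :=
  (hf.continuousOn.integrableOn_compact (isCompact_closedBall x0 r)).mono_set ball_subset_closedBall

lemma AAq_int {R θ : ℝ} (hR : 0 < R) (hθ : 0 ≤ θ) (k : ℕ) (μ : Measure (Euc n)) [IsFiniteMeasure μ] :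
    Integrable (fun x => AA τ R k x ^ θ) μ := by
  obtain ⟨M, hM0, hM⟩ := AA_bdd τ hR k
  refine Integrable.mono' (integrable_const (M ^ θ)) (AAq_cont τ hR hθ k).aestronglyMeasurable
    (Eventually.of_forall fun x => ?_)
  rw [Real.norm_of_nonneg (Real.rpow_nonneg (AA_nonneg τ hR k x) _)]
  exact Real.rpow_le_rpow (AA_nonneg τ hR k x) (hM x) hθ

lemma fub_k {R θ : ℝ} (hR : 0 < R) (hθ : 0 ≤ θ) (hn : 2 ≤ n) (k : ℕ) (x0 : Euc n) :
    ∫ x in ball x0 (2 * R), aa τ R k x * AA τ R k x ^ θ ≤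
      (2 ^ n * vB n * (1 + 4 ^ (n - 1)) ^ θ) * (R / 4 ^ k * ∫ x, AA τ R k x ^ θ ∂τ) := by
  have hv := vB_pos n
  have hc1 : (1 : ℝ) ≤ (1 + 4 ^ (n - 1)) ^ θ := Real.one_le_rpow (by simp) hθ
  have h2n : (1 : ℝ) ≤ 2 ^ n := one_le_pow₀ (by norm_num)
  set I := ∫ x, AA τ R k x ^ θ ∂τ with hI
  have hI0 : 0 ≤ I := integral_nonneg fun x => Real.rpow_nonneg (AA_nonneg τ hR k x) _
  have hpw : ∀ t : ℝ, t ^ n = t ^ (n - 1) * t := fun t => by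
    rw [← pow_succ]; congr 1; omega
  by_cases hk : k = 0
  · subst hk
    have hI2 : I = τ.real Set.univ * ((R ^ (n - 1))⁻¹ * τ.real Set.univ) ^ θ := by
      simp [hI, AA_zero, aa]
    simp only [AA_zero, aa, if_true]
    rw [setIntegral_const, vol_ball _ (by positivity), hI2]
    set T := ((R ^ (n - 1))⁻¹ * τ.real Set.univ) ^ θ
    have hT : 0 ≤ T := by positivity
    have e : ((2 * R) ^ n * vB n) • ((R ^ (n - 1))⁻¹ * τ.real Set.univ * T) =
        2 ^ n * vB n * (R * (τ.real Set.univ * T)) := by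
      rw [smul_eq_mul, mul_pow, hpw R]
      field_simp
    rw [e]
    have h5 : 0 ≤ 2 ^ n * vB n * (R * (τ.real Set.univ * T)) := by positivity
    calc _ ≤ _ := le_mul_of_one_le_right h5 hc1
      _ = _ := by simp; ring
  · set r := R / 4 ^ k with hr
    have hr0 : 0 < r := by positivity
    set S := ball x0 (2 * R)
    obtain ⟨M, hM0, hM⟩ := AA_bdd τ hR k
    have hAc := AAq_cont τ hR hθ k
    have e1 : ∫ x in S, aa τ R k x * AA τ R k x ^ θ =
        (r ^ (n - 1))⁻¹ * ∫ x in S, ∫ y, eta n (r⁻¹ • (x - y)) * AA τ R k x ^ θ ∂τ := by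
      rw [← integral_const_mul]
      congr 1; ext x
      simp only [aa, hk, if_false, bb, ← hr]
      rw [integral_mul_const]; ring
    have hint : Integrable (Function.uncurry fun x y => eta n (r⁻¹ • (x - y)) * AA τ R k x ^ θ)
        ((volume.restrict S).prod τ) := by
      have : IsFiniteMeasure ((volume : Measure (Euc n)).restrict S) :=
        ⟨by simp only [Measure.restrict_apply_univ]; exact measure_ball_lt_top⟩
      refine Integrable.mono' (integrable_const (M ^ θ)) ?_ (Eventually.of_forall fun z => ?_)
      · refine Continuous.aestronglyMeasurable ?_
        refine Continuous.mul ((eta_cont n).comp (by fun_prop)) (hAc.comp continuous_fst)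
      · have h1 := eta_nonneg (r⁻¹ • (z.1 - z.2))
        have h2 := Real.rpow_nonneg (AA_nonneg τ hR k z.1) θ
        rw [Function.uncurry, Real.norm_of_nonneg (mul_nonneg h1 h2)]
        calc _ ≤ 1 * AA τ R k z.1 ^ θ := mul_le_mul_of_nonneg_right (eta_le_one _) h2
          _ ≤ _ := by rw [one_mul]; exact Real.rpow_le_rpow (AA_nonneg τ hR k _) (hM _) hθ
    have e2 : ∀ y, ∫ x in S, eta n (r⁻¹ • (x - y)) * AA τ R k x ^ θ ≤
        r ^ n * vB n * ((1 + 4 ^ (n - 1)) ^ θ * AA τ R k y ^ θ) := by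
      intro y
      have h0 : ∀ x, eta n (r⁻¹ • (x - y)) * AA τ R k x ^ θ ≤
          (ball y r).indicator (fun _ => (1 + 4 ^ (n - 1)) ^ θ * AA τ R k y ^ θ) x := by
        intro x
        by_cases hx : x ∈ ball y r
        · simp only [hx, Set.indicator_of_mem]
          have h2 := Real.rpow_nonneg (AA_nonneg τ hR k x) θ
          have h3 := AA_comp τ hR k (le_of_lt (mem_ball.1 hx))
          calc _ ≤ 1 * AA τ R k x ^ θ := mul_le_mul_of_nonneg_right (eta_le_one _) h2
            _ ≤ ((1 + 4 ^ (n - 1)) * AA τ R k y) ^ θ := by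
              rw [one_mul]; exact Real.rpow_le_rpow (AA_nonneg τ hR k _) h3 hθ
            _ = _ := Real.mul_rpow (by positivity) (AA_nonneg τ hR k _)
        · simp only [hx, not_false_eq_true, Set.indicator_of_notMem]
          rw [eta_zero, zero_mul]
          rw [mem_ball, not_lt, dist_eq_norm] at hx
          rw [norm_smul, norm_inv, Real.norm_of_nonneg hr0.le, ← div_eq_inv_mul, le_div_iff₀ hr0]
          linarith
      have hi1 : Integrable ((ball y r).indicator
          (fun _ => (1 + 4 ^ (n - 1)) ^ θ * AA τ R k y ^ θ)) (volume : Measure (Euc n)) := by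
        rw [integrable_indicator_iff measurableSet_ball]
        exact cont_intOn continuous_const _ _
      have h1 : Continuous fun x => eta n (r⁻¹ • (x - y)) * AA τ R k x ^ θ :=
        ((eta_cont n).comp (by fun_prop)).mul hAc
      set J := (ball y r).indicator (fun _ => (1 + 4 ^ (n - 1)) ^ θ * AA τ R k y ^ θ) with hJ
      calc _ ≤ ∫ x in S, J x :=
            integral_mono (cont_intOn h1 _ _) hi1.integrableOn h0
        _ ≤ ∫ x, J x := by
            refine setIntegral_le_integral hi1 (Eventually.of_forall fun x => ?_)
            refine Set.indicator_nonneg (fun z _ => ?_) x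
            have := Real.rpow_nonneg (AA_nonneg τ hR k y) θ
            positivity
        _ = _ := by
          rw [hJ, integral_indicator_const _ measurableSet_ball, vol_ball _ hr0, smul_eq_mul]
    rw [e1, integral_integral_swap hint]
    have e3 : ∫ y, (∫ x in S, eta n (r⁻¹ • (x - y)) * AA τ R k x ^ θ) ∂τ ≤
        ∫ y, r ^ n * vB n * ((1 + 4 ^ (n - 1)) ^ θ * AA τ R k y ^ θ) ∂τ := by
      refine integral_mono hint.integral_prod_right ?_ e2
      exact ((AAq_int τ hR hθ k τ).const_mul _).const_mul _
    rw [integral_const_mul, integral_const_mul, ← hI] at e3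
    have h6 : 0 ≤ vB n * (1 + 4 ^ (n - 1)) ^ θ * (r * I) := by positivity
    calc _ ≤ (r ^ (n - 1))⁻¹ * (r ^ n * vB n * ((1 + 4 ^ (n - 1)) ^ θ * I)) :=
          mul_le_mul_of_nonneg_left e3 (by positivity)
      _ = vB n * (1 + 4 ^ (n - 1)) ^ θ * (r * I) := by
        rw [hpw r]; field_simp
      _ ≤ 2 ^ n * (vB n * (1 + 4 ^ (n - 1)) ^ θ * (r * I)) := le_mul_of_one_le_left h6 h2n
      _ = _ := by ring

lemma low_X {R q : ℝ} (hR : 0 < R) (hq : 1 < q) (hn : 2 ≤ n) (N : ℕ) (x0 : Euc n) :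
    ∫ x in ball x0 (2 * R), AA τ R N x ^ q ≤
      (q * (2 ^ n * vB n * (1 + 4 ^ (n - 1)) ^ (q - 1))) * ∫ x, hh τ R q N x ∂τ := by
  have hq1 : 0 ≤ q - 1 := by linarith
  have hc : ∀ k, Continuous fun x => aa τ R k x * AA τ R k x ^ (q - 1) := fun k =>
    (aa_cont τ hR k).mul (AAq_cont τ hR hq1 k)
  calc _ ≤ ∫ x in ball x0 (2 * R), q * ∑ k ∈ Finset.range (N + 1), aa τ R k x * AA τ R k x ^ (q - 1) := by
        refine integral_mono (cont_intOn (AAq_cont τ hR (by linarith) N) _ _)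
          (cont_intOn (continuous_const.mul (continuous_finsetSum _ fun k _ => hc k)) _ _) fun x => ?_
        exact seq_S1 hq.le (a := fun j => aa τ R j x) (A := fun j => AA τ R j x)
          (fun k => aa_nonneg τ hR k x) (AA_zero τ R x) (fun k => AA_succ τ R k x) N
    _ = q * ∑ k ∈ Finset.range (N + 1), ∫ x in ball x0 (2 * R), aa τ R k x * AA τ R k x ^ (q - 1) := by
        rw [integral_const_mul, integral_finsetSum _ fun k _ => cont_intOn (hc k) _ _]
    _ ≤ q * ∑ k ∈ Finset.range (N + 1), (2 ^ n * vB n * (1 + 4 ^ (n - 1)) ^ (q - 1)) *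
        (R / 4 ^ k * ∫ x, AA τ R k x ^ (q - 1) ∂τ) := by
        refine mul_le_mul_of_nonneg_left (Finset.sum_le_sum fun k _ => ?_) (by linarith)
        exact fub_k τ hR hq1 hn k x0
    _ = _ := by
        unfold hh
        rw [integral_finsetSum _ fun k _ => (AAq_int τ hR hq1 k τ).const_mul _, ← Finset.mul_sum]
        simp_rw [integral_const_mul]
        ring

end


/-- trace inequality -/
def HypT {n : ℕ} (σ : Measure (Euc n)) (p CT : ℝ) : Prop :=
  ∀ φ : Euc n → ℝ, ContDiff ℝ (⊤ : ℕ∞) φ → HasCompactSupport φ → (∀ x, 0 ≤ φ x) →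
    ∫ x, φ x ^ p ∂σ ≤ CT * ∫ x, (‖fderiv ℝ φ x‖ ^ p + φ x ^ p)

lemma young_eps {p C ε h : ℝ} (hp : 1 < p) (hC : 0 ≤ C) (hε : 0 < ε) (hh : 0 ≤ h) :
    C * h ≤ ε * h ^ p + C * (C / ε) ^ (1 / (p - 1)) := by
  have hp1 : 0 < p - 1 := by linarith
  have hK : 0 ≤ (C / ε) ^ (1 / (p - 1)) := by positivity
  rcases le_total h ((C / ε) ^ (1 / (p - 1))) with h1 | h1
  · have : 0 ≤ ε * h ^ p := by positivity
    nlinarith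
  · have h2 : C / ε ≤ h ^ (p - 1) := by
      have := Real.rpow_le_rpow hK h1 hp1.le
      rwa [← Real.rpow_mul (by positivity), one_div_mul_cancel hp1.ne', Real.rpow_one] at this
    rw [div_le_iff₀ hε] at h2
    rcases hh.eq_or_lt with h0 | h0
    · subst h0; simp; positivity
    · have h3 : h ^ p = h ^ (p - 1) * h := by
        rw [← Real.rpow_add_one h0.ne']; congr 1; ring
      rw [h3]
      nlinarith [mul_le_mul_of_nonneg_right h2 hh, mul_nonneg hC hK]

lemma prod_cut {n : ℕ} {x0 : Euc n} {R : ℝ} (hR : 0 < R) {h : Euc n → ℝ}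
    (hh : ContDiff ℝ (⊤ : ℕ∞) h) (h0 : ∀ x, 0 ≤ h x) :
    ∃ φ : Euc n → ℝ, ContDiff ℝ (⊤ : ℕ∞) φ ∧ HasCompactSupport φ ∧ tsupport φ ⊆ ball x0 (2 * R) ∧
      (∀ x, 0 ≤ φ x) ∧ (∀ x, φ x ≤ h x) ∧ (∀ x ∈ ball x0 R, φ x = h x) ∧
      (∀ x, ‖fderiv ℝ φ x‖ ≤ ‖fderiv ℝ h x‖ + etaL n * (2 * R)⁻¹ * h x) := by
  have hL := etaL_pos n
  have h2R : 0 < 2 * R := by positivity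
  set χ : Euc n → ℝ := fun x => eta n ((2 * R)⁻¹ • (x - x0)) with hχ
  have hχs : ContDiff ℝ (⊤ : ℕ∞) χ := (eta_contDiff n).comp (by fun_prop)
  have hnorm : ∀ x, ‖(2 * R)⁻¹ • (x - x0)‖ = dist x x0 / (2 * R) := by
    intro x
    rw [norm_smul, norm_inv, Real.norm_of_nonneg h2R.le, dist_eq_norm, ← div_eq_inv_mul]
  have hsup : Function.support (fun x => χ x * h x) ⊆ closedBall x0 (3 / 2 * R) := by
    intro x hx
    by_contra hx'
    apply hx
    rw [mem_closedBall, not_le] at hx'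
    have : χ x = 0 := eta_zero (by rw [hnorm, le_div_iff₀ h2R]; linarith)
    simp [this]
  have hts : tsupport (fun x => χ x * h x) ⊆ closedBall x0 (3 / 2 * R) :=
    closure_minimal hsup isClosed_closedBall
  refine ⟨fun x => χ x * h x, hχs.mul hh,
    HasCompactSupport.of_support_subset_isCompact (isCompact_closedBall _ _) hsup, ?_, ?_, ?_, ?_, ?_⟩
  · refine hts.trans (closedBall_subset_ball (by linarith))
  · intro x; exact mul_nonneg (eta_nonneg _) (h0 x)
  · intro x; exact mul_le_of_le_one_left (h0 x) (eta_le_one _)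
  · intro x hx
    have : χ x = 1 := eta_one (by
      rw [hnorm, div_le_iff₀ h2R]; rw [mem_ball] at hx; linarith)
    simp [this]
  · intro x
    have d1 : DifferentiableAt ℝ χ x := hχs.differentiable (by simp) x
    have d2 : DifferentiableAt ℝ h x := hh.differentiable (by simp) x
    rw [fderiv_fun_mul d1 d2]
    refine (norm_add_le _ _).trans ?_
    rw [norm_smul, norm_smul, Real.norm_of_nonneg (eta_nonneg _ : 0 ≤ χ x), Real.norm_of_nonneg (h0 x)]
    have h1 : ‖fderiv ℝ χ x‖ ≤ etaL n * (2 * R)⁻¹ := by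
      refine norm_fderiv_le_of_lip' ℝ (by positivity) (Eventually.of_forall fun y => ?_)
      refine (eta_lip _ _).trans (le_of_eq ?_)
      rw [← smul_sub, norm_smul, norm_inv, Real.norm_of_nonneg h2R.le]
      simp; ring
    have h2 : χ x * ‖fderiv ℝ h x‖ ≤ ‖fderiv ℝ h x‖ :=
      mul_le_of_le_one_left (norm_nonneg _) (eta_le_one _)
    nlinarith [mul_le_mul_of_nonneg_left h1 (h0 x)]

lemma cpow_int {n : ℕ} {φ : Euc n → ℝ} (hc : Continuous φ) (hs : HasCompactSupport φ) {p : ℝ}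
    (hp : 1 < p) (μ : Measure (Euc n)) [IsFiniteMeasureOnCompacts μ] :
    Integrable (fun x => φ x ^ p) μ := by
  refine Continuous.integrable_of_hasCompactSupport (hc.rpow_const fun _ => Or.inr (by linarith)) ?_
  refine hs.mono fun x hx hx' => hx ?_
  simp only [hx']
  exact Real.zero_rpow (by linarith)

lemma testing {n : ℕ} (hn : 2 ≤ n) {p q : ℝ} (hpq : p.HolderConjugate q) (σ : Measure (Euc n))
    [IsFiniteMeasure σ] {CT : ℝ} (hCT : 0 ≤ CT) (hT : HypT σ p CT) {R0 : ℝ} (hR0 : 0 < R0) :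
    ∃ C : ℝ, 0 ≤ C ∧ ∀ (x0 : Euc n) (R : ℝ) (N : ℕ), 0 < R → R ≤ R0 →
      ∫ x in ball x0 (2 * R), AA (σ.restrict (ball x0 R)) R N x ^ q ≤ C * σ.real (ball x0 R) := by
  have hp := hpq.lt
  have hq := hpq.symm.lt
  have hL := etaL_pos n
  have hv := vB_pos n
  set C1 : ℝ := q * (2 ^ n * vB n * (1 + 4 ^ (n - 1)) ^ (q - 1)) with hC1
  have hC10 : 0 ≤ C1 := by positivity
  set D2 : ℝ := etaL n * 4 ^ (n - 1) * (4 / 3 * q) + etaL n with hD2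
  have hD20 : 0 ≤ D2 := by positivity
  set C3 : ℝ := D2 ^ p + (2 * R0) ^ p with hC3
  have hC30 : 0 ≤ C3 := by positivity
  set ε : ℝ := (2 * (CT * C3 + 1))⁻¹ with hε
  have hε0 : 0 < ε := by positivity
  set K : ℝ := C1 * (C1 / ε) ^ (1 / (p - 1)) with hK
  have hK0 : 0 ≤ K := by positivity
  refine ⟨2 * K, by positivity, fun x0 R N hR hRR => ?_⟩
  set τ := σ.restrict (ball x0 R) with hτd
  have hτu : τ.real Set.univ = σ.real (ball x0 R) := by simp [hτd, Measure.real]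
  by_cases hτ : τ = 0
  · have : ∀ x, AA τ R N x = 0 := by
      intro x; simp [AA, aa, hτ, bb]
    simp only [this]
    rw [Real.zero_rpow (by linarith)]
    simp; positivity
  set S := ball x0 (2 * R) with hS
  set X := ∫ x in S, AA τ R N x ^ q with hX
  have hX0 : 0 ≤ X := integral_nonneg fun x => Real.rpow_nonneg (AA_nonneg τ hR N x) _
  have hXi : IntegrableOn (fun x => AA τ R N x ^ q) S :=
    cont_intOn (AAq_cont τ hR (by linarith) N) _ _
  have hlow : X ≤ C1 * ∫ x, hh τ R q N x ∂τ := low_X τ hR hq hn N x0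
  obtain ⟨φ, f1, f2, f3, f4, f5, f6, f7⟩ := prod_cut (x0 := x0) hR (hh_contDiff τ hR hτ q N)
    (hh_nonneg τ hR q N)
  have hApow : ∀ x, (AA τ R N x ^ (q - 1)) ^ p = AA τ R N x ^ q := fun x =>
    rpow_conj1 hpq.symm (AA_nonneg τ hR N x)
  -- gradient side
  have hup : ∫ x, (‖fderiv ℝ φ x‖ ^ p + φ x ^ p) ≤ C3 * X := by
    rw [hX, ← integral_const_mul, ← integral_indicator measurableSet_ball]
    refine integral_mono_of_nonneg (Eventually.of_forall fun x => ?_) ?_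
      (Eventually.of_forall fun x => ?_)
    · have := f4 x
      simp only [Pi.zero_apply]; positivity
    · rw [integrable_indicator_iff measurableSet_ball]
      exact hXi.const_mul _
    · by_cases hx : x ∈ S
      · rw [hS] at hx; rw [Set.indicator_of_mem hx]
        have hA := AA_nonneg τ hR N x
        have hAp : 0 ≤ AA τ R N x ^ (q - 1) := by positivity
        have g1 : ‖fderiv ℝ φ x‖ ≤ D2 * AA τ R N x ^ (q - 1) := by
          have e1 := hh_fderiv τ hR hq hτ N x
          have e2 := hh_le τ hR hq N x
          have e3 : etaL n * (2 * R)⁻¹ * hh τ R q N x ≤ etaL n * AA τ R N x ^ (q - 1) := by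
            calc _ ≤ etaL n * (2 * R)⁻¹ * (2 * R * AA τ R N x ^ (q - 1)) :=
                  mul_le_mul_of_nonneg_left e2 (by positivity)
              _ = _ := by field_simp
          have := f7 x
          rw [hD2, add_mul]
          linarith
        have g2 : φ x ≤ 2 * R0 * AA τ R N x ^ (q - 1) := by
          refine (f5 x).trans ((hh_le τ hR hq N x).trans ?_)
          gcongr
        have g3 : ‖fderiv ℝ φ x‖ ^ p ≤ D2 ^ p * AA τ R N x ^ q := by
          rw [← hApow, ← Real.mul_rpow hD20 hAp]
          exact Real.rpow_le_rpow (norm_nonneg _) g1 (by linarith)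
        have g4 : φ x ^ p ≤ (2 * R0) ^ p * AA τ R N x ^ q := by
          rw [← hApow, ← Real.mul_rpow (by positivity) hAp]
          exact Real.rpow_le_rpow (f4 x) g2 (by linarith)
        rw [hC3, add_mul]
        linarith
      · rw [hS] at hx; rw [Set.indicator_of_notMem hx]
        have hx1 : x ∉ tsupport φ := fun h => hx (f3 h)
        have hx2 : fderiv ℝ φ x = 0 := by
          by_contra hne
          exact hx1 (support_fderiv_subset ℝ hne)
        show ‖fderiv ℝ φ x‖ ^ p + φ x ^ p ≤ 0
        rw [hx2, image_eq_zero_of_notMem_tsupport hx1, norm_zero, Real.zero_rpow (by linarith)]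
        simp
  have hhc : Continuous (hh τ R q N) := (hh_contDiff τ hR hτ q N).continuous
  have htr : ∫ x, hh τ R q N x ^ p ∂τ ≤ CT * (C3 * X) := by
    have e1 : ∫ x, hh τ R q N x ^ p ∂τ = ∫ x in ball x0 R, φ x ^ p ∂σ := by
      rw [hτd]
      refine setIntegral_congr_fun measurableSet_ball fun x hx => ?_
      simp only [f6 x hx]
      rfl
    rw [e1]
    calc _ ≤ ∫ x, φ x ^ p ∂σ := setIntegral_le_integral (cpow_int f1.continuous f2 hp σ)
          (Eventually.of_forall fun x => Real.rpow_nonneg (f4 x) _)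
      _ ≤ _ := hT φ f1 f2 f4
      _ ≤ _ := mul_le_mul_of_nonneg_left hup hCT
  obtain ⟨M, hM0, hM⟩ := AA_bdd τ hR N
  have hhb : ∀ x, hh τ R q N x ≤ 2 * R * M ^ (q - 1) := fun x => by
    refine (hh_le τ hR hq N x).trans ?_
    have := Real.rpow_le_rpow (AA_nonneg τ hR N x) (hM x) (by linarith : 0 ≤ q - 1)
    gcongr
  have hhi : Integrable (hh τ R q N) τ := by
    refine Integrable.mono' (integrable_const (2 * R * M ^ (q - 1))) hhc.aestronglyMeasurable
      (Eventually.of_forall fun x => ?_)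
    rw [Real.norm_of_nonneg (hh_nonneg τ hR q N x)]; exact hhb x
  have hhpi : Integrable (fun x => hh τ R q N x ^ p) τ := by
    refine Integrable.mono' (integrable_const ((2 * R * M ^ (q - 1)) ^ p))
      (hhc.rpow_const fun _ => Or.inr (by linarith)).aestronglyMeasurable
      (Eventually.of_forall fun x => ?_)
    rw [Real.norm_of_nonneg (Real.rpow_nonneg (hh_nonneg τ hR q N x) _)]
    exact Real.rpow_le_rpow (hh_nonneg τ hR q N x) (hhb x) (by linarith)
  have hfin : C1 * ∫ x, hh τ R q N x ∂τ ≤ ε * ∫ x, hh τ R q N x ^ p ∂τ + K * σ.real (ball x0 R) := by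
    have : ∫ x, C1 * hh τ R q N x ∂τ ≤ ∫ x, (ε * hh τ R q N x ^ p + K) ∂τ :=
      integral_mono (hhi.const_mul _) ((hhpi.const_mul _).add (integrable_const _))
        fun x => young_eps hp hC10 hε0 (hh_nonneg τ hR q N x)
    rw [integral_const_mul, integral_add (hhpi.const_mul _) (integrable_const _),
      integral_const_mul, integral_const, hτu, smul_eq_mul] at this
    linarith
  have h5 : ε * (CT * (C3 * X)) ≤ 1 / 2 * X := by
    have : ε * (CT * C3) ≤ 1 / 2 := by
      rw [hε, inv_mul_le_iff₀ (by positivity)]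
      linarith
    calc _ = ε * (CT * C3) * X := by ring
      _ ≤ _ := mul_le_mul_of_nonneg_right this hX0
  have h6 := mul_le_mul_of_nonneg_left htr hε0.le
  nlinarith

lemma growth {n : ℕ} (hn : 2 ≤ n) {p q : ℝ} (hpq : p.HolderConjugate q) (σ : Measure (Euc n))
    [IsFiniteMeasure σ] {CT : ℝ} (hCT : 0 ≤ CT) (hT : HypT σ p CT) {R0 : ℝ} (hR0 : 0 < R0) :
    ∃ G : ℝ, 0 ≤ G ∧ ∀ (x : Euc n) (k : ℕ), R0 / 4 ^ k * AA σ R0 k x ^ (q - 1) ≤ G := by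
  obtain ⟨C, hC, htest⟩ := testing hn hpq σ hCT hT hR0
  have hp := hpq.lt
  have hq := hpq.symm.lt
  have hv := vB_pos n
  have hq1 : 0 < q - 1 := by linarith
  have hqp : (q - 1) * (p - 1) = 1 := by
    have := hpq.mul_eq_add
    nlinarith
  have hpw : ∀ t : ℝ, t ^ n = t ^ (n - 1) * t := fun t => by
    rw [← pow_succ]; congr 1; omega
  set G1 : ℝ := C / (2 ^ n * vB n) with hG1
  have hG10 : 0 ≤ G1 := by positivity
  have ht : ∀ (x : Euc n) (r : ℝ), 0 < r → r ≤ R0 → r * tt σ r x ^ (q - 1) ≤ G1 := by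
    intro x r hr hrR
    have h := htest x r 0 hr hrR
    have e : ∀ y, AA (σ.restrict (ball x r)) r 0 y = tt σ r x := by
      intro y; simp [AA_zero, aa, tt, Measure.real]
    simp only [e] at h
    rw [setIntegral_const, vol_ball _ (by positivity), smul_eq_mul] at h
    have ht0 := tt_nonneg σ hr x
    rcases ht0.eq_or_lt with h0 | h0
    · rw [← h0, Real.zero_rpow hq1.ne']; simpa using hG10
    have e2 : σ.real (ball x r) = r ^ (n - 1) * tt σ r x := by
      unfold tt; field_simp
    have e3 : tt σ r x ^ q = tt σ r x ^ (q - 1) * tt σ r x := by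
      rw [← Real.rpow_add_one h0.ne']; congr 1; ring
    rw [e2, e3, mul_pow, hpw r] at h
    rw [hG1, le_div_iff₀ (by positivity)]
    have h7 : 0 < r ^ (n - 1) * tt σ r x := by positivity
    refine le_of_mul_le_mul_right ?_ h7
    calc _ = _ := by ring
      _ ≤ _ := h
      _ = _ := by ring
  set G2 : ℝ := max G1 (R0 * ((R0 ^ (n - 1))⁻¹ * σ.real Set.univ) ^ (q - 1)) with hG2
  have hG20 : 0 ≤ G2 := hG10.trans (le_max_left _ _)
  have hak : ∀ (x : Euc n) k, aa σ R0 k x ≤ G2 ^ (p - 1) * (R0 / 4 ^ k) ^ (1 - p) := by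
    intro x k
    have hr : 0 < R0 / 4 ^ k := by positivity
    have ha := aa_nonneg σ hR0 k x
    have h1 : R0 / 4 ^ k * aa σ R0 k x ^ (q - 1) ≤ G2 := by
      by_cases hk : k = 0
      · subst hk
        simp only [aa, if_true, pow_zero, div_one]
        exact le_max_right _ _
      · refine le_trans ?_ ((ht x (R0 / 4 ^ k) hr ?_).trans (le_max_left _ _))
        · refine mul_le_mul_of_nonneg_left (Real.rpow_le_rpow ha ?_ hq1.le) hr.le
          simp only [aa, hk, if_false]
          exact bb_le_tt σ hr x
        · exact div_le_self hR0.le (one_le_pow₀ (by norm_num))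
    have h2 := Real.rpow_le_rpow (by positivity) h1 (by linarith : 0 ≤ p - 1)
    rw [Real.mul_rpow hr.le (by positivity), ← Real.rpow_mul ha, hqp, Real.rpow_one] at h2
    have h3 : (R0 / 4 ^ k) ^ (1 - p) = ((R0 / 4 ^ k) ^ (p - 1))⁻¹ := by
      rw [← Real.rpow_neg hr.le]; congr 1; ring
    rw [h3, ← div_eq_mul_inv, le_div_iff₀ (by positivity)]
    linarith
  have h4 : (4 : ℝ) ^ (1 - p) < 1 := Real.rpow_lt_one_of_one_lt_of_neg (by norm_num) (by linarith)
  set H : ℝ := G2 ^ (p - 1) / (1 - 4 ^ (1 - p)) with hH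
  have hH0 : 0 ≤ H := div_nonneg (by positivity) (by linarith)
  refine ⟨H ^ (q - 1), by positivity, fun x k => ?_⟩
  have hr : 0 < R0 / 4 ^ k := by positivity
  have h5 := seq_S5 hp hR0 (by positivity) (a := fun j => aa σ R0 j x) (A := fun j => AA σ R0 j x) (AA_zero σ R0 x) (fun k => AA_succ σ R0 k x) (hak x) k
  have h6 := Real.rpow_le_rpow (AA_nonneg σ hR0 k x) h5 hq1.le
  rw [Real.mul_rpow hH0 (by positivity), ← Real.rpow_mul hr.le] at h6
  have e : (1 - p) * (q - 1) = -1 := by linarith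
  rw [e, Real.rpow_neg_one] at h6
  calc _ ≤ _ := mul_le_mul_of_nonneg_left h6 hr.le
    _ = _ := by field_simp


lemma ker_integrableOn' {n : ℕ} (hn : 2 ≤ n) (x : Euc n) (r : ℝ) :
    IntegrableOn (fun z : Euc n => (‖z - x‖ ^ (n - 1))⁻¹) (ball x r) := by
  have := ker_integrableOn hn r
  rw [← integrable_indicator_iff measurableSet_ball] at this ⊢
  have := this.comp_sub_right x
  refine this.congr (Eventually.of_forall fun z => ?_)
  simp [Set.indicator, dist_eq_norm]

lemma ker_integral' {n : ℕ} (hn : 2 ≤ n) (x : Euc n) {r : ℝ} (hr : 0 ≤ r) :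
    ∫ z in ball x r, (‖z - x‖ ^ (n - 1))⁻¹ = cS n * r := by
  rw [← ker_integral hn hr, ← integral_indicator measurableSet_ball,
    ← integral_indicator measurableSet_ball]
  rw [← integral_sub_right_eq_self (μ := (volume : Measure (Euc n)))
    ((ball (0 : Euc n) r).indicator fun z => (‖z‖ ^ (n - 1))⁻¹) x]
  congr 1; ext z
  simp [Set.indicator, dist_eq_norm]

lemma ker_split {n : ℕ} {R : ℝ} (hR : 0 < R) (x z : Euc n) (N : ℕ) (hz : dist z x < R / 4 ^ 1) :
    (‖z - x‖ ^ (n - 1))⁻¹ ≤ ∑ m ∈ Finset.range N, ((R / 4 ^ (m + 2)) ^ (n - 1))⁻¹ *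
        (ball x (R / 4 ^ (m + 1))).indicator (fun _ => (1 : ℝ)) z +
      (ball x (R / 4 ^ (N + 1))).indicator (fun _ => (1 : ℝ)) z * (‖z - x‖ ^ (n - 1))⁻¹ := by
  induction N with
  | zero =>
    have : z ∈ ball x (R / 4 ^ (0 + 1)) := hz
    rw [Set.indicator_of_mem this]; simp
  | succ N ih =>
    refine ih.trans ?_
    rw [Finset.sum_range_succ, add_assoc]
    refine add_le_add le_rfl ?_
    have hmono : R / 4 ^ (N + 1 + 1) ≤ R / 4 ^ (N + 1) := by
      gcongr
      · norm_num
      · omega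
    by_cases h1 : z ∈ ball x (R / 4 ^ (N + 1))
    · rw [Set.indicator_of_mem h1, one_mul, mul_one]
      by_cases h2 : z ∈ ball x (R / 4 ^ (N + 1 + 1))
      · rw [Set.indicator_of_mem h2, one_mul]
        have : 0 ≤ ((R / 4 ^ (N + 2)) ^ (n - 1))⁻¹ := by positivity
        linarith
      · rw [Set.indicator_of_notMem h2, zero_mul, add_zero]
        rw [mem_ball, not_lt, dist_eq_norm] at h2
        gcongr
    · have h2 : z ∉ ball x (R / 4 ^ (N + 1 + 1)) := fun h => h1 (ball_subset_ball hmono h)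
      rw [Set.indicator_of_notMem h1, Set.indicator_of_notMem h2]; simp

lemma bb_restrict {n : ℕ} (σ : Measure (Euc n)) {x z : Euc n} {r s : ℝ} (hr : 0 < r)
    (h : dist z x + r ≤ s) : bb (σ.restrict (ball x s)) r z = bb σ r z := by
  unfold bb
  congr 1
  refine setIntegral_eq_integral_of_forall_compl_eq_zero fun y hy => ?_
  rw [mem_ball, not_lt] at hy
  apply eta_zero
  rw [norm_smul, norm_inv, Real.norm_of_nonneg hr.le, ← div_eq_inv_mul, le_div_iff₀ hr,
    ← dist_eq_norm]
  have := dist_triangle y z x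
  rw [dist_comm y z] at this
  linarith

lemma AA_loc {n : ℕ} (σ : Measure (Euc n)) [IsFiniteMeasure σ] {R : ℝ} (hR : 0 < R) (x z : Euc n)
    (m M : ℕ) (hz : dist z x < R / 4 ^ (m + 1)) :
    AA σ R (m + M) z ≤ AA σ R m z + AA (σ.restrict (ball x (R / 4 ^ m))) (R / 4 ^ m) M z := by
  induction M with
  | zero => 
    have := AA_nonneg (σ.restrict (ball x (R / 4 ^ m))) (show 0 < R / 4 ^ m by positivity) 0 z
    simpa using this
  | succ M ih =>
    rw [← add_assoc, AA_succ, AA_succ]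
    have e : aa σ R (m + M + 1) z = aa (σ.restrict (ball x (R / 4 ^ m))) (R / 4 ^ m) (M + 1) z := by
      simp only [aa, Nat.add_eq_zero_iff, one_ne_zero, and_false, if_false]
      have e1 : R / 4 ^ (m + M + 1) = R / 4 ^ m / 4 ^ (M + 1) := by
        rw [add_assoc, pow_add]; field_simp
      rw [e1]
      refine (bb_restrict σ (by positivity) ?_).symm
      have e2 : R / 4 ^ (m + 1) = R / 4 ^ m / 4 := by rw [pow_succ]; field_simp
      have e3 : R / 4 ^ m / 4 ^ (M + 1) ≤ R / 4 ^ m / 4 := by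
        gcongr
        exact le_self_pow₀ (by norm_num) (by omega)
      have e4 : 0 < R / 4 ^ m := by positivity
      linarith
    rw [e]; linarith

lemma two_rpow {q a b : ℝ} (hq : 0 ≤ q) (ha : 0 ≤ a) (hb : 0 ≤ b) :
    (a + b) ^ q ≤ 2 ^ q * (a ^ q + b ^ q) := by
  have h1 : 0 ≤ a ^ q := by positivity
  have h2 : 0 ≤ b ^ q := by positivity
  have h3 : (0 : ℝ) ≤ 2 ^ q := by positivity
  rcases le_total a b with h | h
  · calc (a + b) ^ q ≤ (2 * b) ^ q := Real.rpow_le_rpow (by positivity) (by linarith) hq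
      _ = 2 ^ q * b ^ q := Real.mul_rpow (by norm_num) hb
      _ ≤ _ := by nlinarith
  · calc (a + b) ^ q ≤ (2 * a) ^ q := Real.rpow_le_rpow (by positivity) (by linarith) hq
      _ = 2 ^ q * a ^ q := Real.mul_rpow (by norm_num) ha
      _ ≤ _ := by nlinarith

lemma tt_sum {n : ℕ} (σ : Measure (Euc n)) [IsFiniteMeasure σ] {R : ℝ} (hR : 0 < R) (x : Euc n)
    (N : ℕ) : ∑ m ∈ Finset.range (N + 1), tt σ (R / 4 ^ m) x ≤ (1 + 4 ^ (n - 1)) * AA σ R N x := by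
  rw [Finset.sum_range_succ']
  have h1 : tt σ (R / 4 ^ 0) x ≤ AA σ R N x := by
    refine le_trans ?_ (AA_mono σ hR x (Nat.zero_le N))
    simp only [AA_zero, aa, if_true, tt, pow_zero, div_one]
    exact mul_le_mul_of_nonneg_left (measureReal_mono (Set.subset_univ _)) (by positivity)
  have h2 : ∑ m ∈ Finset.range N, tt σ (R / 4 ^ (m + 1)) x ≤ 4 ^ (n - 1) * AA σ R N x := by
    calc _ ≤ ∑ m ∈ Finset.range N, 4 ^ (n - 1) * aa σ R m x :=
          Finset.sum_le_sum fun m _ => tt_le_aa σ hR m (by simp; positivity)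
      _ = 4 ^ (n - 1) * ∑ m ∈ Finset.range N, aa σ R m x := by rw [Finset.mul_sum]
      _ ≤ _ := by
        refine mul_le_mul_of_nonneg_left ?_ (by positivity)
        unfold AA
        rw [Finset.sum_range_succ]
        linarith [aa_nonneg σ hR N x]
  linarith

lemma loc_int {n : ℕ} (hn : 2 ≤ n) {q : ℝ} (hq : 1 < q) (σ : Measure (Euc n))
    [IsFiniteMeasure σ] {R0 C : ℝ} (hR0 : 0 < R0) (hC : 0 ≤ C)
    (htest : ∀ (x0 : Euc n) (R : ℝ) (N : ℕ), 0 < R → R ≤ R0 →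
      ∫ x in ball x0 (2 * R), AA (σ.restrict (ball x0 R)) R N x ^ q ≤ C * σ.real (ball x0 R))
    (x : Euc n) (m N : ℕ) (hm : m ≤ N) :
    ((R0 / 4 ^ (m + 2)) ^ (n - 1))⁻¹ * ∫ z in ball x (R0 / 4 ^ (m + 1)), AA σ R0 N z ^ q ≤
      (16 ^ (n - 1) * 2 ^ q * ((1 + 4 ^ (n - 1)) ^ q * vB n + C)) *
        (R0 / 4 ^ m * AA σ R0 m x ^ q + tt σ (R0 / 4 ^ m) x) := by
  have hv := vB_pos n
  obtain ⟨M, rfl⟩ := Nat.exists_eq_add_of_le hm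
  have hpw : ∀ t : ℝ, t ^ n = t ^ (n - 1) * t := fun t => by
    rw [← pow_succ]; congr 1; omega
  set r := R0 / 4 ^ m with hr
  have hr0 : 0 < r := by positivity
  have hrR : r ≤ R0 := div_le_self hR0.le (one_le_pow₀ (by norm_num))
  have e1 : R0 / 4 ^ (m + 1) = r / 4 := by rw [hr, pow_succ]; field_simp
  have e2 : R0 / 4 ^ (m + 2) = r / 16 := by rw [hr, pow_add]; field_simp; norm_num
  set τ := σ.restrict (ball x r) with hτ
  set c : ℝ := 1 + 4 ^ (n - 1) with hc
  have hc0 : 0 < c := by positivity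
  have hA0 := AA_nonneg σ hR0 m x
  rw [e1, e2]
  have hq0 : 0 ≤ q := by linarith
  have hτi : IntegrableOn (fun z => AA τ r M z ^ q) (ball x (2 * r)) :=
    cont_intOn (AAq_cont τ hr0 hq0 M) _ _
  have hsub : ball x (r / 4) ⊆ ball x (2 * r) := ball_subset_ball (by linarith)
  have hI : ∫ z in ball x (r / 4), AA σ R0 (m + M) z ^ q ≤
      2 ^ q * (r ^ n * vB n * (c ^ q * AA σ R0 m x ^ q) + C * σ.real (ball x r)) := by
    calc _ ≤ ∫ z in ball x (r / 4), 2 ^ q * (c ^ q * AA σ R0 m x ^ q + AA τ r M z ^ q) := by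
          refine setIntegral_mono_on (cont_intOn (AAq_cont σ hR0 hq0 _) _ _)
            (cont_intOn (continuous_const.mul (continuous_const.add (AAq_cont τ hr0 hq0 M))) _ _)
            measurableSet_ball fun z hz => ?_
          have hz' : dist z x < R0 / 4 ^ (m + 1) := by rw [e1]; exact hz
          have h1 := AA_loc σ hR0 x z m M hz'
          have h2 : AA σ R0 m z ≤ c * AA σ R0 m x := by
            refine AA_comp σ hR0 m ?_
            rw [← hr]; rw [mem_ball] at hz; linarith
          have h3 := AA_nonneg τ hr0 M z
          calc _ ≤ (c * AA σ R0 m x + AA τ r M z) ^ q :=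
                Real.rpow_le_rpow (AA_nonneg σ hR0 _ z) (h1.trans (by linarith)) hq0
            _ ≤ 2 ^ q * ((c * AA σ R0 m x) ^ q + AA τ r M z ^ q) := two_rpow hq0 (by positivity) h3
            _ = _ := by rw [Real.mul_rpow hc0.le hA0]
      _ = 2 ^ q * ((r / 4) ^ n * vB n * (c ^ q * AA σ R0 m x ^ q) +
          ∫ z in ball x (r / 4), AA τ r M z ^ q) := by
          rw [integral_const_mul, integral_add (cont_intOn continuous_const _ _) (hτi.mono_set hsub),
            setIntegral_const, vol_ball _ (by positivity), smul_eq_mul]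
      _ ≤ _ := by
          have h4 : ∫ z in ball x (r / 4), AA τ r M z ^ q ≤ C * σ.real (ball x r) := by
            refine le_trans (setIntegral_mono_set hτi ?_ hsub.eventuallyLE) (htest x r M hr0 hrR)
            exact Eventually.of_forall fun z => Real.rpow_nonneg (AA_nonneg τ hr0 M z) _
          have h5 : (r / 4) ^ n ≤ r ^ n := pow_le_pow_left₀ (by positivity) (by linarith) _
          gcongr
  have e3 : ((r / 16) ^ (n - 1))⁻¹ = 16 ^ (n - 1) * (r ^ (n - 1))⁻¹ := by
    rw [div_pow]; field_simp
  have e4 : σ.real (ball x r) = r ^ (n - 1) * tt σ r x := by unfold tt; field_simp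
  have ht := tt_nonneg σ hr0 x
  calc _ ≤ ((r / 16) ^ (n - 1))⁻¹ *
      (2 ^ q * (r ^ n * vB n * (c ^ q * AA σ R0 m x ^ q) + C * σ.real (ball x r))) :=
        mul_le_mul_of_nonneg_left hI (by positivity)
    _ = 16 ^ (n - 1) * 2 ^ q * ((c ^ q * vB n) * (r * AA σ R0 m x ^ q) + C * tt σ r x) := by
        rw [e3, e4, hpw r]; field_simp
    _ ≤ 16 ^ (n - 1) * 2 ^ q * ((c ^ q * vB n + C) * (r * AA σ R0 m x ^ q + tt σ r x)) := by
        have h6 : 0 ≤ c ^ q * vB n * tt σ r x := by positivity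
        have h7 : 0 ≤ C * (r * AA σ R0 m x ^ q) := by positivity
        refine mul_le_mul_of_nonneg_left ?_ (by positivity)
        linarith
    _ = _ := by ring

lemma stepC {n : ℕ} (hn : 2 ≤ n) {p q : ℝ} (hpq : p.HolderConjugate q) (σ : Measure (Euc n))
    [IsFiniteMeasure σ] {CT : ℝ} (hCT : 0 ≤ CT) (hT : HypT σ p CT) {R0 : ℝ} (hR0 : 0 < R0) :
    ∃ C : ℝ, 0 ≤ C ∧ ∀ (x : Euc n) (N : ℕ),
      ∫ z in ball x (R0 / 4), (‖z - x‖ ^ (n - 1))⁻¹ * AA σ R0 N z ^ q ≤ C * AA σ R0 N x := by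
  obtain ⟨C, hC, htest⟩ := testing hn hpq σ hCT hT hR0
  obtain ⟨G, hG, hgr⟩ := growth hn hpq σ hCT hT hR0
  have hv := vB_pos n
  have hcs := cS_pos hn
  have hq := hpq.symm.lt
  have hq0 : 0 ≤ q := by linarith
  set c : ℝ := 1 + 4 ^ (n - 1) with hc
  have hc0 : 0 < c := by positivity
  set K1 : ℝ := 16 ^ (n - 1) * 2 ^ q * (c ^ q * vB n + C) with hK1
  have hK10 : 0 ≤ K1 := by positivity
  refine ⟨K1 * (4 / 3 * (q * G) + c) + c ^ q * cS n * G, by positivity, fun x N => ?_⟩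
  have hf0 := AA_nonneg σ hR0 N x
  set f := fun z => AA σ R0 N z ^ q with hf
  have hfc : Continuous f := AAq_cont σ hR0 hq0 N
  have hfn : ∀ z, 0 ≤ f z := fun z => Real.rpow_nonneg (AA_nonneg σ hR0 N z) _
  have hrN : 0 < R0 / 4 ^ (N + 1) := by positivity
  have hrN' : R0 / 4 ^ (N + 1) = R0 / 4 ^ N / 4 := by rw [pow_succ]; field_simp
  have hrN0 : 0 < R0 / 4 ^ N := by positivity
  have hi1 : ∀ m, Integrable (fun z => ((R0 / 4 ^ (m + 2)) ^ (n - 1))⁻¹ *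
      (ball x (R0 / 4 ^ (m + 1))).indicator f z) := by
    intro m
    refine Integrable.const_mul ?_ _
    rw [integrable_indicator_iff measurableSet_ball]
    exact cont_intOn hfc _ _
  have hi2 : Integrable ((ball x (R0 / 4 ^ (N + 1))).indicator
      (fun z => (‖z - x‖ ^ (n - 1))⁻¹ * (c ^ q * f x))) := by
    rw [integrable_indicator_iff measurableSet_ball]
    exact (ker_integrableOn' hn x _).mul_const _
  have hup : ∫ z in ball x (R0 / 4), (‖z - x‖ ^ (n - 1))⁻¹ * f z ≤
      ∫ z, ((∑ m ∈ Finset.range N, ((R0 / 4 ^ (m + 2)) ^ (n - 1))⁻¹ *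
        (ball x (R0 / 4 ^ (m + 1))).indicator f z) +
        (ball x (R0 / 4 ^ (N + 1))).indicator
          (fun z => (‖z - x‖ ^ (n - 1))⁻¹ * (c ^ q * f x)) z) := by
    rw [← integral_indicator measurableSet_ball]
    refine integral_mono_of_nonneg (Eventually.of_forall fun z => ?_)
      ((integrable_finsetSum _ fun m _ => hi1 m).add hi2) (Eventually.of_forall fun z => ?_)
    · refine Set.indicator_nonneg (fun z _ => ?_) z
      have := hfn z
      positivity
    · have hpos : 0 ≤ (∑ m ∈ Finset.range N, ((R0 / 4 ^ (m + 2)) ^ (n - 1))⁻¹ *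
        (ball x (R0 / 4 ^ (m + 1))).indicator f z) +
        (ball x (R0 / 4 ^ (N + 1))).indicator
          (fun z => (‖z - x‖ ^ (n - 1))⁻¹ * (c ^ q * f x)) z := by
        refine add_nonneg (Finset.sum_nonneg fun m _ => mul_nonneg (by positivity) ?_) ?_
        · exact Set.indicator_nonneg (fun z _ => hfn z) z
        · refine Set.indicator_nonneg (fun z _ => ?_) z
          have := hfn x
          positivity
      by_cases hz : z ∈ ball x (R0 / 4)
      · rw [Set.indicator_of_mem hz]
        have hs := mul_le_mul_of_nonneg_right
          (ker_split hR0 x z N (by rw [mem_ball] at hz; simpa using hz)) (hfn z)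
        refine hs.trans ?_
        rw [add_mul, Finset.sum_mul]
        refine add_le_add (Finset.sum_le_sum fun m _ => le_of_eq ?_) ?_
        · rw [mul_assoc]; congr 1
          by_cases h : z ∈ ball x (R0 / 4 ^ (m + 1))
          · rw [Set.indicator_of_mem h, Set.indicator_of_mem h, one_mul]
          · rw [Set.indicator_of_notMem h, Set.indicator_of_notMem h, zero_mul]
        · by_cases h : z ∈ ball x (R0 / 4 ^ (N + 1))
          · rw [Set.indicator_of_mem h, Set.indicator_of_mem h, one_mul]
            refine mul_le_mul_of_nonneg_left ?_ (by positivity)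
            have h2 : AA σ R0 N z ≤ c * AA σ R0 N x := by
              refine AA_comp σ hR0 N ?_
              rw [mem_ball] at h; linarith
            have := Real.rpow_le_rpow (AA_nonneg σ hR0 N z) h2 hq0
            rwa [Real.mul_rpow hc0.le hf0] at this
          · rw [Set.indicator_of_notMem h, Set.indicator_of_notMem h]; simp
      · rw [Set.indicator_of_notMem hz]; exact hpos
  rw [integral_add (integrable_finsetSum _ fun m _ => hi1 m) hi2,
    integral_finsetSum _ fun m _ => hi1 m, integral_indicator measurableSet_ball,
    integral_mul_const, ker_integral' hn x hrN.le] at hup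
  simp_rw [integral_const_mul, integral_indicator measurableSet_ball] at hup
  have hs1 : ∑ m ∈ Finset.range N, ((R0 / 4 ^ (m + 2)) ^ (n - 1))⁻¹ *
      ∫ z in ball x (R0 / 4 ^ (m + 1)), f z ≤ K1 * (4 / 3 * (q * G) + c) * AA σ R0 N x := by
    calc _ ≤ ∑ m ∈ Finset.range N, K1 *
          (R0 / 4 ^ m * AA σ R0 m x ^ q + tt σ (R0 / 4 ^ m) x) := by
          refine Finset.sum_le_sum fun m hm => ?_
          exact loc_int hn hq σ hR0 hC htest x m N (by simp at hm; omega)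
      _ ≤ ∑ m ∈ Finset.range (N + 1), K1 *
          (R0 / 4 ^ m * AA σ R0 m x ^ q + tt σ (R0 / 4 ^ m) x) := by
          rw [Finset.sum_range_succ]
          have h1 := tt_nonneg σ hrN0 x
          have : 0 ≤ K1 * (R0 / 4 ^ N * AA σ R0 N x ^ q + tt σ (R0 / 4 ^ N) x) := by positivity
          linarith
      _ = K1 * (∑ m ∈ Finset.range (N + 1), R0 / 4 ^ m * AA σ R0 m x ^ q +
          ∑ m ∈ Finset.range (N + 1), tt σ (R0 / 4 ^ m) x) := by
          rw [← Finset.mul_sum, Finset.sum_add_distrib]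
      _ ≤ K1 * (4 / 3 * (q * G) * AA σ R0 N x + c * AA σ R0 N x) := by
          refine mul_le_mul_of_nonneg_left (add_le_add ?_ (tt_sum σ hR0 x N)) hK10
          exact seq_S4 hq.le hR0.le (a := fun j => aa σ R0 j x) (A := fun j => AA σ R0 j x)
            (fun k => aa_nonneg σ hR0 k x) (AA_zero σ R0 x) (fun k => AA_succ σ R0 k x) (hgr x) N
      _ = _ := by ring
  have hs2 : cS n * (R0 / 4 ^ (N + 1)) * (c ^ q * f x) ≤ c ^ q * cS n * G * AA σ R0 N x := by
    have h1 := hgr x N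
    have h2 : f x ≤ AA σ R0 N x ^ (q - 1) * AA σ R0 N x := by
      have := conv_ineq hq.le le_rfl hf0
      simp only [hf]
      rcases hf0.eq_or_lt with h | h
      · rw [← h, Real.zero_rpow (by linarith)]; simp
      · rw [← Real.rpow_add_one h.ne']; apply le_of_eq; congr 1; ring
    have h3 : 0 ≤ c ^ q * cS n := by positivity
    calc _ = c ^ q * cS n * (R0 / 4 ^ (N + 1) * f x) := by ring
      _ ≤ c ^ q * cS n * (R0 / 4 ^ N * (AA σ R0 N x ^ (q - 1) * AA σ R0 N x)) := by
          refine mul_le_mul_of_nonneg_left ?_ h3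
          refine mul_le_mul (by linarith) h2 (hfn x) hrN0.le
      _ = c ^ q * cS n * ((R0 / 4 ^ N * AA σ R0 N x ^ (q - 1)) * AA σ R0 N x) := by ring
      _ ≤ c ^ q * cS n * (G * AA σ R0 N x) := by
          refine mul_le_mul_of_nonneg_left (mul_le_mul_of_nonneg_right h1 hf0) h3
      _ = _ := by ring
  calc _ ≤ _ := hup
    _ ≤ _ := add_le_add hs1 hs2
    _ = _ := by ring


lemma ker_meas' (n : ℕ) : Measurable (fun z : Euc n => (‖z‖ ^ (n - 1))⁻¹) :=
  ((measurable_norm).pow_const _).inv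

lemma prodInt {n : ℕ} (hn : 2 ≤ n) {w : Euc n → ℝ} (hw : Continuous w) (hc : HasCompactSupport w)
    (τ : Measure (Euc n)) [IsFiniteMeasure τ] :
    Integrable (fun z : Euc n × Euc n => w z.1 * (‖z.1 - z.2‖ ^ (n - 1))⁻¹)
      ((volume : Measure (Euc n)).prod τ) := by
  obtain ⟨M, hM⟩ := hc.exists_bound_of_continuous hw
  have hM0 : 0 ≤ M := (norm_nonneg _).trans (hM 0)
  obtain ⟨r, hr⟩ := hc.isCompact.isBounded.subset_ball 0
  have hmeas : Measurable (fun z : Euc n × Euc n => w z.1 * (‖z.1 - z.2‖ ^ (n - 1))⁻¹) :=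
    (hw.measurable.comp measurable_fst).mul
      ((ker_meas' n).comp (measurable_fst.sub measurable_snd))
  have hdom : ∀ y : Euc n, Integrable (fun x => M * ((ball y 1).indicator
      (fun x => (‖x - y‖ ^ (n - 1))⁻¹) x + (ball 0 r).indicator (fun _ => (1 : ℝ)) x)) := by
    intro y
    refine Integrable.const_mul (Integrable.add ?_ ?_) M
    · rw [integrable_indicator_iff measurableSet_ball]; exact ker_integrableOn' hn y 1
    · rw [integrable_indicator_iff measurableSet_ball]
      exact integrableOn_const measure_ball_lt_top.ne
  have hle : ∀ x y : Euc n, ‖w x * (‖x - y‖ ^ (n - 1))⁻¹‖ ≤ M * ((ball y 1).indicator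
      (fun x => (‖x - y‖ ^ (n - 1))⁻¹) x + (ball 0 r).indicator (fun _ => (1 : ℝ)) x) := by
    intro x y
    have hk : 0 ≤ (‖x - y‖ ^ (n - 1))⁻¹ := by positivity
    have hi2 : 0 ≤ (ball 0 r).indicator (fun _ => (1 : ℝ)) x :=
      Set.indicator_nonneg (fun _ _ => zero_le_one) _
    rw [norm_mul, Real.norm_of_nonneg hk]
    by_cases h : x ∈ ball y 1
    · rw [Set.indicator_of_mem h]
      exact mul_le_mul (hM x) (by linarith) hk hM0
    · rw [Set.indicator_of_notMem h]
      by_cases hx : w x = 0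
      · rw [hx]; simp; positivity
      · have : x ∈ ball (0 : Euc n) r := hr (subset_tsupport _ hx)
        rw [Set.indicator_of_mem this, zero_add]
        refine mul_le_mul (hM x) ?_ hk hM0
        apply inv_le_one_of_one_le₀
        apply one_le_pow₀
        simpa [mem_ball, dist_eq_norm] using h
  have hint : ∀ y : Euc n, Integrable (fun x => w x * (‖x - y‖ ^ (n - 1))⁻¹) := by
    intro y
    refine (hdom y).mono' ?_ (Eventually.of_forall fun x => hle x y)
    exact (hw.measurable.mul ((ker_meas' n).comp (measurable_id.sub_const y))).aestronglyMeasurable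
  rw [integrable_prod_iff' hmeas.aestronglyMeasurable]
  refine ⟨Eventually.of_forall fun y => hint y, ?_⟩
  refine (integrable_const (M * (cS n * 1 + volume.real (ball (0 : Euc n) r)))).mono'
    ?_ (Eventually.of_forall fun y => ?_)
  · exact hmeas.aestronglyMeasurable.norm.prod_swap.integral_prod_right'
  · rw [Real.norm_of_nonneg (by positivity)]
    refine (integral_mono (hint y).norm (hdom y) (fun x => hle x y)).trans (le_of_eq ?_)
    rw [integral_const_mul, integral_add, integral_indicator measurableSet_ball,
      integral_indicator measurableSet_ball, ker_integral' hn y zero_le_one]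
    · simp
    · rw [integrable_indicator_iff measurableSet_ball]; exact ker_integrableOn' hn y 1
    · rw [integrable_indicator_iff measurableSet_ball]
      exact integrableOn_const measure_ball_lt_top.ne

/-- the weighted measure -/
def muN {n : ℕ} (σ : Measure (Euc n)) (R0 q r : ℝ) (N : ℕ) : Measure (Euc n) :=
  (volume.restrict (ball 0 r)).withDensity (fun x => ENNReal.ofReal (AA σ R0 N x ^ q))

section
variable {n : ℕ} (σ : Measure (Euc n)) [IsFiniteMeasure σ] {R0 : ℝ} (hR0 : 0 < R0) {q : ℝ}
  (hq : 0 ≤ q) (r : ℝ) (N : ℕ)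
include hR0 hq

lemma muN_fin : IsFiniteMeasure (muN σ R0 q r N) :=
  haveI : IsFiniteMeasure (volume.restrict (ball (0 : Euc n) r)) :=
    ⟨by rw [Measure.restrict_apply_univ]; exact measure_ball_lt_top⟩
  isFiniteMeasure_withDensity_ofReal
    ((AAq_int σ hR0 hq N (volume.restrict (ball 0 r)) : Integrable _ _).2)

lemma muN_int (f : Euc n → ℝ) :
    ∫ x, f x ∂(muN σ R0 q r N) = ∫ x in ball 0 r, AA σ R0 N x ^ q * f x := by
  rw [muN, integral_withDensity_eq_integral_toReal_smul]
  · refine integral_congr_ae (Eventually.of_forall fun x => ?_)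
    simp only [smul_eq_mul]
    rw [ENNReal.toReal_ofReal (Real.rpow_nonneg (AA_nonneg σ hR0 N x) _)]
  · exact (AAq_cont σ hR0 hq N).measurable.ennreal_ofReal
  · exact Eventually.of_forall fun x => ENNReal.ofReal_lt_top
end

lemma stepD {n : ℕ} (hn : 2 ≤ n) {p q : ℝ} (hpq : p.HolderConjugate q) (σ : Measure (Euc n))
    [IsFiniteMeasure σ] {CT : ℝ} (hCT : 0 ≤ CT) (hT : HypT σ p CT) {R0 : ℝ} (hR0 : 0 < R0) :
    ∃ C : ℝ, 0 ≤ C ∧ ∀ (N : ℕ) (ψ : Euc n → ℝ), IsTest n (ball 0 (R0 / 8)) ψ → (∀ x, 0 ≤ ψ x) →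
      ∫ x, ψ x ∂(muN σ R0 q (R0 / 8) N) ≤ C * ∫ x in ball 0 (R0 / 8), AA σ R0 N x * ‖fderiv ℝ ψ x‖ := by
  obtain ⟨C, hC, hst⟩ := stepC hn hpq σ hCT hT hR0
  have hcs := cS_pos hn
  have hq0 : 0 ≤ q := hpq.symm.nonneg
  refine ⟨C / cS n, by positivity, fun N ψ hψ hψ0 => ?_⟩
  have := muN_fin σ hR0 hq0 (R0 / 8) N
  obtain ⟨h1, h2, h3⟩ := hψ
  set μ := muN σ R0 q (R0 / 8) N with hμ
  have hdc : Continuous (fun x => ‖fderiv ℝ ψ x‖) := (h1.continuous_fderiv (by simp)).norm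
  have hds : HasCompactSupport (fun x => ‖fderiv ℝ ψ x‖) := (h2.fderiv (𝕜 := ℝ)).norm
  have hd0 : ∀ x, x ∉ ball (0 : Euc n) (R0 / 8) → ‖fderiv ℝ ψ x‖ = 0 := by
    intro x hx
    rw [norm_eq_zero]
    exact image_eq_zero_of_notMem_tsupport fun h => hx (h3 (tsupport_fderiv_subset ℝ h))
  have hP := prodInt hn hdc hds μ
  have hA : cS n * ∫ y, ψ y ∂μ ≤ ∫ y, (∫ x, ‖fderiv ℝ ψ x‖ * (‖x - y‖ ^ (n - 1))⁻¹) ∂μ := by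
    rw [← integral_const_mul]
    refine integral_mono ?_ hP.integral_prod_right (fun y => ?_)
    · exact (h1.continuous.integrable_of_hasCompactSupport h2).const_mul _
    · have := (rep_le hn (h1.of_le (by simp)) h2 y).1
      rwa [abs_of_nonneg (hψ0 y)] at this
  have hB : ∫ y, (∫ x, ‖fderiv ℝ ψ x‖ * (‖x - y‖ ^ (n - 1))⁻¹) ∂μ =
      ∫ x, ∫ y, ‖fderiv ℝ ψ x‖ * (‖x - y‖ ^ (n - 1))⁻¹ ∂μ := by
    exact (integral_integral_swap (f := fun x y => ‖fderiv ℝ ψ x‖ * (‖x - y‖ ^ (n - 1))⁻¹) hP).symm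
  have hD : ∫ x, ∫ y, ‖fderiv ℝ ψ x‖ * (‖x - y‖ ^ (n - 1))⁻¹ ∂μ ≤
      ∫ x, C * (AA σ R0 N x * ‖fderiv ℝ ψ x‖) := by
    refine integral_mono hP.integral_prod_left ?_ (fun x => ?_)
    · refine Integrable.const_mul ?_ _
      exact ((AA_cont σ hR0 N).mul hdc).integrable_of_hasCompactSupport hds.mul_left
    · simp only
      rw [integral_const_mul]
      by_cases hx : x ∈ ball (0 : Euc n) (R0 / 8)
      · rw [hμ, muN_int σ hR0 hq0]
        have h5 : ∫ y in ball 0 (R0 / 8), AA σ R0 N y ^ q * (‖x - y‖ ^ (n - 1))⁻¹ ≤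
            C * AA σ R0 N x := by
          refine le_trans ?_ (hst x N)
          obtain ⟨M, hM0, hM⟩ := AA_bdd σ hR0 N
          have e : ∀ y, AA σ R0 N y ^ q * (‖x - y‖ ^ (n - 1))⁻¹ =
              (‖y - x‖ ^ (n - 1))⁻¹ * AA σ R0 N y ^ q := by
            intro y; rw [norm_sub_rev, mul_comm]
          simp only [e]
          refine setIntegral_mono_set ?_ ?_ ?_
          · refine Integrable.mul_bdd (c := M ^ q) (ker_integrableOn' hn x _) ?_ ?_
            · exact (AAq_cont σ hR0 hq0 N).aestronglyMeasurable
            · refine Eventually.of_forall fun y => ?_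
              have := AA_nonneg σ hR0 N y
              rw [Real.norm_of_nonneg (by positivity)]
              exact Real.rpow_le_rpow this (hM y) hq0
          · refine Eventually.of_forall fun y => ?_
            have := AA_nonneg σ hR0 N y
            show (0:ℝ) ≤ _
            positivity
          · refine (LE.le.eventuallyLE fun y hy => ?_)
            rw [mem_ball] at hx hy ⊢
            have := dist_triangle_right y x 0
            linarith
        calc _ ≤ ‖fderiv ℝ ψ x‖ * (C * AA σ R0 N x) := by gcongr
          _ = _ := by ring
      · rw [hd0 x hx]; simp
  have hE : ∫ x, C * (AA σ R0 N x * ‖fderiv ℝ ψ x‖) =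
      C * ∫ x in ball 0 (R0 / 8), AA σ R0 N x * ‖fderiv ℝ ψ x‖ := by
    rw [integral_const_mul, setIntegral_eq_integral_of_forall_compl_eq_zero]
    intro x hx; rw [hd0 x hx, mul_zero]
  rw [div_mul_eq_mul_div, le_div_iff₀ hcs]
  linarith

lemma stepD2 {n : ℕ} (hn : 2 ≤ n) {p q : ℝ} (hpq : p.HolderConjugate q) (σ : Measure (Euc n))
    [IsFiniteMeasure σ] {CT : ℝ} (hCT : 0 ≤ CT) (hT : HypT σ p CT) {R0 : ℝ} (hR0 : 0 < R0) :
    ∃ C : ℝ, 0 ≤ C ∧ ∀ (N : ℕ) (φ : Euc n → ℝ), ContDiff ℝ (⊤ : ℕ∞) φ → HasCompactSupport φ →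
      (∀ x, 0 ≤ φ x) →
      ∫ x in ball 0 (R0 / 16), AA σ R0 N x ^ q * φ x ^ p ≤ C * ∫ x, (‖fderiv ℝ φ x‖ ^ p + φ x ^ p) := by
  obtain ⟨C, hC, hst⟩ := stepD hn hpq σ hCT hT hR0
  have hq0 : 0 ≤ q := hpq.symm.nonneg
  have hp := hpq.lt
  have hp0 : 0 ≤ p := by linarith
  have hL := etaL_pos n
  set c := etaL n * (2 * (R0 / 16))⁻¹ with hc
  have hc0 : 0 ≤ c := by positivity
  refine ⟨(p * (2 * C)) ^ p * (2 ^ p * (1 + c ^ p)), by positivity, fun N φ h1 h2 h0 => ?_⟩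
  have := muN_fin σ hR0 hq0 (R0 / 8) N
  obtain ⟨χ, k1, k2, k3, k4, k5, k6, k7⟩ := prod_cut (x0 := 0) (by positivity : 0 < R0 / 16) h1 h0
  rw [show 2 * (R0 / 16) = R0 / 8 by ring] at k3
  have hA := lemA hpq (isOpen_ball (x := (0 : Euc n)) (ε := R0 / 8))
    (μ := muN σ R0 q (R0 / 8) N) (g := fun x => AA σ R0 N x) (AA_nonneg σ hR0 N)
    (fun K _ hK => (AAq_cont σ hR0 hq0 N).continuousOn.integrableOn_compact hK)
    (by positivity : 0 ≤ 2 * C) (fun ψ hψ hψ0 => by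
      have := hst N ψ hψ hψ0
      rw [← muN_int σ hR0 hq0]; linarith) ⟨k1, k2, k3⟩ k4
  have hI1 : Integrable (fun x => ‖fderiv ℝ φ x‖ ^ p) := 
    cpow_int ((h1.continuous_fderiv (by simp)).norm) (h2.fderiv (𝕜 := ℝ)).norm hp volume
  have hI2 : Integrable (fun x => φ x ^ p) := cpow_int h1.continuous h2 hp volume
  have hI3 : Integrable (fun x => ‖fderiv ℝ χ x‖ ^ p) := 
    cpow_int ((k1.continuous_fderiv (by simp)).norm) (k2.fderiv (𝕜 := ℝ)).norm hp volume
  have hB : ∫ x, ‖fderiv ℝ χ x‖ ^ p ≤ (2 ^ p * (1 + c ^ p)) * ∫ x, (‖fderiv ℝ φ x‖ ^ p + φ x ^ p) := by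
    rw [← integral_const_mul]
    refine integral_mono hI3 ((hI1.add hI2).const_mul _) (fun x => ?_)
    have h3 := h0 x
    calc ‖fderiv ℝ χ x‖ ^ p ≤ (‖fderiv ℝ φ x‖ + c * φ x) ^ p :=
          Real.rpow_le_rpow (norm_nonneg _) (k7 x) hp0
      _ ≤ 2 ^ p * (‖fderiv ℝ φ x‖ ^ p + (c * φ x) ^ p) := two_rpow hp0 (norm_nonneg _) (by positivity)
      _ = 2 ^ p * (‖fderiv ℝ φ x‖ ^ p + c ^ p * φ x ^ p) := by rw [Real.mul_rpow hc0 h3]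
      _ ≤ _ := by
        have e1 : 0 ≤ ‖fderiv ℝ φ x‖ ^ p := by positivity
        have e2 : 0 ≤ φ x ^ p := by positivity
        have e3 : 0 ≤ c ^ p := by positivity
        rw [mul_assoc]
        gcongr
        nlinarith
  calc _ = ∫ x in ball 0 (R0 / 16), AA σ R0 N x ^ q * χ x ^ p := by
        refine setIntegral_congr_fun measurableSet_ball (fun x hx => ?_)
        simp only [k6 x hx]
    _ ≤ ∫ x in ball 0 (R0 / 8), AA σ R0 N x ^ q * χ x ^ p := by
        refine setIntegral_mono_set ?_ ?_ ?_
        · refine Integrable.integrableOn ?_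
          refine ((AAq_cont σ hR0 hq0 N).mul (k1.continuous.rpow_const fun _ => Or.inr hp0)).integrable_of_hasCompactSupport ?_
          refine HasCompactSupport.mul_left (k2.mono fun x hx hx' => hx ?_)
          simp only [hx']
          exact Real.zero_rpow (by linarith)
        · refine Eventually.of_forall fun y => ?_
          have := AA_nonneg σ hR0 N y
          have := k4 y
          show (0:ℝ) ≤ _
          positivity
        · exact (LE.le.eventuallyLE (ball_subset_ball (by linarith)))
    _ ≤ (p * (2 * C)) ^ p * ∫ x, ‖fderiv ℝ χ x‖ ^ p := by rw [← muN_int σ hR0 hq0]; exact hA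
    _ ≤ _ := by
        rw [mul_assoc ((p * (2 * C)) ^ p)]
        exact mul_le_mul_of_nonneg_left hB (by positivity)

lemma cap_ne {n : ℕ} (p : ℝ) {K : Set (Euc n)} (hK : IsCompact K) :
    {c : ℝ | ∃ φ : Euc n → ℝ, ContDiff ℝ (⊤ : ℕ∞) φ ∧ HasCompactSupport φ ∧
    (∀ x, 0 ≤ φ x ∧ φ x ≤ 1) ∧ (∀ x ∈ K, 1 ≤ φ x) ∧
    c = ∫ x, (‖gradient φ x‖ ^ p + φ x ^ p)}.Nonempty := by
  obtain ⟨r, hr0, hr⟩ := hK.isBounded.subset_ball_lt 0 0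
  obtain ⟨χ, k1, k2, k3, k4, k5, k6, k7⟩ := prod_cut (x0 := (0 : Euc n)) hr0
    (h := fun _ => 1) contDiff_const (fun _ => zero_le_one)
  exact ⟨_, χ, k1, k2, fun x => ⟨k4 x, k5 x⟩, fun x hx => (k6 x (hr hx)).ge, rfl⟩

lemma stepD3 {n : ℕ} (hn : 2 ≤ n) {p q : ℝ} (hpq : p.HolderConjugate q) (σ : Measure (Euc n))
    [IsFiniteMeasure σ] {CT : ℝ} (hCT : 0 ≤ CT) (hT : HypT σ p CT) {R0 : ℝ} (hR0 : 0 < R0) :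
    ∃ C : ℝ, 0 ≤ C ∧ ∀ (N : ℕ) (K : Set (Euc n)), IsCompact K → K ⊆ ball 0 (R0 / 16) →
      ∫ x in K, AA σ R0 N x ^ q ≤ C * cap1p n p K := by
  obtain ⟨C, hC, hst⟩ := stepD2 hn hpq σ hCT hT hR0
  have hq0 : 0 ≤ q := hpq.symm.nonneg
  have hp := hpq.lt
  have hp0 : 0 ≤ p := by linarith
  refine ⟨C + 1, by positivity, fun N K hK hKs => ?_⟩
  rw [mul_comm, ← div_le_iff₀ (by positivity)]
  refine le_csInf (cap_ne p hK) ?_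
  rintro _ ⟨φ, h1, h2, h3, h4, rfl⟩
  rw [div_le_iff₀ (by positivity), mul_comm]
  simp only [norm_gradient_eq]
  have hnn : 0 ≤ ∫ x, (‖fderiv ℝ φ x‖ ^ p + φ x ^ p) := 
    integral_nonneg fun x => by have := (h3 x).1; positivity
  have hcont : Continuous (fun x => AA σ R0 N x ^ q * φ x ^ p) :=
    (AAq_cont σ hR0 hq0 N).mul (h1.continuous.rpow_const fun _ => Or.inr hp0)
  have hII : Integrable (fun x => AA σ R0 N x ^ q * φ x ^ p) := by
    refine hcont.integrable_of_hasCompactSupport ?_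
    refine HasCompactSupport.mul_left (h2.mono fun x hx hx' => hx ?_)
    simp only [hx']
    exact Real.zero_rpow (by linarith)
  calc _ ≤ ∫ x in K, AA σ R0 N x ^ q * φ x ^ p := by
        refine setIntegral_mono_on ((AAq_cont σ hR0 hq0 N).continuousOn.integrableOn_compact hK)
          hII.integrableOn hK.measurableSet (fun x hx => ?_)
        have := AA_nonneg σ hR0 N x
        exact le_mul_of_one_le_right (by positivity) (Real.one_le_rpow (h4 x hx) hp0)
    _ ≤ ∫ x in ball 0 (R0 / 16), AA σ R0 N x ^ q * φ x ^ p := by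
        refine setIntegral_mono_set hII.integrableOn ?_ (LE.le.eventuallyLE hKs)
        refine Eventually.of_forall fun y => ?_
        have := AA_nonneg σ hR0 N y
        have := (h3 y).1
        show (0:ℝ) ≤ _
        positivity
    _ ≤ _ := hst N φ h1 h2 (fun x => (h3 x).1)
    _ ≤ _ := by nlinarith


lemma sig_fin {n : ℕ} {Ω : Set (Euc n)} {σ : Measure (Euc n)} {K : Set (Euc n)} (hK : IsCompact K)
    (hKΩ : K ⊆ Ω) (hK0 : σ Kᶜ = 0)
    (hσloc : ∀ x ∈ Ω, ∃ U : Set (Euc n), IsOpen U ∧ x ∈ U ∧ σ U < ⊤) : IsFiniteMeasure σ := by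
  have h1 : σ K < ⊤ := by
    refine hK.measure_lt_top_of_nhdsWithin fun x hx => ?_
    obtain ⟨U, hU, hxU, hfin⟩ := hσloc x (hKΩ hx)
    exact ⟨U, mem_nhdsWithin_of_mem_nhds (hU.mem_nhds hxU), hfin⟩
  constructor
  rw [← Set.union_compl_self K]
  exact (measure_union_le _ _).trans_lt (by rw [hK0, add_zero]; exact h1)

lemma exists_cut {n : ℕ} {Ω K : Set (Euc n)} (hΩ : IsOpen Ω) (hK : IsCompact K) (hKΩ : K ⊆ Ω) :
    ∃ χ : Euc n → ℝ, IsTest n Ω χ ∧ (∀ x, 0 ≤ χ x ∧ χ x ≤ 1) ∧ ∀ x ∈ K, χ x = 1 := by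
  obtain ⟨L, hL, hKL, hLΩ⟩ := exists_compact_between hK hΩ hKΩ
  obtain ⟨f, h1, h2, h3⟩ := exists_contMDiffMap_one_nhds_of_subset_interior
    (modelWithCornersSelf ℝ (Euc n)) (n := (⊤ : ℕ∞)) hK.isClosed hKL
  have hts : tsupport f ⊆ L := by
    refine closure_minimal (fun x hx => ?_) hL.isClosed
    by_contra h; exact hx (h2 x h)
  refine ⟨f, ⟨f.contMDiff.contDiff, hL.of_isClosed_subset (isClosed_tsupport _) hts,
    hts.trans hLΩ⟩, fun x => h3 x, fun x hx => h1.self_of_nhdsSet x hx⟩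

lemma hypT_of {n : ℕ} {p q : ℝ} (hpq : p.HolderConjugate q)
    {Ω : Set (Euc n)} (hΩo : IsOpen Ω) {σ : Measure (Euc n)} [IsFiniteMeasure σ]
    {K : Set (Euc n)} (hK : IsCompact K) (hKΩ : K ⊆ Ω) (hK0 : σ Kᶜ = 0)
    {V : Euc n → Euc n}
    (hloc : ∀ K : Set (Euc n), K ⊆ Ω → IsCompact K → IntegrableOn (fun x => ‖V x‖ ^ p) K volume)
    (heq : ∀ φ : Euc n → ℝ, IsTest n Ω φ →
      ∫ x in Ω, ‖V x‖ ^ (p - 2) * ⟪V x, gradient φ x⟫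
        = (∫ x in Ω, ‖V x‖ ^ p * φ x) + ∫ x, φ x ∂σ) :
    ∃ CT : ℝ, 0 ≤ CT ∧ HypT σ p CT := by
  have hp := hpq.lt
  have hp0 : 0 ≤ p := by linarith
  have hgq : ∀ x, (‖V x‖ ^ (p - 1)) ^ q = ‖V x‖ ^ p := fun x => rpow_conj1 hpq (norm_nonneg _)
  have hA : ∀ φ : Euc n → ℝ, IsTest n Ω φ → (∀ x, 0 ≤ φ x) →
      ∫ x, φ x ^ p ∂σ ≤ (p * 1) ^ p * ∫ x, ‖fderiv ℝ φ x‖ ^ p := by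
    intro φ hφ hφ0
    refine lemA hpq hΩo (g := fun x => ‖V x‖ ^ (p - 1)) (fun x => by positivity) ?_ zero_le_one ?_
      hφ hφ0
    · intro K' h1 h2
      simp only [hgq]
      exact hloc K' h1 h2
    · intro ψ hψ hψ0
      simp only [hgq]
      rw [← heq ψ hψ, one_mul]
      obtain ⟨h1, h2, h3⟩ := hψ
      refine (Real.le_norm_self _).trans ?_
      refine norm_integral_le_of_norm_le ?_ (Eventually.of_forall fun x => ?_)
      · have hI := hloc _ h3 h2
        have hI2 : IntegrableOn (fun x => ‖V x‖ ^ (p - 1)) (tsupport ψ) := by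
          have hc : IntegrableOn (fun _ : Euc n => (1:ℝ)) (tsupport ψ) :=
            integrableOn_const h2.isCompact.measure_lt_top.ne
          refine Integrable.mono' (hc.add hI) ?_ (Eventually.of_forall fun x => ?_)
          · have : (fun x => ‖V x‖ ^ (p - 1)) = fun x => (‖V x‖ ^ p) ^ ((p - 1) / p) := by
              ext x
              rw [← Real.rpow_mul (norm_nonneg _)]
              congr 1
              field_simp
            rw [this]
            exact (Real.continuous_rpow_const (by apply div_nonneg <;> linarith)).comp_aestronglyMeasurable hI.1
          · rw [Real.norm_of_nonneg (by positivity)]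
            show _ ≤ 1 + ‖V x‖ ^ p
            rcases le_total ‖V x‖ 1 with h | h
            · have := Real.rpow_le_one (norm_nonneg (V x)) h (by linarith : 0 ≤ p - 1)
              have : 0 ≤ ‖V x‖ ^ p := by positivity
              linarith
            · have := Real.rpow_le_rpow_of_exponent_le h (by linarith : p - 1 ≤ p)
              linarith
        have hdc : Continuous (fun x => ‖fderiv ℝ ψ x‖) := (h1.continuous_fderiv (by simp)).norm
        obtain ⟨M, hM⟩ := (h2.fderiv (𝕜 := ℝ)).exists_bound_of_continuous
          (h1.continuous_fderiv (by simp))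
        have hI3 : IntegrableOn (fun x => ‖V x‖ ^ (p - 1) * ‖fderiv ℝ ψ x‖) (tsupport ψ) :=
          Integrable.mul_bdd (c := M) hI2 hdc.aestronglyMeasurable
            (Eventually.of_forall fun x => by rw [norm_norm]; exact hM x)
        refine Integrable.integrableOn ?_
        rw [← integrableOn_iff_integrable_of_support_subset (s := tsupport ψ)]
        · exact hI3
        · intro x hx
          by_contra hx'
          apply hx
          have : fderiv ℝ ψ x = 0 :=
            image_eq_zero_of_notMem_tsupport fun h => hx' (tsupport_fderiv_subset ℝ h)
          simp [this]
      · rw [norm_mul, Real.norm_of_nonneg (by positivity : 0 ≤ ‖V x‖ ^ (p - 2)), ← norm_gradient_eq]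
        have e : ‖V x‖ ^ (p - 2) * ‖V x‖ = ‖V x‖ ^ (p - 1) := by
          by_cases h : ‖V x‖ = 0
          · rw [h, mul_zero, Real.zero_rpow (by linarith)]
          · rw [← Real.rpow_add_one h]; congr 1; ring
        rw [← e, mul_assoc]
        exact mul_le_mul_of_nonneg_left (norm_inner_le_norm _ _) (by positivity)
  obtain ⟨χ, ⟨c1, c2, c3⟩, c4, c5⟩ := exists_cut hΩo hK hKΩ
  obtain ⟨M, hM⟩ := (c2.fderiv (𝕜 := ℝ)).exists_bound_of_continuous
          (c1.continuous_fderiv (by simp))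
  have hM0 : 0 ≤ M := (norm_nonneg _).trans (hM 0)
  refine ⟨(p * 1) ^ p * (2 ^ p * (1 + M ^ p)), by positivity, fun φ h1 h2 h0 => ?_⟩
  have k1 : ContDiff ℝ (⊤ : ℕ∞) (fun x => χ x * φ x) := c1.mul h1
  have k2 : HasCompactSupport (fun x => χ x * φ x) := h2.mul_left
  have hI1 : Integrable (fun x => ‖fderiv ℝ φ x‖ ^ p) := 
    cpow_int ((h1.continuous_fderiv (by simp)).norm) (h2.fderiv (𝕜 := ℝ)).norm hp volume
  have hI2 : Integrable (fun x => φ x ^ p) := cpow_int h1.continuous h2 hp volume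
  have hI3 : Integrable (fun x => ‖fderiv ℝ (fun x => χ x * φ x) x‖ ^ p) := 
    cpow_int ((k1.continuous_fderiv (by simp)).norm) (k2.fderiv (𝕜 := ℝ)).norm hp volume
  have hB : ∫ x, ‖fderiv ℝ (fun x => χ x * φ x) x‖ ^ p ≤
      (2 ^ p * (1 + M ^ p)) * ∫ x, (‖fderiv ℝ φ x‖ ^ p + φ x ^ p) := by
    rw [← integral_const_mul]
    refine integral_mono hI3 ((hI1.add hI2).const_mul _) (fun x => ?_)
    have h3 := h0 x
    have k7 : ‖fderiv ℝ (fun x => χ x * φ x) x‖ ≤ ‖fderiv ℝ φ x‖ + M * φ x := by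
      rw [fderiv_fun_mul (c1.differentiable (by simp) x) (h1.differentiable (by simp) x)]
      refine (norm_add_le _ _).trans ?_
      rw [norm_smul, norm_smul, Real.norm_of_nonneg (c4 x).1, Real.norm_of_nonneg h3]
      have := hM x
      have := (c4 x).2
      have := norm_nonneg (fderiv ℝ φ x)
      nlinarith
    calc _ ≤ (‖fderiv ℝ φ x‖ + M * φ x) ^ p :=
          Real.rpow_le_rpow (norm_nonneg _) k7 hp0
      _ ≤ 2 ^ p * (‖fderiv ℝ φ x‖ ^ p + (M * φ x) ^ p) := two_rpow hp0 (norm_nonneg _) (by positivity)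
      _ = 2 ^ p * (‖fderiv ℝ φ x‖ ^ p + M ^ p * φ x ^ p) := by rw [Real.mul_rpow hM0 h3]
      _ ≤ _ := by
        have e1 : 0 ≤ ‖fderiv ℝ φ x‖ ^ p := by positivity
        have e2 : 0 ≤ φ x ^ p := by positivity
        have e3 : 0 ≤ M ^ p := by positivity
        rw [mul_assoc]
        gcongr
        nlinarith
  have hE : ∫ x, φ x ^ p ∂σ = ∫ x, (χ x * φ x) ^ p ∂σ := by
    refine integral_congr_ae ?_
    have : ∀ᵐ x ∂σ, x ∈ K := by rw [ae_iff]; exact hK0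
    filter_upwards [this] with x hx
    rw [c5 x hx, one_mul]
  rw [hE]
  refine (hA _ ⟨k1, k2, (tsupport_mul_subset_left).trans c3⟩
    (fun x => mul_nonneg (c4 x).1 (h0 x))).trans ?_
  rw [mul_assoc ((p * 1) ^ p)]
  exact mul_le_mul_of_nonneg_left hB (by positivity)


/-- the vector field -/
def FF {n : ℕ} (σ : Measure (Euc n)) (x : Euc n) : Euc n :=
  (cS n)⁻¹ • ∫ y, kerF n (x - y) ∂σ

lemma FF_meas {n : ℕ} (σ : Measure (Euc n)) [IsFiniteMeasure σ] : StronglyMeasurable (FF σ) := by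
  have : StronglyMeasurable (fun z : Euc n × Euc n => kerF n (z.1 - z.2)) :=
    ((ker_meas n).comp (measurable_fst.sub measurable_snd)).stronglyMeasurable
  exact StronglyMeasurable.const_smul (this.integral_prod_right' (ν := σ)) (cS n)⁻¹

lemma FF_div {n : ℕ} (hn : 2 ≤ n) (σ : Measure (Euc n)) [IsFiniteMeasure σ] {Ω : Set (Euc n)}
    {φ : Euc n → ℝ} (hφ : IsTest n Ω φ) :
    ∫ x, φ x ∂σ = - ∫ x in Ω, ⟪FF σ x, gradient φ x⟫ := by
  obtain ⟨h1, h2, h3⟩ := hφ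
  have hcs := cS_pos hn
  have hfc : Continuous (fderiv ℝ φ) := h1.continuous_fderiv (by simp)
  have hP := prodInt hn hfc.norm (h2.fderiv (𝕜 := ℝ)).norm σ
  have hb : ∀ x y : Euc n, ‖fderiv ℝ φ x (kerF n (x - y))‖ ≤
      ‖fderiv ℝ φ x‖ * (‖x - y‖ ^ (n - 1))⁻¹ := fun x y => by
    rw [← ker_norm hn]; exact (fderiv ℝ φ x).le_opNorm _
  have hm : StronglyMeasurable (fun z : Euc n × Euc n => fderiv ℝ φ z.1 (kerF n (z.1 - z.2))) := by
    have a1 : StronglyMeasurable (fun z : Euc n × Euc n => fderiv ℝ φ z.1) :=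
      (hfc.comp continuous_fst).stronglyMeasurable
    have a2 : StronglyMeasurable (fun z : Euc n × Euc n => kerF n (z.1 - z.2)) :=
      ((ker_meas n).comp (measurable_fst.sub measurable_snd)).stronglyMeasurable
    exact (isBoundedBilinearMap_apply (𝕜 := ℝ) (E := Euc n) (F := ℝ)).continuous.comp_stronglyMeasurable
      (a1.prodMk a2)
  have hQ : Integrable (fun z : Euc n × Euc n => fderiv ℝ φ z.1 (kerF n (z.1 - z.2)))
      ((volume : Measure (Euc n)).prod σ) :=
    hP.mono' hm.aestronglyMeasurable (Eventually.of_forall fun z => hb z.1 z.2)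
  have hA : ∫ y, φ y ∂σ = - ((cS n)⁻¹ * ∫ y, (∫ x, fderiv ℝ φ x (kerF n (x - y))) ∂σ) := by
    rw [← integral_const_mul, ← integral_neg]
    refine integral_congr_ae (Eventually.of_forall fun y => ?_)
    simp only
    rw [(rep hn (h1.of_le (by simp)) h2 y).2]
    field_simp
  have hB := integral_integral_swap (f := fun x y => fderiv ℝ φ x (kerF n (x - y))) hQ
  rw [hA, ← hB, ← integral_const_mul]
  congr 1
  rw [setIntegral_eq_integral_of_forall_compl_eq_zero]
  · refine integral_congr_ae ?_
    filter_upwards [hP.prod_right_ae] with x hx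
    have e1 : ⟪FF σ x, gradient φ x⟫ = fderiv ℝ φ x (FF σ x) := by
      rw [real_inner_comm, gradient, InnerProductSpace.toDual_symm_apply]
    rw [e1, FF, map_smul, smul_eq_mul]
    congr 1
    by_cases h0 : fderiv ℝ φ x = 0
    · simp [h0]
    · refine ContinuousLinearMap.integral_comp_comm _ ?_
      have hx2 := hx.const_mul (‖fderiv ℝ φ x‖)⁻¹
      refine hx2.mono' ?_ (Eventually.of_forall fun y => ?_)
      · exact ((ker_meas n).comp (measurable_const.sub measurable_id)).aestronglyMeasurable
      · rw [ker_norm hn, inv_mul_cancel_left₀ (norm_ne_zero_iff.2 h0)]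
  · intro x hx
    have : fderiv ℝ φ x = 0 :=
      image_eq_zero_of_notMem_tsupport fun h => hx (h3 (tsupport_fderiv_subset ℝ h))
    simp [gradient, this]

lemma FF_bound {n : ℕ} (hn : 2 ≤ n) (σ : Measure (Euc n)) [IsFiniteMeasure σ] {R0 : ℝ}
    (hR0 : 0 < R0) (hσ : ∀ᵐ y ∂σ, y ∈ ball (0 : Euc n) (R0 / 16)) {x : Euc n}
    (hx : x ∈ ball (0 : Euc n) (R0 / 16)) :
    ‖FF σ x‖ₑ ≤ ⨆ N, ENNReal.ofReal ((cS n)⁻¹ * (4 ^ (n - 1) * (1 + 4 ^ (n - 1))) * AA σ R0 N x) := by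
  have hcs := cS_pos hn
  have h1 : ‖∫ y, kerF n (x - y) ∂σ‖ₑ ≤
      ⨆ N, ENNReal.ofReal ((4 ^ (n - 1) * (1 + 4 ^ (n - 1))) * AA σ R0 N x) := by
    refine (enorm_integral_le_lintegral_enorm _).trans ?_
    have hpt : ∀ᵐ y ∂σ, ‖kerF n (x - y)‖ₑ ≤ ∑' m : ℕ,
        ENNReal.ofReal ((R0 / 4 ^ (m + 2)) ^ (n - 1))⁻¹ *
          (ball x (R0 / 4 ^ (m + 1))).indicator (fun _ => (1 : ℝ≥0∞)) y := by
      filter_upwards [hσ] with y hy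
      by_cases hxy : y = x
      · simp [hxy, kerF]
      · have hd : 0 < dist y x := dist_pos.2 hxy
        obtain ⟨N, hN⟩ : ∃ N : ℕ, R0 / 4 ^ (N + 1) < dist y x := by
          obtain ⟨N, hN⟩ := pow_unbounded_of_one_lt (R0 / dist y x) (by norm_num : (1:ℝ) < 4)
          refine ⟨N, ?_⟩
          rw [div_lt_iff₀ (by positivity)]
          rw [div_lt_iff₀ hd] at hN
          have : (4:ℝ) ^ N ≤ 4 ^ (N + 1) := pow_le_pow_right₀ (by norm_num) (by omega)
          nlinarith
        have hz : dist y x < R0 / 4 ^ 1 := by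
          rw [mem_ball] at hx hy
          have := dist_triangle_right y x 0
          linarith
        have hk := ker_split hR0 x y N hz
        rw [Set.indicator_of_notMem (s := ball x (R0 / 4 ^ (N + 1)))
          (by rw [mem_ball]; exact not_lt.2 hN.le), zero_mul, add_zero] at hk
        rw [← ofReal_norm, ker_norm hn, norm_sub_rev]
        refine (ENNReal.ofReal_le_ofReal hk).trans ?_
        rw [ENNReal.ofReal_sum_of_nonneg]
        · refine le_trans (le_of_eq (Finset.sum_congr rfl fun m _ => ?_)) (ENNReal.sum_le_tsum (Finset.range N))
          rw [ENNReal.ofReal_mul (by positivity)]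
          congr 1
          by_cases hm : y ∈ ball x (R0 / 4 ^ (m + 1))
          · simp only [Set.indicator_of_mem hm, ENNReal.ofReal_one]
          · simp only [Set.indicator_of_notMem hm, ENNReal.ofReal_zero]
        · intro m _
          exact mul_nonneg (by positivity) (Set.indicator_nonneg (fun _ _ => zero_le_one) _)
    refine (lintegral_mono_ae hpt).trans ?_
    rw [lintegral_tsum (fun m => ((measurable_const.indicator measurableSet_ball).const_mul _).aemeasurable),
      ENNReal.tsum_eq_iSup_nat]
    refine iSup_mono fun N => ?_
    have e : ∀ m, ∫⁻ y, ENNReal.ofReal ((R0 / 4 ^ (m + 2)) ^ (n - 1))⁻¹ *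
          (ball x (R0 / 4 ^ (m + 1))).indicator (fun _ => (1 : ℝ≥0∞)) y ∂σ =
        ENNReal.ofReal (4 ^ (n - 1) * tt σ (R0 / 4 ^ (m + 1)) x) := by
      intro m
      rw [lintegral_const_mul _ (measurable_const.indicator measurableSet_ball),
        lintegral_indicator measurableSet_ball, setLIntegral_const, one_mul,
        ← ofReal_measureReal, ← ENNReal.ofReal_mul (by positivity), tt]
      congr 1
      rw [← mul_assoc]
      congr 1
      rw [show R0 / 4 ^ (m + 2) = R0 / 4 ^ (m + 1) / 4 by rw [div_div, ← pow_succ], div_pow, inv_div]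
      rfl
    simp only [e]
    rw [← ENNReal.ofReal_sum_of_nonneg (fun m _ => mul_nonneg (by positivity) (tt_nonneg σ (by positivity) x)),
      ← Finset.mul_sum]
    refine ENNReal.ofReal_le_ofReal ?_
    rw [mul_assoc]
    refine mul_le_mul_of_nonneg_left ?_ (by positivity)
    refine le_trans ?_ (tt_sum σ hR0 x N)
    rw [Finset.sum_range_succ' _ N]
    have := tt_nonneg σ (by positivity : 0 < R0 / 4 ^ 0) x
    linarith
  rw [FF, enorm_smul]
  have e2 : ‖(cS n)⁻¹‖ₑ = ENNReal.ofReal (cS n)⁻¹ := by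
    rw [← ofReal_norm, Real.norm_of_nonneg (by positivity)]
  rw [e2]
  refine (mul_le_mul_right h1 _).trans (le_of_eq ?_)
  rw [ENNReal.mul_iSup]
  refine iSup_congr fun N => ?_
  rw [← ENNReal.ofReal_mul (by positivity), mul_assoc (cS n)⁻¹]

lemma FF_lint {n : ℕ} (hn : 2 ≤ n) (σ : Measure (Euc n)) [IsFiniteMeasure σ] {R0 : ℝ}
    (hR0 : 0 < R0) (hσ : ∀ᵐ y ∂σ, y ∈ ball (0 : Euc n) (R0 / 16)) {q : ℝ} (hq : 0 < q) :
    ∃ C : ℝ, 0 ≤ C ∧ ∀ (S : Set (Euc n)) (B : ℝ), MeasurableSet S → S ⊆ ball (0 : Euc n) (R0 / 16) →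
      (∀ N, ∫ x in S, AA σ R0 N x ^ q ≤ B) → ∫⁻ x in S, ‖FF σ x‖ₑ ^ q ≤ ENNReal.ofReal (C * B) := by
  have hcs := cS_pos hn
  set c := (cS n)⁻¹ * (4 ^ (n - 1) * (1 + 4 ^ (n - 1))) with hc
  have hc0 : 0 ≤ c := by positivity
  refine ⟨c ^ q, by positivity, fun S B hS hSs hB => ?_⟩
  have hpt : ∀ x ∈ S, ‖FF σ x‖ₑ ^ q ≤ ⨆ N, ENNReal.ofReal (c ^ q * AA σ R0 N x ^ q) := by
    intro x hx
    refine (ENNReal.rpow_le_rpow (FF_bound hn σ hR0 hσ (hSs hx)) hq.le).trans (le_of_eq ?_)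
    have := (ENNReal.orderIsoRpow q hq).map_iSup
      (fun N => ENNReal.ofReal (c * AA σ R0 N x))
    simp only [ENNReal.orderIsoRpow_apply] at this
    rw [this]
    refine iSup_congr fun N => ?_
    have h0 := AA_nonneg σ hR0 N x
    rw [ENNReal.ofReal_rpow_of_nonneg (by positivity) hq.le, Real.mul_rpow hc0 h0]
  refine (setLIntegral_mono' hS hpt).trans ?_
  rw [lintegral_iSup]
  · refine iSup_le fun N => ?_
    rw [← ofReal_integral_eq_lintegral_ofReal]
    · refine ENNReal.ofReal_le_ofReal ?_
      rw [integral_const_mul]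
      exact mul_le_mul_of_nonneg_left (hB N) (by positivity)
    · refine Integrable.const_mul ?_ _
      exact IntegrableOn.mono_set (t := ball (0 : Euc n) (R0 / 16))
        (cont_intOn (AAq_cont σ hR0 hq.le N) _ _) hSs
    · refine Eventually.of_forall fun x => ?_
      have h0 := AA_nonneg σ hR0 N x
      show (0:ℝ) ≤ _
      positivity
  · intro N
    exact ((AAq_cont σ hR0 hq.le N).measurable.const_mul _).ennreal_ofReal
  · intro N M hNM x
    refine ENNReal.ofReal_le_ofReal ?_
    refine mul_le_mul_of_nonneg_left ?_ (by positivity)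
    exact Real.rpow_le_rpow (AA_nonneg σ hR0 N x) (AA_mono σ hR0 x hNM) hq.le

lemma final {n : ℕ} (hn : 2 ≤ n) {p q : ℝ} (hpq : p.HolderConjugate q) (σ : Measure (Euc n))
    [IsFiniteMeasure σ] {CT : ℝ} (hCT : 0 ≤ CT) (hT : HypT σ p CT) {Ω : Set (Euc n)}
    (hΩo : IsOpen Ω) (hΩb : Bornology.IsBounded Ω) (hσΩ : ∀ᵐ y ∂σ, y ∈ Ω) :
    MemM1p n p Ω (fun x => ‖FF σ x‖ ^ (1 / (p - 1))) := by
  have hp := hpq.lt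
  have hp0 : 0 < p := by linarith
  have hq := hpq.symm.pos
  have hp1 : 0 < p - 1 := by linarith
  obtain ⟨r, hr0, hr⟩ := hΩb.subset_ball_lt 0 (0 : Euc n)
  set R0 := 16 * r with hR0d
  have hR0 : 0 < R0 := by positivity
  have hr16 : R0 / 16 = r := by rw [hR0d]; ring
  have hΩs : Ω ⊆ ball (0 : Euc n) (R0 / 16) := by rwa [hr16]
  have hσ : ∀ᵐ y ∂σ, y ∈ ball (0 : Euc n) (R0 / 16) := hσΩ.mono fun y hy => hΩs hy
  obtain ⟨C1, hC1, hL⟩ := FF_lint hn σ hR0 hσ hq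
  obtain ⟨C2, hC2, hD⟩ := stepD3 hn hpq σ hCT hT hR0
  obtain ⟨C3, hC3, hE⟩ := testing hn hpq σ hCT hT hR0
  have hσr : σ.restrict (ball 0 R0) = σ := by
    refine Measure.restrict_eq_self_of_ae_mem (hσ.mono fun y hy => ?_)
    exact ball_subset_ball (by linarith) hy
  have hqe : 1 / (p - 1) * p = q := by
    have := hpq.mul_eq_add
    field_simp
    linarith
  have hFe : ∀ x, ‖(‖FF σ x‖ ^ (1 / (p - 1)))‖ₑ ^ p = ‖FF σ x‖ₑ ^ q := by
    intro x
    rw [← ofReal_norm, ← ofReal_norm, Real.norm_of_nonneg (by positivity),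
      ← ENNReal.ofReal_rpow_of_nonneg (norm_nonneg _) (by positivity), ← ENNReal.rpow_mul, hqe]
  have hm : StronglyMeasurable (fun x => ‖FF σ x‖ ^ (1 / (p - 1))) :=
    (Real.continuous_rpow_const (by positivity)).comp_stronglyMeasurable (FF_meas σ).norm
  refine ⟨⟨hm.aestronglyMeasurable, ?_⟩, C1 * C2, by positivity, fun K hK hKc => ?_⟩
  · rw [eLpNorm_lt_top_iff_lintegral_rpow_enorm_lt_top (by simpa using hp0) ENNReal.ofReal_ne_top,
      ENNReal.toReal_ofReal hp0.le]
    simp only [hFe]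
    refine (hL Ω (C3 * σ.real (ball 0 R0)) hΩo.measurableSet hΩs (fun N => ?_)).trans_lt ENNReal.ofReal_lt_top
    · have h5 := hE 0 R0 N hR0 le_rfl
      rw [hσr] at h5
      refine le_trans (setIntegral_mono_set (cont_intOn (AAq_cont σ hR0 hq.le N) _ _) ?_ ?_) h5
      · refine Eventually.of_forall fun x => ?_
        have h0 := AA_nonneg σ hR0 N x
        show (0:ℝ) ≤ _
        positivity
      · exact LE.le.eventuallyLE (hΩs.trans (ball_subset_ball (by linarith)))
  · have h6 := hL K _ hKc.measurableSet (hK.trans hΩs) (fun N => hD N K hKc (hK.trans hΩs))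
    have hnn : 0 ≤ C2 * cap1p n p K := by
      refine le_trans ?_ (hD 0 K hKc (hK.trans hΩs))
      exact integral_nonneg fun x => Real.rpow_nonneg (AA_nonneg σ hR0 0 x) _
    simp only [← Real.norm_eq_abs]
    rw [integral_eq_lintegral_of_nonneg_ae (Eventually.of_forall fun x => by
        show (0:ℝ) ≤ _
        positivity)
      ((Real.continuous_rpow_const hp0.le).comp_stronglyMeasurable hm.norm).aestronglyMeasurable]
    rw [mul_assoc]
    refine ENNReal.toReal_le_of_le_ofReal (by positivity) ?_
    refine le_trans (le_of_eq (lintegral_congr fun x => ?_)) h6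
    rw [← hFe, ← ofReal_norm, ENNReal.ofReal_rpow_of_nonneg (norm_nonneg _) hp0.le]

/-- if `σ ≥ 0` is compactly supported in `Ω` and
`−Δ_p u = |∇u|^p + σ` has a `W^{1,p}_loc(Ω)` solution, then `σ = div F`
with `|F|^{1/(p−1)} ∈ M^{1,p}(Ω)`. -/
theorem statement11 (n : ℕ) (hn : 2 ≤ n) (p : ℝ) (hp : 1 < p)
    (Ω : Set (Euc n)) (hΩo : IsOpen Ω) (hΩb : Bornology.IsBounded Ω)
    (σ : Measure (Euc n))
    (hσsupp : ∃ K : Set (Euc n), IsCompact K ∧ K ⊆ Ω ∧ σ Kᶜ = 0)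
    (hσloc : ∀ x ∈ Ω, ∃ U : Set (Euc n), IsOpen U ∧ x ∈ U ∧ σ U < ⊤)
    (u : Euc n → ℝ) (V : Euc n → Euc n)
    (hloc : ∀ K : Set (Euc n), K ⊆ Ω → IsCompact K →
      IntegrableOn (fun x => |u x| ^ p) K volume ∧
      IntegrableOn (fun x => ‖V x‖ ^ p) K volume)
    (hgrad : IsWeakGrad n Ω u V)
    (heq : ∀ φ : Euc n → ℝ, IsTest n Ω φ →
      ∫ x in Ω, ‖V x‖ ^ (p - 2) * ⟪V x, gradient φ x⟫
        = (∫ x in Ω, ‖V x‖ ^ p * φ x) + ∫ x, φ x ∂σ) :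
    ∃ F : Euc n → Euc n,
      MemM1p n p Ω (fun x => ‖F x‖ ^ (1 / (p - 1))) ∧
      ∀ φ : Euc n → ℝ, IsTest n Ω φ →
        ∫ x, φ x ∂σ = - ∫ x in Ω, ⟪F x, gradient φ x⟫ := by
  have hpq : p.HolderConjugate p.conjExponent := Real.HolderConjugate.conjExponent hp
  obtain ⟨K, hK, hKΩ, hK0⟩ := hσsupp
  have := sig_fin hK hKΩ hK0 hσloc
  obtain ⟨CT, hCT, hT⟩ := hypT_of hpq hΩo hK hKΩ hK0 (fun K h1 h2 => (hloc K h1 h2).2) heq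
  have hae : ∀ᵐ y ∂σ, y ∈ K := by rw [ae_iff]; exact hK0
  exact ⟨FF σ, final hn hpq σ hCT hT hΩo hΩb (hae.mono fun y hy => hKΩ hy),
    fun φ hφ => FF_div hn σ hφ⟩

end
end

section
/- Let n ≥ 2, 1 < p < ∞, and let Ω ⊂ ℝⁿ be an open set. Let σ be a nonnegative locally finite Borel measure on Ω and suppose u ∈ W^{1,p}_loc(Ω) (i.e., u ∈ L^p_loc(Ω) with weak gradient ∇u ∈ L^p_loc(Ω; ℝⁿ)) satisfies ∫_Ω |∇u|^{p−2} ∇u · ∇φ dx = ∫_Ω |∇u|^p φ dx + ∫_Ω φ dσ for all φ ∈ C_c^∞(Ω). Then ∫_Ω |φ|^p dσ ≤ (p−1)^{p−1} ∫_Ω |∇φ|^p dx for all φ ∈ C_c^∞(Ω). -/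
open MeasureTheory Filter Real Metric Bornology
open scoped ENNReal RealInnerProductSpace Topology

noncomputable section

lemma aux_young (p : ℝ) (hp : 1 < p) (a b : ℝ) (ha : 0 ≤ a) (hb : 0 ≤ b) :
    p * (a ^ (p - 1) * b) ≤ a ^ p + (p - 1) ^ (p - 1) * b ^ p := by
  have hp1 : 0 < p - 1 := by linarith
  have hpq : p.HolderConjugate (p / (p - 1)) := Real.HolderConjugate.conjExponent hp
  set c : ℝ := (p - 1) ^ ((p - 1) / p) with hc
  have hcpos : 0 < c := Real.rpow_pos_of_pos hp1 _
  have h := Real.young_inequality_of_nonneg (a := c * b) (b := a ^ (p - 1) * c⁻¹)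
    (by positivity) (by positivity) hpq
  have e1 : (c * b) * (a ^ (p - 1) * c⁻¹) = a ^ (p - 1) * b := by
    field_simp
  have e2 : (c * b) ^ p = (p - 1) ^ (p - 1) * b ^ p := by
    rw [Real.mul_rpow hcpos.le hb, hc, ← Real.rpow_mul hp1.le]
    congr 2; field_simp
  have e3 : (a ^ (p - 1) * c⁻¹) ^ (p / (p - 1)) = a ^ p * (p - 1)⁻¹ := by
    rw [Real.mul_rpow (by positivity) (by positivity), ← Real.rpow_mul ha,
      Real.inv_rpow hcpos.le, hc, ← Real.rpow_mul hp1.le]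
    have i1 : (p - 1) * (p / (p - 1)) = p := by field_simp
    have i2 : (p - 1) / p * (p / (p - 1)) = 1 := by field_simp
    rw [i1, i2, Real.rpow_one]
  rw [e1, e2, e3] at h
  have := mul_le_mul_of_nonneg_left h (show 0 ≤ p by linarith)
  refine this.trans (le_of_eq ?_)
  generalize (p - 1) ^ (p - 1) * b ^ p = A
  generalize a ^ p = B
  have hp1' : p - 1 ≠ 0 := hp1.ne'
  have hp' : p ≠ 0 := by linarith
  generalize p - 1 = q at *
  field_simp
  ring

lemma aux_F (p δ : ℝ) (hδ : 0 < δ) (t : ℝ) :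
    HasDerivAt (fun t : ℝ => (t ^ 2 + δ) ^ (p / 2) - δ ^ (p / 2))
      (p * t * (t ^ 2 + δ) ^ (p / 2 - 1)) t := by
  have h1 : HasDerivAt (fun t : ℝ => t ^ 2 + δ) (2 * t) t := by
    simpa using (hasDerivAt_pow 2 t).add_const δ
  have h2 := (h1.rpow_const (p := p / 2) (Or.inl (by positivity))).sub_const (δ ^ (p / 2))
  refine HasDerivAt.congr_deriv h2 ?_
  ring

lemma aux_norm_grad {n : ℕ} (f : Euc n → ℝ) (x : Euc n) : ‖gradient f x‖ = ‖fderiv ℝ f x‖ := by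
  simp [gradient]

lemma aux_grad (n : ℕ) (p δ : ℝ) (hp : 1 < p) (hδ : 0 < δ) (φ : Euc n → ℝ) (x : Euc n)
    (hφ : DifferentiableAt ℝ φ x) :
    ‖gradient (fun x => (φ x ^ 2 + δ) ^ (p / 2) - δ ^ (p / 2)) x‖
      ≤ p * (Real.sqrt (φ x ^ 2 + δ)) ^ (p - 1) * ‖gradient φ x‖ := by
  have h := (aux_F p δ hδ (φ x)).comp_hasFDerivAt x hφ.hasFDerivAt
  have h' : fderiv ℝ (fun x => (φ x ^ 2 + δ) ^ (p / 2) - δ ^ (p / 2)) x = _ := h.fderiv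
  rw [aux_norm_grad, aux_norm_grad, h', norm_smul]
  gcongr
  have hs : 0 < φ x ^ 2 + δ := by positivity
  set s := φ x ^ 2 + δ with hsd
  rw [Real.norm_eq_abs, abs_mul, abs_mul, abs_of_pos (by linarith : 0 < p), mul_assoc,
    abs_of_pos (Real.rpow_pos_of_pos hs _)]
  gcongr
  have hle : |φ x| ≤ Real.sqrt s := Real.abs_le_sqrt (by rw [hsd]; linarith)
  calc |φ x| * s ^ (p / 2 - 1) ≤ Real.sqrt s * s ^ (p / 2 - 1) := by gcongr
    _ = Real.sqrt s ^ (p - 1) := by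
      rw [Real.sqrt_eq_rpow, ← Real.rpow_add hs, ← Real.rpow_mul hs.le]
      congr 1; ring

lemma aux_test (n : ℕ) (p δ : ℝ) (hδ : 0 < δ) (U : Set (Euc n)) (φ : Euc n → ℝ)
    (hφ : IsTest n U φ) :
    IsTest n U (fun x => (φ x ^ 2 + δ) ^ (p / 2) - δ ^ (p / 2)) := by
  obtain ⟨h1, h2, h3⟩ := hφ
  have hsub : tsupport (fun x => (φ x ^ 2 + δ) ^ (p / 2) - δ ^ (p / 2)) ⊆ tsupport φ := by
    apply closure_mono
    intro x hx
    rw [Function.mem_support] at hx ⊢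
    intro h0
    apply hx
    simp [h0]
  refine ⟨?_, h2.of_isClosed_subset (isClosed_tsupport _) hsub, hsub.trans h3⟩
  refine ContDiff.sub (ContDiff.rpow_const_of_ne ?_ ?_) contDiff_const
  · exact (h1.pow 2).add contDiff_const
  · intro x; positivity

lemma aux_main (n : ℕ) (p : ℝ) (hp : 1 < p)
    (Ω : Set (Euc n)) (hΩo : IsOpen Ω)
    (σ : Measure (Euc n))
    (hσloc : ∀ x ∈ Ω, ∃ U : Set (Euc n), IsOpen U ∧ x ∈ U ∧ σ U < ⊤)
    (V : Euc n → Euc n)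
    (hloc : ∀ K : Set (Euc n), K ⊆ Ω → IsCompact K →
      IntegrableOn (fun x => ‖V x‖ ^ p) K volume)
    (heq : ∀ φ : Euc n → ℝ, IsTest n Ω φ →
      ∫ x in Ω, ‖V x‖ ^ (p - 2) * ⟪V x, gradient φ x⟫
        = (∫ x in Ω, ‖V x‖ ^ p * φ x) + ∫ x, φ x ∂σ)
    (φ : Euc n → ℝ) (hφ : IsTest n Ω φ) (δ : ℝ) (hδ : 0 < δ) :
      ∫ x, |φ x| ^ p ∂σ ≤ (p - 1) ^ (p - 1) * (∫ x in Ω, ‖gradient φ x‖ ^ p)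
        + δ ^ (p / 2) * (σ.real (tsupport φ) + ∫ x in tsupport φ, ‖V x‖ ^ p) := by
  have hp0 : 0 < p := by linarith
  have hp1 : 0 < p - 1 := by linarith
  set h : Euc n → ℝ := fun x => (φ x ^ 2 + δ) ^ (p / 2) - δ ^ (p / 2) with hh
  have ht : IsTest n Ω h := aux_test n p δ hδ Ω φ hφ
  obtain ⟨h1, h2, h3⟩ := hφ
  set K := tsupport φ with hK
  have hKc : IsCompact K := h2
  have hKm : MeasurableSet K := (isClosed_tsupport φ).measurableSet
  have hσK : σ K < ⊤ := by
    refine hKc.measure_lt_top_of_nhdsWithin fun x hx => ?_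
    obtain ⟨U, hU, hxU, hUf⟩ := hσloc x (h3 hx)
    exact ⟨U, mem_nhdsWithin_of_mem_nhds (hU.mem_nhds hxU), hUf⟩
  have hφ0 : ∀ x, x ∉ K → φ x = 0 := fun x hx => image_eq_zero_of_notMem_tsupport hx
  have hφh : ∀ x, x ∉ K → h x = 0 := fun x hx => by simp [hh, hφ0 x hx]
  have hφc : Continuous φ := h1.continuous
  have hhc : Continuous h := ht.1.continuous
  have hgc : Continuous (fun x => ‖gradient φ x‖) := by
    simp_rw [aux_norm_grad]
    exact (h1.continuous_fderiv (by simp)).norm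
  have hg0 : ∀ x, x ∉ K → ‖gradient φ x‖ = 0 := fun x hx => by
    rw [aux_norm_grad, norm_eq_zero]
    exact image_eq_zero_of_notMem_tsupport fun hx' => hx (tsupport_fderiv_subset ℝ hx')
  -- integrability
  have iσ : ∀ f : Euc n → ℝ, Continuous f → (∀ x, x ∉ K → f x = 0) → Integrable f σ := by
    intro f hf hf0
    have : IntegrableOn f K σ := by
      obtain ⟨C, hC⟩ := hKc.exists_bound_of_continuousOn hf.continuousOn
      exact IntegrableOn.of_bound hσK hf.aestronglyMeasurable.restrict C
        ((ae_restrict_iff' hKm).2 (ae_of_all _ hC))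
    exact (integrableOn_iff_integrable_of_support_subset
      (Function.support_subset_iff'.2 hf0)).1 this
  have iV : IntegrableOn (fun x => ‖V x‖ ^ p) K volume := hloc K h3 hKc
  have iVi : Integrable (K.indicator fun x => ‖V x‖ ^ p) volume := by
    rwa [integrable_indicator_iff hKm]
  have iVh : Integrable (fun x => ‖V x‖ ^ p * h x) volume := by
    have : (fun x => ‖V x‖ ^ p * h x) = fun x => h x * (K.indicator fun x => ‖V x‖ ^ p) x := by
      funext x
      by_cases hx : x ∈ K
      · simp [hx, mul_comm]
      · simp [hx, hφh x hx]
    rw [this]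
    obtain ⟨C, hC⟩ := ht.2.1.exists_bound_of_continuous hhc
    exact iVi.bdd_mul hhc.aestronglyMeasurable (ae_of_all _ hC)
  have ig : Integrable (fun x => ‖gradient φ x‖ ^ p) volume := by
    refine Continuous.integrable_of_hasCompactSupport
      (hgc.rpow_const fun _ => Or.inr hp0.le) (HasCompactSupport.intro hKc fun x hx => ?_)
    rw [hg0 x hx, Real.zero_rpow hp0.ne']
  -- the bound of the left-hand side
  have hpt : ∀ x, ‖‖V x‖ ^ (p - 2) * ⟪V x, gradient h x⟫‖ ≤
      ‖V x‖ ^ p * h x + (p - 1) ^ (p - 1) * ‖gradient φ x‖ ^ p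
        + δ ^ (p / 2) * (K.indicator fun x => ‖V x‖ ^ p) x := by
    intro x
    have hgr := aux_grad n p δ hp hδ φ x (h1.differentiable (by simp) x)
    have hs : 0 < φ x ^ 2 + δ := by positivity
    by_cases hx : x ∈ K
    · have b1 : ‖‖V x‖ ^ (p - 2) * ⟪V x, gradient h x⟫‖ ≤ ‖V x‖ ^ (p - 1) * ‖gradient h x‖ := by
        rw [norm_mul, Real.norm_of_nonneg (by positivity)]
        rcases eq_or_ne (V x) 0 with h0 | h0
        · simp [h0]; positivity
        · have hVp : 0 < ‖V x‖ := norm_pos_iff.2 h0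
          calc _ ≤ ‖V x‖ ^ (p - 2) * (‖V x‖ * ‖gradient h x‖) := by
                gcongr; exact norm_inner_le_norm _ _
            _ = _ := by
                rw [← mul_assoc]; congr 1
                rw [← Real.rpow_add_one hVp.ne']; congr 1; ring
      have b2 := aux_young p hp (‖V x‖ * √(φ x ^ 2 + δ)) ‖gradient φ x‖ (by positivity)
        (by positivity)
      rw [Real.mul_rpow (by positivity) (by positivity),
        Real.mul_rpow (by positivity) (by positivity)] at b2
      have e : √(φ x ^ 2 + δ) ^ p = h x + δ ^ (p / 2) := by
        rw [hh, Real.sqrt_eq_rpow, ← Real.rpow_mul hs.le]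
        simp only [sub_add_cancel]
        congr 1; ring
      rw [e] at b2
      have b3 := mul_le_mul_of_nonneg_left hgr (show 0 ≤ ‖V x‖ ^ (p - 1) by positivity)
      rw [Set.indicator_of_mem hx]
      refine b1.trans (b3.trans ?_)
      linarith
    · have : ‖gradient h x‖ = 0 := by
        rw [hg0 x hx, mul_zero] at hgr
        exact le_antisymm hgr (norm_nonneg _)
      rw [norm_eq_zero] at this
      simp [this, hφh x hx, hx]
      positivity
  have hL := norm_integral_le_of_norm_le (μ := volume.restrict Ω)
    (((iVh.add (ig.const_mul _)).add (iVi.const_mul _)).restrict) (ae_of_all _ hpt)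
  have hI : ∫ x in Ω, (‖V x‖ ^ p * h x + (p - 1) ^ (p - 1) * ‖gradient φ x‖ ^ p
        + δ ^ (p / 2) * (K.indicator fun x => ‖V x‖ ^ p) x) =
      (∫ x in Ω, ‖V x‖ ^ p * h x) + (p - 1) ^ (p - 1) * (∫ x in Ω, ‖gradient φ x‖ ^ p)
        + δ ^ (p / 2) * ∫ x in K, ‖V x‖ ^ p := by
    have i12 : Integrable (fun x => ‖V x‖ ^ p * h x
        + (p - 1) ^ (p - 1) * ‖gradient φ x‖ ^ p) volume := iVh.add (ig.const_mul _)
    rw [integral_add i12.restrict (iVi.const_mul _).restrict,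
      integral_add iVh.restrict (ig.const_mul _).restrict, integral_const_mul,
      integral_const_mul, setIntegral_indicator hKm, Set.inter_eq_right.2 h3]
  have hL2 := (le_abs_self _).trans (hL.trans_eq hI)
  rw [heq h ht] at hL2
  -- lower bound for the integral of `h`
  have hlow : ∫ x, |φ x| ^ p ∂σ ≤ (∫ x, h x ∂σ) + δ ^ (p / 2) * σ.real K := by
    have iK : Integrable (K.indicator fun _ => δ ^ (p / 2)) σ := by
      rw [integrable_indicator_iff hKm]
      exact integrableOn_const hσK.ne
    have ih := iσ h hhc hφh
    have e : (∫ x, (h x + (K.indicator fun _ => δ ^ (p / 2)) x) ∂σ)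
        = (∫ x, h x ∂σ) + δ ^ (p / 2) * σ.real K := by
      rw [integral_add ih iK, integral_indicator_const _ hKm, smul_eq_mul, mul_comm]
    rw [← e]
    refine integral_mono (iσ _ (hφc.abs.rpow_const fun _ => Or.inr hp0.le) ?_) (ih.add iK) ?_
    · intro x hx
      simp [hφ0 x hx, hp0.ne']
    · intro x
      by_cases hx : x ∈ K
      · simp only [hh, Set.indicator_of_mem hx, sub_add_cancel]
        have : |φ x| ^ p = (φ x ^ 2) ^ (p / 2) := by
          rw [← sq_abs, ← Real.rpow_natCast, ← Real.rpow_mul (abs_nonneg _)]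
          congr 1; push_cast; ring
        rw [this]
        gcongr
        linarith
      · simp [hφh x hx, hx, hφ0 x hx, hp0.ne']
  linarith

/-- the weighted Poincaré–Sobolev inequality satisfied by the
datum `σ` of any local solution of `−Δ_p u = |∇u|^p + σ`. -/
theorem statement12 (n : ℕ) (hn : 2 ≤ n) (p : ℝ) (hp : 1 < p)
    (Ω : Set (Euc n)) (hΩo : IsOpen Ω)
    (σ : Measure (Euc n))
    (hσloc : ∀ x ∈ Ω, ∃ U : Set (Euc n), IsOpen U ∧ x ∈ U ∧ σ U < ⊤)
    (u : Euc n → ℝ) (V : Euc n → Euc n)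
    (hloc : ∀ K : Set (Euc n), K ⊆ Ω → IsCompact K →
      IntegrableOn (fun x => |u x| ^ p) K volume ∧
      IntegrableOn (fun x => ‖V x‖ ^ p) K volume)
    (hgrad : IsWeakGrad n Ω u V)
    (heq : ∀ φ : Euc n → ℝ, IsTest n Ω φ →
      ∫ x in Ω, ‖V x‖ ^ (p - 2) * ⟪V x, gradient φ x⟫
        = (∫ x in Ω, ‖V x‖ ^ p * φ x) + ∫ x, φ x ∂σ) :
    ∀ φ : Euc n → ℝ, IsTest n Ω φ →
      ∫ x, |φ x| ^ p ∂σ ≤ (p - 1) ^ (p - 1) * ∫ x in Ω, ‖gradient φ x‖ ^ p := by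
  intro φ hφ
  have hp0 : 0 < p / 2 := by linarith
  have hT : Tendsto (fun δ : ℝ => (p - 1) ^ (p - 1) * (∫ x in Ω, ‖gradient φ x‖ ^ p)
      + δ ^ (p / 2) * (σ.real (tsupport φ) + ∫ x in tsupport φ, ‖V x‖ ^ p)) (𝓝[>] 0)
      (𝓝 ((p - 1) ^ (p - 1) * (∫ x in Ω, ‖gradient φ x‖ ^ p)
      + (0 : ℝ) ^ (p / 2) * (σ.real (tsupport φ) + ∫ x in tsupport φ, ‖V x‖ ^ p))) := by
    refine Tendsto.mono_left ?_ nhdsWithin_le_nhds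
    exact (((Real.continuous_rpow_const hp0.le).tendsto 0).mul_const _).const_add _
  rw [Real.zero_rpow hp0.ne', zero_mul, add_zero] at hT
  refine ge_of_tendsto hT ?_
  filter_upwards [self_mem_nhdsWithin] with δ hδ
  exact aux_main n p hp Ω hΩo σ hσloc V (fun K h1 h2 => (hloc K h1 h2).2) heq φ hφ δ hδ


end
end

section
/- Let n ≥ 2 and 1 < p < ∞, and set κ = n/(n−p) if p < n and κ = 2 if p ≥ n. There exists a constant C = C(n, p) > 0 such that for every compact set K ⊂ ℝⁿ one has |K|^{1/κ} ≤ C · Cap_{1,p}(K), where |K| denotes the Lebesgue measure of K. -/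
open MeasureTheory Filter Real Metric Bornology
open scoped ENNReal RealInnerProductSpace Topology

noncomputable section

theorem pt_bound (p q : ℝ) (m : ℕ) (hq : 1 ≤ q) (hqp : q ≤ p) (hm : p ≤ m) (a b : ℝ)
    (ha : 0 ≤ a) (ha1 : a ≤ 1) (hb : 0 ≤ b) :
    ((a ^ m) * b) ^ q ≤ b ^ p + a ^ p := by
  rcases le_or_gt b a with h | h
  · have h1 : ((a ^ m) * b) ^ q ≤ a ^ p := by
      have : (a ^ m) * b ≤ a ^ p := by
        rcases ha.eq_or_lt with h0 | h0
        · have : b = 0 := by linarith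
          subst this
          simp; positivity
        calc (a ^ m) * b ≤ a ^ m * 1 := by gcongr; linarith
          _ = a ^ (m : ℝ) := by simp
          _ ≤ a ^ p := Real.rpow_le_rpow_of_exponent_ge h0 ha1 hm
      have h01 : a ^ p ≤ 1 := Real.rpow_le_one ha ha1 (by linarith)
      have hx0 : 0 ≤ (a ^ m) * b := by positivity
      calc ((a ^ m) * b) ^ q ≤ ((a ^ m) * b) ^ (1 : ℝ) :=
            Real.rpow_le_rpow_of_exponent_ge' hx0 (by linarith) (by norm_num) hq
        _ ≤ a ^ p := by simpa using this
    have : 0 ≤ b ^ p := by positivity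
    linarith
  · have hb0 : 0 < b := by linarith
    have h1 : ((a ^ m) * b) ^ q ≤ b ^ p := by
      rw [Real.mul_rpow (by positivity) hb]
      have e : b ^ p = b ^ (p - q) * b ^ q := by rw [← Real.rpow_add hb0]; simp
      rw [e]
      gcongr
      calc (a ^ m) ^ q ≤ (a ^ m) ^ (1 : ℝ) :=
            Real.rpow_le_rpow_of_exponent_ge' (by positivity) (pow_le_one₀ ha ha1) (by norm_num) hq
        _ = a ^ (m : ℝ) := by simp
        _ ≤ a ^ (p - q) := Real.rpow_le_rpow_of_exponent_ge' ha ha1 (by linarith) (by linarith)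
        _ ≤ b ^ (p - q) := Real.rpow_le_rpow ha h.le (by linarith)
    have : 0 ≤ a ^ p := by positivity
    linarith

theorem key (n : ℕ) (p : ℝ) (q : NNReal) (hq : 1 ≤ q) (hqp : (q : ℝ) ≤ p) (hqn : (q : ℝ) < n) :
    ∃ C : ℝ, 0 < C ∧ ∀ K : Set (Euc n), IsCompact K → ∀ φ : Euc n → ℝ,
      ContDiff ℝ (⊤ : ℕ∞) φ → HasCompactSupport φ →
      (∀ x, 0 ≤ φ x ∧ φ x ≤ 1) → (∀ x ∈ K, 1 ≤ φ x) →
      (volume K).toReal ^ (((n : ℝ) - q) / n) ≤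
        C * ∫ x, (‖gradient φ x‖ ^ p + φ x ^ p) := by
  obtain ⟨m, hm⟩ := exists_nat_ge p
  have hq1 : (1 : ℝ) ≤ q := by exact_mod_cast hq
  have hn0 : (0 : ℝ) < n := by linarith
  set p' : NNReal := ((n : ℝ) * q / (n - q)).toNNReal with hp'
  have hnq : (0 : ℝ) < n - q := by linarith
  have hp'r : (p' : ℝ) = (n : ℝ) * q / (n - q) := Real.coe_toNNReal _ (by positivity)
  have hp'0 : (0 : ℝ) < p' := by rw [hp'r]; positivity
  set A : NNReal := eLpNormLESNormFDerivOfEqInnerConst (volume : Measure (Euc n)) q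
  refine ⟨((A : ℝ) ^ (q : ℝ) + 1) * ((m : ℝ) + 1) ^ (q : ℝ), by positivity, ?_⟩
  intro K hK φ hφ hφc hφ01 hφK
  have hfr : Module.finrank ℝ (Euc n) = n := by simp
  set u : Euc n → ℝ := fun x => φ x ^ (m + 1) with hu
  have huc : ContDiff ℝ 1 u := (hφ.pow (m + 1)).of_le (by exact_mod_cast le_top)
  have husupp : HasCompactSupport u := hφc.comp_left (g := fun t : ℝ => t ^ (m + 1)) (by simp)
  have S := eLpNorm_le_eLpNorm_fderiv_of_eq_inner (volume : Measure (Euc n)) huc husupp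
    (p := q) (p' := p') hq (by rw [hfr]; exact_mod_cast hn0) (by
      rw [hfr, hp'r, NNReal.coe_inv]; field_simp)
  have hdiff : Differentiable ℝ φ := hφ.differentiable (by simp)
  -- gradient
  have hgrad : ∀ x, ‖gradient φ x‖ = ‖fderiv ℝ φ x‖ := by
    intro x; simp [gradient]
  have hfd : ∀ x, ‖fderiv ℝ u x‖ = ((m : ℝ) + 1) * (φ x ^ m * ‖gradient φ x‖) := by
    intro x
    rw [hgrad]
    have : fderiv ℝ u x = (((m : ℝ) + 1) * φ x ^ m) • fderiv ℝ φ x := by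
      have := ((hdiff x).hasFDerivAt.pow (m + 1)).fderiv
      simp only [hu]
      convert this using 1
      simp
    rw [this, norm_smul, Real.norm_of_nonneg]
    · ring
    · have := (hφ01 x).1; positivity
  have hgc : Continuous fun x => ‖gradient φ x‖ := by
    simp_rw [hgrad]
    exact (hφ.continuous_fderiv (by simp)).norm
  have hp0 : 0 < p := by linarith
  have hint : Integrable (fun x => ‖gradient φ x‖ ^ p + φ x ^ p) := by
    apply Continuous.integrable_of_hasCompactSupport
    · exact (hgc.rpow_const (fun x => Or.inr hp0.le)).add
        (hφ.continuous.rpow_const (fun x => Or.inr hp0.le))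
    · apply HasCompactSupport.add
      · simp_rw [hgrad]
        exact (hφc.fderiv ℝ).comp_left (g := fun t => ‖t‖ ^ p) (by simp [hp0.ne'])
      · exact hφc.comp_left (g := fun t : ℝ => t ^ p) (by simp [hp0.ne'])
  set c := ∫ x, (‖gradient φ x‖ ^ p + φ x ^ p) with hc
  have hnn : ∀ x, 0 ≤ ‖gradient φ x‖ ^ p + φ x ^ p := by
    intro x; have := (hφ01 x).1; positivity
  have hc0 : 0 ≤ c := integral_nonneg hnn
  have R : eLpNorm (fderiv ℝ u) q volume ^ (q : ℝ) ≤
      ENNReal.ofReal (((m : ℝ) + 1) ^ (q : ℝ) * c) := by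
    rw [eLpNorm_nnreal_pow_eq_lintegral (by positivity), hc, ← integral_const_mul,
      ofReal_integral_eq_lintegral_ofReal (hint.const_mul _)
        (Eventually.of_forall fun x => mul_nonneg (by positivity) (hnn x))]
    apply lintegral_mono
    intro x
    have h0 := (hφ01 x).1
    simp only
    rw [← ofReal_norm, ENNReal.ofReal_rpow_of_nonneg (norm_nonneg _) (by positivity)]
    apply ENNReal.ofReal_le_ofReal
    rw [hfd, Real.mul_rpow (by positivity) (by positivity)]
    gcongr
    exact pt_bound p q m hq1 hqp hm _ _ h0 (hφ01 x).2 (norm_nonneg _)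
  have L : volume K ^ (1 / (p' : ℝ)) ≤ eLpNorm u p' volume := by
    have h1 := eLpNorm_indicator_const (μ := volume) (c := (1 : ℝ)) (p := (p' : ℝ≥0∞))
      hK.measurableSet (by simpa using (NNReal.coe_pos.1 hp'0).ne') (by simp)
    simp only [enorm_one, one_mul, ENNReal.coe_toReal] at h1
    rw [← h1]
    apply eLpNorm_mono
    intro x
    by_cases hx : x ∈ K
    · have : φ x = 1 := le_antisymm (hφ01 x).2 (hφK x hx)
      simp [hx, hu, this]
    · simp [hx]
  have T : ENNReal.ofReal ((volume K).toReal ^ (((n : ℝ) - q) / n)) ≤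
      ENNReal.ofReal ((A : ℝ) ^ (q : ℝ) * (((m : ℝ) + 1) ^ (q : ℝ) * c)) := by
    rw [← ENNReal.ofReal_rpow_of_nonneg (by positivity) (by positivity),
      ENNReal.ofReal_toReal hK.measure_lt_top.ne, ENNReal.ofReal_mul (by positivity)]
    have e : ((n : ℝ) - q) / n = (1 / (p' : ℝ)) * q := by rw [hp'r]; field_simp
    rw [e, ENNReal.rpow_mul, ← ENNReal.ofReal_rpow_of_nonneg (by positivity) (by positivity)]
    refine (ENNReal.rpow_le_rpow (L.trans S) (by positivity)).trans ?_
    rw [ENNReal.mul_rpow_of_nonneg _ _ (by positivity)]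
    simp only [ENNReal.ofReal_coe_nnreal]
    gcongr
  have T' := (ENNReal.ofReal_le_ofReal_iff (by positivity)).1 T
  have : 0 ≤ ((m : ℝ) + 1) ^ (q : ℝ) * c := by positivity
  linarith

/-- isocapacitary inequality `|K|^{1/κ} ≤ C · Cap_{1,p}(K)`,
where `κ = n/(n−p)` if `p < n` and `κ = 2` if `p ≥ n`. -/
theorem statement14 (n : ℕ) (hn : 2 ≤ n) (p : ℝ) (hp : 1 < p) :
    ∃ C : ℝ, 0 < C ∧
      ∀ K : Set (Euc n), IsCompact K →
        (volume K).toReal ^ (1 / (if p < (n : ℝ) then (n : ℝ) / ((n : ℝ) - p) else 2))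
          ≤ C * cap1p n p K := by
  have hn2 : (2 : ℝ) ≤ n := by exact_mod_cast hn
  obtain ⟨r, hr, hqp, hqn, he⟩ : ∃ q : ℝ, 1 ≤ q ∧ q ≤ p ∧ q < n ∧
      (1 / (if p < (n : ℝ) then (n : ℝ) / ((n : ℝ) - p) else 2)) = ((n : ℝ) - q) / n := by
    by_cases h : p < n
    · exact ⟨p, hp.le, le_rfl, h, by simp [h]⟩
    · refine ⟨n / 2, by linarith, by linarith, by linarith, ?_⟩
      rw [if_neg h]; field_simp; ring
  lift r to NNReal using (by linarith) with q
  have hq : 1 ≤ q := by exact_mod_cast hr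
  obtain ⟨C, hC, H⟩ := key n p q hq hqp hqn
  refine ⟨C, hC, fun K hK => ?_⟩
  rw [he, ← div_le_iff₀' hC]
  apply le_csInf
  · obtain ⟨R, hR0, hR⟩ := hK.isBounded.subset_closedBall_lt 0 (0 : Euc n)
    let f : ContDiffBump (0 : Euc n) := ⟨R, R + 1, hR0, by linarith⟩
    exact ⟨_, f, f.contDiff, f.hasCompactSupport, fun x => ⟨f.nonneg, f.le_one⟩,
      fun x hx => (f.one_of_mem_closedBall (hR hx)).ge, rfl⟩
  · rintro c ⟨φ, h1, h2, h3, h4, rfl⟩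
    rw [div_le_iff₀' hC]
    exact H K hK φ h1 h2 h3 h4

end
end
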